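/- For every prime p ≥ 5 and every integer n ≥ 7, Ψ_{n,3}^p = 5p + 2·gcd(p-1,3) + gcd(p-1,4) + c(n), where c(7) = 59, c(8) = 61, and c(n) = 62 for n ≥ 9. -/

import Mathlib

/-- The multiplication extracted from a group structure. -/
def mulOfGroup (G : Type) (s : Group G) : Mul G := by letI := s; infer_instance

/-- The number of isomorphism classes of groups of order `N` whose group structure
satisfies the predicate `Q`. -/
noncomputable def groupClassCount (N : ℕ) (Q : Group (Fin N) → Prop) : ℕ :=
  Nat.card (Quot fun s t : {s : Group (Fin N) // Q s} =>
    Nonempty (@MulEquiv (Fin N) (Fin N) (mulOfGroup _ s.1) (mulOfGroup _ t.1)))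

/-- `Ψ_{n,f}^p`: the number of isomorphism classes of groups of order `p ^ n`
with coexponent `f`, i.e. with exponent `p ^ e` where `n - e = f`. -/
noncomputable def PsiCoexp (p n f : ℕ) : ℕ :=
  groupClassCount (p ^ n) fun s =>
    letI := s
    ∃ e : ℕ, Monoid.exponent (Fin (p ^ n)) = p ^ e ∧ n - e = f


set_option linter.all false

structure LS (A : Type) [AddCommGroup A] where
  br : A → A → A
  add_l : ∀ a b c, br (a + b) c = br a c + br b c
  add_r : ∀ a b c, br a (b + c) = br a b + br a c
  self : ∀ a, br a a = 0
  jac : ∀ a b c, br (br a b) c = br a (br b c) - br b (br a c)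
  nil : ∀ a b c d e, br a (br b (br c (br d e))) = 0

namespace LS
variable {A : Type} [AddCommGroup A] (s : LS A)

lemma zero_l (a : A) : s.br 0 a = 0 := by
  have := s.add_l 0 0 a; simpa using this
lemma zero_r (a : A) : s.br a 0 = 0 := by
  have := s.add_r a 0 0; simpa using this
lemma neg_l (a b : A) : s.br (-a) b = - s.br a b := by
  have := s.add_l a (-a) b
  rw [add_neg_cancel, zero_l] at this
  exact (neg_eq_of_add_eq_zero_right this.symm).symm
lemma neg_r (a b : A) : s.br a (-b) = - s.br a b := by
  have := s.add_r a b (-b)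
  rw [add_neg_cancel, zero_r] at this
  exact (neg_eq_of_add_eq_zero_right this.symm).symm
lemma sub_l (a b c : A) : s.br (a - b) c = s.br a c - s.br b c := by
  rw [sub_eq_add_neg, s.add_l, neg_l, sub_eq_add_neg]
lemma sub_r (a b c : A) : s.br a (b - c) = s.br a b - s.br a c := by
  rw [sub_eq_add_neg, s.add_r, neg_r, sub_eq_add_neg]
lemma skew (a b : A) : s.br a b = - s.br b a := by
  have := s.self (a + b)
  rw [s.add_l, s.add_r, s.add_r, s.self, s.self] at this
  simp only [zero_add, add_zero] at this
  exact eq_neg_of_add_eq_zero_left this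
def ad (a : A) : A →+ A := AddMonoidHom.mk' (s.br a) (s.add_r a)
def da (b : A) : A →+ A := AddMonoidHom.mk' (fun a => s.br a b) (fun x y => s.add_l x y b)
lemma zsmul_r (n : ℤ) (a b : A) : s.br a (n • b) = n • s.br a b := map_zsmul (s.ad a) n b
lemma zsmul_l (n : ℤ) (a b : A) : s.br (n • a) b = n • s.br a b := map_zsmul (s.da b) n a
lemma nsmul_r (n : ℕ) (a b : A) : s.br a (n • b) = n • s.br a b := map_nsmul (s.ad a) n b
lemma nsmul_l (n : ℕ) (a b : A) : s.br (n • a) b = n • s.br a b := map_nsmul (s.da b) n a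

def mul (x y : A) : A := x + y + (3:ℤ) • s.br x y
  + (3:ℤ) • (s.br x (s.br x y) - s.br y (s.br x y)) - (9:ℤ) • s.br y (s.br x (s.br x y))

lemma rel22 (a b c d : A) : s.br a (s.br b (s.br c d)) - s.br b (s.br a (s.br c d))
    = - (s.br c (s.br d (s.br a b)) - s.br d (s.br c (s.br a b))) := by
  rw [← s.jac, ← s.jac, skew]

lemma rel2 (a b : A) : s.br b (s.br a (s.br a b)) = s.br a (s.br b (s.br a b)) := by
  have := s.self (s.br a b)
  rw [s.jac] at this
  exact (sub_eq_zero.mp this).symm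

theorem mul_assoc (x y z : A) : s.mul (s.mul x y) z = s.mul x (s.mul y z) := by
  have h1 := s.skew y x
  have h2 := s.skew z x
  have h3 := s.skew z y
  have j : s.br z (s.br x y) = s.br y (s.br x z) - s.br x (s.br y z) := by
    rw [s.skew z (s.br x y), s.jac]; abel
  have r1 := s.rel2 x y
  have r2 := s.rel2 x z
  have r3 := s.rel2 y z
  have r4 : s.br z (s.br x (s.br x y)) = (2:ℤ) • s.br x (s.br y (s.br x z)) - s.br y (s.br x (s.br x z))
    - s.br x (s.br x (s.br y z)) := by
    have := s.rel22 x y x z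
    rw [j, s.sub_r] at this
    linear_combination (norm := module) (-1:ℤ) • this
  have r5 : s.br z (s.br y (s.br x y)) = s.br x (s.br y (s.br y z)) - (2:ℤ) • s.br y (s.br x (s.br y z))
    + s.br y (s.br y (s.br x z)) := by
    have := s.rel22 x y y z
    rw [j, s.sub_r] at this
    linear_combination (norm := module) (-1:ℤ) • this
  have r6 : s.br z (s.br y (s.br x z)) = s.br x (s.br z (s.br y z)) - s.br z (s.br x (s.br y z))
    + s.br y (s.br z (s.br x z)) := by
    have := s.rel22 x z y z
    linear_combination (norm := module) (-1:ℤ) • this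
  simp only [mul, s.add_l, s.add_r, zsmul_r, zsmul_l, sub_l, sub_r, neg_l, neg_r, s.self, s.jac, s.nil, h1, h2, h3, j,
    r1, r2, r3, r4, r5, r6, zero_l, zero_r, smul_zero, add_zero, zero_add, sub_zero, zero_sub, neg_zero]
  module

lemma conj (a b : A) : s.mul (s.mul a b) (-a) = b + (6:ℤ) • s.br a b + (18:ℤ) • s.br a (s.br a b)
    + (36:ℤ) • s.br a (s.br a (s.br a b)) := by
  have h1 := s.skew b a
  have r1 := s.rel2 a b
  simp only [mul, s.add_l, s.add_r, zsmul_r, zsmul_l, sub_l, sub_r, neg_l, neg_r, s.self, s.jac, s.nil, h1,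
    r1, zero_l, zero_r, smul_zero, add_zero, zero_add, sub_zero, zero_sub, neg_zero]
  module

def cm (a b : A) : A := s.mul (s.mul (s.mul a b) (-a)) (-b)

lemma cm_eq (a b : A) : s.cm a b = (6:ℤ) • s.br a b + (18:ℤ) • s.br a (s.br a b) + (18:ℤ) • s.br b (s.br a b)
    + (36:ℤ) • s.br a (s.br a (s.br a b)) + (54:ℤ) • s.br a (s.br b (s.br a b))
    + (36:ℤ) • s.br b (s.br b (s.br a b)) := by
  have h1 := s.skew b a
  have r1 := s.rel2 a b
  rw [cm, conj]
  simp only [mul, s.add_l, s.add_r, zsmul_r, zsmul_l, sub_l, sub_r, neg_l, neg_r, s.self, s.jac, s.nil, h1,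
    r1, zero_l, zero_r, smul_zero, add_zero, zero_add, sub_zero, zero_sub, neg_zero]
  module

lemma cm3 (a b c : A) : s.cm a (s.cm b c) = (36:ℤ) • s.br a (s.br b c) + (108:ℤ) • s.br a (s.br b (s.br b c))
    + (108:ℤ) • s.br a (s.br c (s.br b c)) + (108:ℤ) • s.br a (s.br a (s.br b c)) := by
  simp only [cm_eq, s.add_l, s.add_r, zsmul_r, zsmul_l, sub_l, sub_r, neg_l, neg_r, s.self, s.jac, s.nil,
    zero_l, zero_r, smul_zero, add_zero, zero_add, sub_zero, zero_sub, neg_zero]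
  module

lemma cm4 (a b c d : A) : s.cm a (s.cm b (s.cm c d)) = (216:ℤ) • s.br a (s.br b (s.br c d)) := by
  simp only [cm_eq, s.add_l, s.add_r, zsmul_r, zsmul_l, sub_l, sub_r, neg_l, neg_r, s.self, s.jac, s.nil,
    zero_l, zero_r, smul_zero, add_zero, zero_add, sub_zero, zero_sub, neg_zero]
  module

lemma mul_zero' (a : A) : s.mul a 0 = a := by simp [mul, zero_r]
lemma zero_mul' (a : A) : s.mul 0 a = a := by simp [mul, zero_l, zero_r]
lemma mul_of_br {a b : A} (h : s.br a b = 0) : s.mul a b = a + b := by simp [mul, h, zero_r]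
lemma mul_neg' (a : A) : s.mul a (-a) = 0 := by
  rw [mul_of_br] <;> simp [neg_r, s.self]
lemma neg_mul' (a : A) : s.mul (-a) a = 0 := by
  rw [mul_of_br] <;> simp [neg_l, s.self]
lemma mul_rc {a b c : A} (h : s.mul a c = s.mul b c) : a = b := by
  have := congrArg (fun t => s.mul t (-c)) h
  simpa [mul_assoc, mul_neg', mul_zero'] using this
lemma mul_lc {a b c : A} (h : s.mul c a = s.mul c b) : a = b := by
  have := congrArg (fun t => s.mul (-c) t) h
  simpa [← mul_assoc, neg_mul', zero_mul'] using this

lemma br_of_comm (tf : ∀ a : A, (6:ℤ) • a = 0 → a = 0) {a b : A} (h : s.mul a b = s.mul b a) :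
    s.br a b = 0 := by
  have h0 : s.mul (s.mul a b) (-a) = b := by rw [h, mul_assoc, mul_neg', mul_zero']
  rw [conj] at h0
  have h1 : (6:ℤ) • s.br a b + (18:ℤ) • s.br a (s.br a b) + (36:ℤ) • s.br a (s.br a (s.br a b)) = 0 := by
    linear_combination (norm := module) (1:ℤ) • h0
  have h2 := congrArg (s.br a) h1
  have h3 := congrArg (s.br a) h2
  simp only [s.add_r, zsmul_r, s.nil, zero_r, smul_zero, add_zero] at h2 h3
  have h4 := tf _ h3
  rw [h4, smul_zero, add_zero] at h2
  have h5 := tf _ h2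
  rw [h5, zero_r, smul_zero, smul_zero, add_zero, add_zero] at h1
  exact tf _ h1

def cr (a b : A) : A := (3:ℤ) • s.br a b + ((-6:ℤ) • s.br a (s.br a b) + (-12:ℤ) • s.br b (s.br a b)
  + (9:ℤ) • s.br a (s.br a (s.br a b)) + (27:ℤ) • s.br a (s.br b (s.br a b))
  + (27:ℤ) • s.br b (s.br b (s.br a b)))

lemma mul_cr (a b : A) : s.mul (a + b) (s.cr a b) = s.mul a b := by
  have h1 := s.skew b a
  have r1 := s.rel2 a b
  simp only [cr, mul, s.add_l, s.add_r, zsmul_r, zsmul_l, sub_l, sub_r, neg_l, neg_r, s.self, s.jac, s.nil, h1,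
    r1, zero_l, zero_r, smul_zero, add_zero, zero_add, sub_zero, zero_sub, neg_zero]
  module

end LS

section hom
variable {A B : Type} [AddCommGroup A] [AddCommGroup B] (s : LS A) (t : LS B) (f : A → B)

lemma hom_zero (hf : ∀ a b, f (s.mul a b) = t.mul (f a) (f b)) : f 0 = 0 := by
  have := hf 0 0
  rw [s.mul_zero'] at this
  exact (t.mul_lc (a := 0) (c := f 0) (by rw [← this, t.mul_zero'])).symm
lemma hom_neg (hf : ∀ a b, f (s.mul a b) = t.mul (f a) (f b)) (a : A) : f (-a) = - f a := by
  have := hf a (-a)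
  rw [s.mul_neg', hom_zero s t f hf] at this
  exact t.mul_lc (c := f a) (by rw [← this, t.mul_neg'])
lemma hom_comm (tf : ∀ a : B, (6:ℤ) • a = 0 → a = 0) (hf : ∀ a b, f (s.mul a b) = t.mul (f a) (f b))
    {a b : A} (h : s.br a b = 0) : f (a + b) = f a + f b := by
  have h' : s.br b a = 0 := by rw [s.skew, h, neg_zero]
  have e1 := hf a b
  have e2 := hf b a
  rw [s.mul_of_br h] at e1
  rw [s.mul_of_br h', add_comm, e1] at e2
  rw [e1, t.mul_of_br (t.br_of_comm tf e2)]
lemma hom_nsmul (hf : ∀ a b, f (s.mul a b) = t.mul (f a) (f b))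
    (a : A) (n : ℕ) : f (n • a) = n • f a := by
  induction n with
  | zero => simp [hom_zero s t f hf]
  | succ k ih =>
    have e1 := hf (k • a) a
    rw [s.mul_of_br (by rw [s.nsmul_l, s.self, smul_zero]), ih,
      t.mul_of_br (by rw [t.nsmul_l, t.self, smul_zero])] at e1
    rw [succ_nsmul, succ_nsmul, e1]
lemma hom_zsmul (hf : ∀ a b, f (s.mul a b) = t.mul (f a) (f b))
    (a : A) (n : ℤ) : f (n • a) = n • f a := by
  obtain ⟨m, rfl | rfl⟩ := n.eq_nat_or_neg
  · simpa using hom_nsmul s t f hf a m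
  · rw [neg_smul, neg_smul, hom_neg s t f hf]; simpa using hom_nsmul s t f hf a m

theorem hom_lie (tf : ∀ a : B, (6:ℤ) • a = 0 → a = 0) (hf : ∀ a b, f (s.mul a b) = t.mul (f a) (f b)) :
    (∀ a b, f (a + b) = f a + f b) ∧ ∀ a b, f (s.br a b) = t.br (f a) (f b) := by
  have hz := hom_zsmul s t f hf
  have hcm : ∀ a b, f (s.cm a b) = t.cm (f a) (f b) := fun a b => by
    simp only [LS.cm, hf, hom_neg s t f hf]
  have tf' : ∀ a b : B, (216:ℤ) • a = (216:ℤ) • b → a = b := fun a b h => by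
    rw [← sub_eq_zero]; apply tf; apply tf; apply tf
    rw [← sub_eq_zero] at h; rw [← h]; module
  have hc : ∀ {a b : A}, s.br a b = 0 → f (a + b) = f a + f b := fun h => hom_comm s t f tf hf h
  have f4 : ∀ a b c d, f (s.br a (s.br b (s.br c d))) = t.br (f a) (t.br (f b) (t.br (f c) (f d))) := by
    intro a b c d
    have := hcm a (s.cm b (s.cm c d))
    rw [hcm b, hcm c, s.cm4, t.cm4, hz] at this
    exact tf' _ _ this
  have f3 : ∀ a b c, f (s.br a (s.br b c)) = t.br (f a) (t.br (f b) (f c)) := by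
    intro a b c
    have := hcm a (s.cm b c)
    rw [hcm b, s.cm3, t.cm3] at this
    rw [hc, hc, hc, hz, hz, hz, hz, f4, f4, f4] at this
    · apply tf'
      linear_combination (norm := module) (6:ℤ) • this
    all_goals simp [s.add_l, s.zsmul_l, s.zsmul_r, s.jac, s.nil, s.zero_r]
  have f2 : ∀ a b, f (s.br a b) = t.br (f a) (f b) := by
    intro a b
    have := hcm a b
    rw [s.cm_eq, t.cm_eq] at this
    rw [hc, hc, hc, hc, hc, hz, hz, hz, hz, hz, hz, f4, f4, f4, f3, f3] at this
    · apply tf'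
      linear_combination (norm := module) (36:ℤ) • this
    all_goals simp [s.add_l, s.zsmul_l, s.zsmul_r, s.jac, s.nil, s.zero_r]
  refine ⟨fun a b => ?_, f2⟩
  have h1 := hf (a + b) (s.cr a b)
  have h2 : f (s.cr a b) = t.cr (f a) (f b) := by
    rw [LS.cr, hc, hc, hc, hc, hc, hz, hz, hz, hz, hz, hz, f4, f4, f4, f3, f3, f2, LS.cr]
    all_goals simp [s.add_l, s.add_r, s.zsmul_l, s.zsmul_r, s.neg_l, s.neg_r, s.nsmul_l, s.nsmul_r, s.jac, s.nil, s.zero_r]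
  rw [s.mul_cr, hf, h2, ← t.mul_cr] at h1
  exact (t.mul_rc h1).symm
end hom

section chain
variable {A : Type} [AddCommGroup A]

lemma exists_phi [Finite A] {p e : ℕ} (hp : p.Prime) (he : ∀ a : A, (p ^ e : ℕ) • a = 0) (x : A)
    (hx : (p ^ (e - 1) : ℕ) • x ≠ 0) : ∃ φ : A →+ ZMod (p ^ e), φ x = 1 := by
  have e0 : e ≠ 0 := by rintro rfl; exact hx (he x)
  obtain ⟨ι, _, q, hq, k, ⟨f⟩⟩ := AddCommGroup.equiv_directSum_zmod_of_finite A
  have h1 : f ((p ^ (e - 1) : ℕ) • x) ≠ 0 := fun h => hx (f.map_eq_zero_iff.1 h)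
  obtain ⟨i, hi⟩ : ∃ i, (f ((p ^ (e - 1) : ℕ) • x)) i ≠ 0 := by
    by_contra hcon
    push Not at hcon
    exact h1 (DFinsupp.ext hcon)
  let c : A →+ ZMod (q i ^ k i) := (DFinsupp.evalAddMonoidHom i).comp f.toAddMonoidHom
  have hc : (p ^ (e - 1) : ℕ) • c x ≠ 0 := by rw [← map_nsmul]; exact hi
  have hcs : ∃ a, c a = 1 := by
    classical
    refine ⟨f.symm (DirectSum.of (fun i => ZMod (q i ^ k i)) i 1), ?_⟩
    simp only [c, AddMonoidHom.comp_apply, AddEquiv.coe_toAddMonoidHom, AddEquiv.apply_symm_apply]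
    exact DirectSum.of_eq_same i _
  have ho : addOrderOf (c x) = p ^ e := by
    obtain ⟨m, rfl⟩ := Nat.exists_eq_succ_of_ne_zero e0
    have := Fact.mk hp
    refine addOrderOf_eq_prime_pow (by simpa using hc) ?_
    rw [← map_nsmul, he, map_zero]
  have hN : q i ^ k i = p ^ e := by
    apply Nat.dvd_antisymm
    · obtain ⟨a, ha⟩ := hcs
      have : (p ^ e : ℕ) • c a = 0 := by rw [← map_nsmul, he, map_zero]
      rw [ha] at this
      rw [← ZMod.natCast_eq_zero_iff]
      simpa using this
    · rw [← ho]
      apply addOrderOf_dvd_of_nsmul_eq_zero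
      simp
  clear_value c
  generalize q i ^ k i = N at c hN
  subst hN
  have hu : IsUnit (c x) := by
    have : NeZero (p ^ e) := ⟨(pow_pos hp.pos e).ne'⟩
    have : c x = ((c x).val : ZMod (p ^ e)) := by simp
    rw [this, ZMod.isUnit_iff_coprime]
    apply Nat.Coprime.pow_right
    rw [Nat.coprime_comm, hp.coprime_iff_not_dvd]
    rintro ⟨m, hm⟩
    apply hc
    rw [this, hm, nsmul_eq_mul, ← Nat.cast_mul, ZMod.natCast_eq_zero_iff]
    refine ⟨m, ?_⟩
    obtain ⟨m, rfl⟩ := Nat.exists_eq_succ_of_ne_zero e0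
    simp [pow_succ]; ring
  obtain ⟨u, hu⟩ := hu
  refine ⟨(AddMonoidHom.mulLeft (↑u⁻¹ : ZMod (p ^ e))).comp c, ?_⟩
  simp [← hu]

def FE (Θ : Set (A →+ A)) : Prop := ∀ U V : AddSubgroup A, V < U → (∀ θ ∈ Θ, ∀ u ∈ U, θ u ∈ U) →
  (∀ θ ∈ Θ, ∀ u ∈ V, θ u ∈ V) → ∃ u ∈ U, u ∉ V ∧ ∀ θ ∈ Θ, θ u ∈ V

lemma FE.index {Θ : Set (A →+ A)} [Finite A] (h : FE Θ) {p : ℕ} (hp : p.Prime) {n : ℕ} (hA : Nat.card A = p ^ n)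
    {U V : AddSubgroup A} (hVU : V ≤ U)
    (hU : ∀ θ ∈ Θ, ∀ u ∈ U, θ u ∈ U) (hV : ∀ θ ∈ Θ, ∀ u ∈ V, θ u ∈ V)
    (hc : Nat.card U ≤ p * Nat.card V) : ∀ θ ∈ Θ, ∀ u ∈ U, θ u ∈ V := by
  by_cases hne : V = U
  · subst hne; exact hV
  obtain ⟨u, huU, huV, hu⟩ := h U V (lt_of_le_of_ne hVU hne) hU hV
  have key : V ⊔ AddSubgroup.zmultiples u = U := by
    set W := V ⊔ AddSubgroup.zmultiples u with hW
    have h1 : W ≤ U := sup_le hVU (by simpa using huU)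
    have h2 : V ≤ W := le_sup_left
    have h3 : V ≠ W := by
      intro h; apply huV; rw [h]
      exact (le_sup_right : _ ≤ W) (AddSubgroup.mem_zmultiples u)
    obtain ⟨a, -, ha⟩ := (Nat.dvd_prime_pow hp).1 (hA ▸ AddSubgroup.card_addSubgroup_dvd_card V)
    obtain ⟨b, -, hb⟩ := (Nat.dvd_prime_pow hp).1 (hA ▸ AddSubgroup.card_addSubgroup_dvd_card W)
    have c1 := AddSubgroup.card_le_of_le h2
    have c2 : Nat.card V ≠ Nat.card W := fun h => h3 (AddSubgroup.eq_of_le_of_card_ge h2 h.ge)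
    apply AddSubgroup.eq_of_le_of_card_ge h1
    refine hc.trans ?_
    rw [ha, hb] at *
    have hab : a < b := by
      rcases lt_trichotomy a b with h | h | h
      · exact h
      · subst h; exact absurd rfl c2
      · exact absurd c1 (not_le.2 (Nat.pow_lt_pow_right hp.one_lt h))
    calc p * p ^ a = p ^ (a + 1) := by ring
      _ ≤ p ^ b := Nat.pow_le_pow_right hp.pos hab
  intro θ hθ w hw
  rw [← key] at hw
  obtain ⟨v, hv, t, ht, rfl⟩ := AddSubgroup.mem_sup.1 hw
  obtain ⟨k, rfl⟩ := AddSubgroup.mem_zmultiples_iff.1 ht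
  rw [map_add, map_zsmul]
  exact V.add_mem (hV θ hθ v hv) (V.zsmul_mem (hu θ hθ) k)


lemma FE.index' {Θ : Set (A →+ A)} (h : FE Θ) {p : ℕ} (hp : p.Prime)
    {U V : AddSubgroup A} (hVU : V ≤ U)
    (hU : ∀ θ ∈ Θ, ∀ u ∈ U, θ u ∈ U) (hV : ∀ θ ∈ Θ, ∀ u ∈ V, θ u ∈ V) (y : A) (hpy : p • y ∈ V)
    (hy : ∀ u ∈ U, ∃ j : ℤ, u - j • y ∈ V) : ∀ θ ∈ Θ, ∀ u ∈ U, θ u ∈ V := by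
  by_cases hne : V = U
  · subst hne; exact hV
  obtain ⟨u, huU, huV, hu⟩ := h U V (lt_of_le_of_ne hVU hne) hU hV
  obtain ⟨j, hj⟩ := hy u huU
  have hpj : ¬ (p : ℤ) ∣ j := by
    rintro ⟨m, rfl⟩
    apply huV
    have : u = (u - ((p:ℤ) * m) • y) + m • (p • y) := by
      rw [← natCast_zsmul y p]; module
    rw [this]
    exact V.add_mem hj (V.zsmul_mem hpy m)
  have hcop : IsCoprime (p : ℤ) j := (Prime.coprime_iff_not_dvd (Nat.prime_iff_prime_int.1 hp)).2 hpj
  obtain ⟨m, j', hjj⟩ := hcop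
  intro θ hθ w hw
  obtain ⟨i, hi⟩ := hy w hw
  have : w - (i * j') • u ∈ V := by
    have e1 : w - (i * j') • u = (w - i • y) + (i * m) • (p • y) - (i * j') • (u - j • y) := by
      have : i • y = (i * (m * p + j' * j)) • y := by rw [hjj, mul_one]
      rw [this, ← natCast_zsmul y p]; module
    rw [e1]
    exact V.sub_mem (V.add_mem hi (V.zsmul_mem hpy _)) (V.zsmul_mem hj _)
  have e2 : θ w = θ (w - (i * j') • u) + (i * j') • θ u := by
    rw [map_sub, map_zsmul]; abel
  rw [e2]
  exact V.add_mem (hV θ hθ _ this) (V.zsmul_mem (hu θ hθ) _)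

theorem words_zero [Finite A] {p e n : ℕ} (hp : p.Prime) (he4 : 4 ≤ e) (he : ∀ a : A, (p ^ e : ℕ) • a = 0) (x : A)
    (hx : (p ^ (e - 1) : ℕ) • x ≠ 0) (hA : Nat.card A = p ^ n) (hn : n ≤ e + 2)
    {Θ : Set (A →+ A)} (h : FE Θ) (hC : ∀ θ ∈ Θ, ∃ k : ℤ, θ (p ^ 2 • x) = k • p ^ (e - 1) • x) :
    ∀ θ₁ ∈ Θ, ∀ θ₂ ∈ Θ, ∀ θ₃ ∈ Θ, ∀ θ₄ ∈ Θ, ∀ b, θ₁ (θ₂ (θ₃ (θ₄ b))) = 0 := by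
  have := Fact.mk hp
  have : NeZero (p ^ e) := ⟨(pow_pos hp.pos e).ne'⟩
  obtain ⟨φ, hφ⟩ := exists_phi hp he x hx
  obtain ⟨d, rfl⟩ : ∃ d, e = d + 4 := ⟨e - 4, by omega⟩
  have hox : addOrderOf x = p ^ (d + 4) := addOrderOf_eq_prime_pow hx (he x)
  have hdec : ∀ a, ∃ (i : ℤ) (y : A), φ y = 0 ∧ a = i • x + y := fun a =>
    ⟨(φ a).val, a - ((φ a).val : ℤ) • x, by simp [hφ], by abel⟩
  have hYc : Nat.card φ.ker ∣ p ^ 2 := by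
    have h1 : φ.ker.index = p ^ (d + 4) := by
      rw [AddSubgroup.index_ker]
      have : φ.range = ⊤ := by
        rw [AddMonoidHom.range_eq_top]
        intro t; exact ⟨t.val • x, by simp [hφ]⟩
      rw [this]; simp
    have h2 := φ.ker.card_mul_index
    rw [h1, hA] at h2
    have h3 : p ^ n ∣ p ^ 2 * p ^ (d + 4) := by
      rw [← pow_add]; exact pow_dvd_pow p (by omega)
    rw [← h2] at h3
    exact Nat.dvd_of_mul_dvd_mul_right (pow_pos hp.pos _) h3
  have hY2 : ∀ y, φ y = 0 → p ^ 2 • y = 0 := fun y hy => by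
    have : (⟨y, hy⟩ : φ.ker) = ⟨y, hy⟩ := rfl
    have h1 : Nat.card φ.ker • (⟨y, hy⟩ : φ.ker) = 0 := card_nsmul_eq_zero'
    obtain ⟨m, hm⟩ := hYc
    have h2 : Nat.card φ.ker • y = 0 := congrArg Subtype.val h1
    rw [hm, mul_comm, mul_smul, h2, smul_zero]
  set z := p ^ (d + 4 - 1) • x with hz
  have hz' : z = (p ^ (d + 3) : ℤ) • x := by rw [hz, ← natCast_zsmul]; push_cast; rfl
  have hpz : p • z = 0 := by
    rw [hz, ← mul_smul, ← he x]; congr 1; rw [show d + 4 - 1 = d + 3 by omega]; ring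
  have heZ : ∀ a : A, (p ^ (d + 4) : ℤ) • a = 0 := fun a => by
    have := he a; rw [← natCast_zsmul] at this; push_cast at this; exact this
  have hU2 : ∀ θ ∈ Θ, ∀ a, ∃ k : ℤ, p ^ 2 • θ a = k • z := by
    intro θ hθ a
    obtain ⟨i, y, hy, rfl⟩ := hdec a
    obtain ⟨k, hk⟩ := hC θ hθ
    refine ⟨i * k, ?_⟩
    rw [← map_nsmul, smul_add, hY2 y hy, add_zero, smul_comm, map_zsmul, hk, mul_smul]
  have hθz : ∀ θ ∈ Θ, θ z = 0 := by
    intro θ hθ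
    obtain ⟨k, hk⟩ := hC θ hθ
    have : z = p ^ (d + 1) • p ^ 2 • x := by
      rw [hz, ← mul_smul, ← pow_add]; congr 1
    rw [this, map_nsmul, hk, smul_comm, pow_succ, mul_smul, hpz, smul_zero, smul_zero]
  have hΩ : ∀ u, (∃ k : ℤ, p ^ 2 • u = k • z) → ∃ (i : ℤ) (w : A), p ^ 2 • w = 0 ∧ u = i • p ^ (d + 1) • x + w := by
    rintro u ⟨k, hk⟩
    refine ⟨k, u - k • p ^ (d + 1) • x, ?_, by abel⟩
    rw [smul_sub, hk, hz, smul_comm (p ^ 2) k, ← mul_smul (p ^ 2), ← pow_add, sub_eq_zero]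
    congr 3; omega
  have hΩ2 : ∀ w, p ^ 2 • w = 0 → ∃ (i : ℤ) (y : A), φ y = 0 ∧ w = i • p ^ (d + 2) • x + y := by
    intro w hw
    obtain ⟨i, y, hy, rfl⟩ := hdec w
    rw [smul_add, hY2 y hy, add_zero, ← natCast_zsmul, ← mul_smul] at hw
    have h1 := addOrderOf_dvd_iff_zsmul_eq_zero.2 hw
    rw [hox] at h1
    have h2 : (p ^ (d + 2) : ℤ) ∣ i := by
      have : ((p : ℤ) ^ 2) ≠ 0 := pow_ne_zero _ (by exact_mod_cast hp.ne_zero)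
      apply Int.dvd_of_mul_dvd_mul_left this
      push_cast at h1
      rw [← pow_add, show 2 + (d + 2) = d + 4 by ring]
      exact h1
    obtain ⟨m, rfl⟩ := h2
    refine ⟨m, y, hy, ?_⟩
    rw [← natCast_zsmul x]; push_cast; module
  by_cases hcase : ∀ y, φ y = 0 → p • y = 0
  · -- elementary complement
    set Z := AddSubgroup.zmultiples z with hZ
    let Ω : AddSubgroup A := (nsmulAddMonoidHom (α := A) p).ker
    have mΩ : ∀ u, u ∈ Ω ↔ p • u = 0 := fun u => Iff.rfl
    let V : AddSubgroup A := Ω ⊓ ⨅ θ ∈ Θ, Z.comap θ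
    have mV : ∀ u, u ∈ V ↔ p • u = 0 ∧ ∀ θ ∈ Θ, θ u ∈ Z := by
      intro u; simp [V, AddSubgroup.mem_iInf, mΩ]
    have ZV : Z ≤ V := by
      rw [hZ, AddSubgroup.zmultiples_le, mV]
      exact ⟨hpz, fun θ hθ => by rw [hθz θ hθ]; exact Z.zero_mem⟩
    have VΩ : V ≤ Ω := inf_le_left
    have hΩinv : ∀ θ ∈ Θ, ∀ u ∈ Ω, θ u ∈ Ω := fun θ hθ u hu => by
      rw [mΩ] at *; rw [← map_nsmul, hu, map_zero]
    have hZinv : ∀ θ ∈ Θ, ∀ u ∈ Z, θ u ∈ Z := fun θ hθ u hu => by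
      obtain ⟨k, rfl⟩ := AddSubgroup.mem_zmultiples_iff.1 hu
      rw [map_zsmul, hθz θ hθ, smul_zero]; exact Z.zero_mem
    have hVinv : ∀ θ ∈ Θ, ∀ u ∈ V, θ u ∈ V := fun θ hθ u hu => ZV (((mV u).1 hu).2 θ hθ)
    have cZ : Nat.card Z = p := by
      rw [hZ, Nat.card_zmultiples]
      exact addOrderOf_eq_prime hpz hx
    have cΩ : Nat.card Ω ≤ p ^ 3 := by
      have h1 := Ω.card_mul_index
      rw [AddSubgroup.index_ker, hA] at h1
      have h2 : AddSubgroup.zmultiples (p • x) ≤ (nsmulAddMonoidHom (α := A) p).range := by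
        rw [AddSubgroup.zmultiples_le]; exact ⟨x, rfl⟩
      have h3 := AddSubgroup.card_le_of_le h2
      rw [Nat.card_zmultiples] at h3
      have h4 : addOrderOf (p • x) = p ^ (d + 3) := by
        apply addOrderOf_eq_prime_pow
        · rw [← mul_smul, ← pow_succ]; exact hx
        · rw [← mul_smul, ← pow_succ]; exact he x
      rw [h4] at h3
      have h5 : Nat.card Ω * p ^ (d + 3) ≤ p ^ 3 * p ^ (d + 3) := by
        calc _ ≤ _ := Nat.mul_le_mul_left _ h3
          _ = p ^ n := h1
          _ ≤ p ^ (3 + (d + 3)) := Nat.pow_le_pow_right hp.pos (by omega)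
          _ = _ := pow_add _ _ _
      exact Nat.le_of_mul_le_mul_right h5 (pow_pos hp.pos _)
    have cV : Nat.card Ω ≤ p * Nat.card V := by
      by_cases hΩZ : Z = Ω
      · rw [← hΩZ]
        exact (AddSubgroup.card_le_of_le ZV).trans (Nat.le_mul_of_pos_left _ hp.pos)
      obtain ⟨u, huΩ, huZ, hu⟩ := h Ω Z (lt_of_le_of_ne (ZV.trans VΩ) hΩZ) hΩinv hZinv
      have huV : u ∈ V := (mV u).2 ⟨huΩ, hu⟩
      obtain ⟨a, -, ha⟩ := (Nat.dvd_prime_pow hp).1 (hA ▸ AddSubgroup.card_addSubgroup_dvd_card V)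
      have c1 : Nat.card Z < Nat.card V := by
        refine lt_of_le_of_ne (AddSubgroup.card_le_of_le ZV) fun h => huZ ?_
        rw [AddSubgroup.eq_of_le_of_card_ge ZV h.ge]; exact huV
      rw [cZ, ha] at c1
      have h2 : 2 ≤ a := by
        by_contra hcon
        have : p ^ a ≤ p ^ 1 := Nat.pow_le_pow_right hp.pos (by omega)
        rw [pow_one] at this; omega
      rw [ha]
      calc _ ≤ p ^ 3 := cΩ
        _ ≤ p ^ (1 + a) := Nat.pow_le_pow_right hp.pos (by omega)
        _ = _ := by rw [pow_add, pow_one]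
    have key := FE.index h hp hA VΩ hΩinv hVinv cV
    have hU : ∀ θ ∈ Θ, ∀ a, ∃ (i : ℤ) (y : A), p • y = 0 ∧ θ a = i • p ^ (d + 1) • x + y := by
      intro θ hθ a
      obtain ⟨i, w, hw, e1⟩ := hΩ _ (hU2 θ hθ a)
      obtain ⟨j, y, hy, rfl⟩ := hΩ2 w hw
      refine ⟨i + j * p, y, hcase y hy, ?_⟩
      rw [e1, ← natCast_zsmul x, ← natCast_zsmul x]; push_cast; module
    intro θ₁ h₁ θ₂ h₂ θ₃ h₃ θ₄ h₄ b
    obtain ⟨i, y, hy, e4⟩ := hU θ₄ h₄ b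
    obtain ⟨j, y', hy', e3⟩ := hU θ₃ h₃ x
    obtain ⟨k, e2⟩ := hU2 θ₂ h₂ x
    have hv := key θ₃ h₃ y hy
    obtain ⟨k', e1⟩ := AddSubgroup.mem_zmultiples_iff.1 (((mV _).1 hv).2 θ₂ h₂)
    have e5 : p ^ (d + 1) • θ₂ y' = 0 := by
      rw [← map_nsmul, pow_succ, mul_smul, hy', smul_zero, map_zero]
    have e6 : (p ^ (d + 1) • (j • p ^ (d + 1) • θ₂ x)) = (j * p ^ (2 * d) * k) • z := by
      rw [mul_smul, ← e2, ← natCast_zsmul, ← natCast_zsmul, ← natCast_zsmul]; push_cast; module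
    have e7 : θ₂ (θ₃ (θ₄ b)) = i • ((j * p ^ (2 * d) * k) • z) + k' • z := by
      rw [e4, map_add, map_zsmul, map_nsmul, e3, map_add, map_zsmul, map_nsmul, map_add, map_zsmul, map_nsmul, smul_add,
        e5, e6, e1, add_zero]
    rw [e7, map_add, map_zsmul, map_zsmul, map_zsmul, hθz θ₁ h₁]
    simp
  · push Not at hcase
    obtain ⟨y, hy, hpy⟩ := hcase
    have hoy : addOrderOf y = p ^ 2 := addOrderOf_eq_prime_pow (n := 1) (by simpa using hpy) (hY2 y hy)
    have hgen : ∀ w, φ w = 0 → ∃ j : ℤ, j • y = w := by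
      intro w hw
      have h1 : AddSubgroup.zmultiples y ≤ φ.ker := by rw [AddSubgroup.zmultiples_le]; exact hy
      have h2 : AddSubgroup.zmultiples y = φ.ker := by
        apply AddSubgroup.eq_of_le_of_card_ge h1
        rw [Nat.card_zmultiples, hoy]
        exact Nat.le_of_dvd (pow_pos hp.pos _) hYc
      have h3 : w ∈ AddSubgroup.zmultiples y := by rw [h2]; exact hw
      exact AddSubgroup.mem_zmultiples_iff.1 h3
    let U2 : AddSubgroup A := (AddSubgroup.zmultiples z).comap (nsmulAddMonoidHom (p ^ 2))
    have mU2 : ∀ u, u ∈ U2 ↔ ∃ k : ℤ, p ^ 2 • u = k • z := fun u => by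
      simp only [U2, AddSubgroup.mem_comap, AddSubgroup.mem_zmultiples_iff, nsmulAddMonoidHom_apply]
      exact exists_congr fun k => eq_comm
    let Ω : AddSubgroup A := (nsmulAddMonoidHom (α := A) (p ^ 2)).ker
    have mΩ : ∀ u, u ∈ Ω ↔ p ^ 2 • u = 0 := fun u => Iff.rfl
    let V : AddSubgroup A := U2.map (nsmulAddMonoidHom p)
    have mV : ∀ u, u ∈ V ↔ ∃ v ∈ U2, p • v = u := fun u => Iff.rfl
    have VΩ : V ≤ Ω := by
      rintro _ ⟨v, hv, rfl⟩
      obtain ⟨k, hk⟩ := (mU2 v).1 hv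
      rw [mΩ, nsmulAddMonoidHom_apply, smul_comm, hk, smul_comm, hpz, smul_zero]
    have hΩinv : ∀ θ ∈ Θ, ∀ u ∈ Ω, θ u ∈ Ω := fun θ hθ u hu => by
      rw [mΩ] at *; rw [← map_nsmul, hu, map_zero]
    have hVinv : ∀ θ ∈ Θ, ∀ u ∈ V, θ u ∈ V := by
      rintro θ hθ _ ⟨v, hv, rfl⟩
      rw [nsmulAddMonoidHom_apply, map_nsmul]
      exact ⟨θ v, (mU2 _).2 (hU2 θ hθ v), rfl⟩
    have hxU : ∀ m : ℤ, m • p ^ (d + 1) • x ∈ U2 := fun m => by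
      rw [mU2]; refine ⟨m, ?_⟩
      rw [hz', ← natCast_zsmul, ← natCast_zsmul]; push_cast; module
    have key := FE.index' h hp VΩ hΩinv hVinv y ⟨y, (mU2 y).2 ⟨0, by rw [hY2 y hy, zero_smul]⟩, rfl⟩ (by
      intro u hu
      obtain ⟨i, w, hw, rfl⟩ := hΩ2 u hu
      obtain ⟨j, rfl⟩ := hgen w hw
      refine ⟨j, (mV _).2 ⟨i • p ^ (d + 1) • x, hxU i, ?_⟩⟩
      rw [← natCast_zsmul x, ← natCast_zsmul x, ← natCast_zsmul]; push_cast; module)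
    have key2 : ∀ θ ∈ Θ, ∀ u ∈ U2, θ u ∈ V := by
      intro θ hθ u hu
      obtain ⟨i, w, hw, rfl⟩ := hΩ u ((mU2 u).1 hu)
      rw [map_add]
      refine V.add_mem ?_ (key θ hθ w hw)
      refine (mV _).2 ⟨(i * p ^ d) • θ x, U2.zsmul_mem ((mU2 _).2 (hU2 θ hθ x)) _, ?_⟩
      rw [map_zsmul, map_nsmul, ← natCast_zsmul, ← natCast_zsmul]; push_cast; module
    intro θ₁ h₁ θ₂ h₂ θ₃ h₃ θ₄ h₄ b
    obtain ⟨u, hu, e1⟩ := (mV _).1 (key2 θ₃ h₃ _ ((mU2 _).2 (hU2 θ₄ h₄ b)))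
    obtain ⟨v, hv, e2⟩ := (mV _).1 (key2 θ₂ h₂ u hu)
    obtain ⟨k, hk⟩ := (mU2 v).1 hv
    rw [← e1, map_nsmul, ← e2, ← mul_smul, ← pow_two, hk, map_zsmul, hθz θ₁ h₁, smul_zero]

end chain

section ext
variable {A : Type} [AddCommGroup A]

def lev (Θ : Set (A →+ A)) : ℕ → AddSubgroup A
  | 0 => ⊥
  | k + 1 => ⨅ θ ∈ Θ, (lev Θ k).comap θ

lemma mem_lev (Θ : Set (A →+ A)) (k : ℕ) (u : A) : u ∈ lev Θ (k + 1) ↔ ∀ θ ∈ Θ, θ u ∈ lev Θ k := by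
  simp [lev, AddSubgroup.mem_iInf]

lemma lev_succ (Θ : Set (A →+ A)) (k : ℕ) : lev Θ k ≤ lev Θ (k + 1) := by
  induction k with
  | zero =>
    intro u hu
    rw [mem_lev]
    intro θ _
    have : u = 0 := hu
    rw [this, map_zero]; exact AddSubgroup.zero_mem _
  | succ k ih =>
    intro u hu
    rw [mem_lev] at *
    exact fun θ hθ => ih (hu θ hθ)

def Tht (s : LS A) (τ : A →+ A) : Set (A →+ A) := insert τ (Set.range s.ad)

def Dlog (τ : A →+ A) (m : ℤ) : A →+ A :=
  m • ((6:ℤ) • τ - (3:ℤ) • τ.comp τ + (2:ℤ) • τ.comp (τ.comp τ))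

variable (s : LS A) (τ : A →+ A) (m : ℤ)

lemma Dlog_apply (a : A) : Dlog τ m a = m • ((6:ℤ) • τ a - (3:ℤ) • τ (τ a) + (2:ℤ) • τ (τ (τ a))) := by
  simp [Dlog]

lemma Dlog_lev {k : ℕ} {u : A} (hu : u ∈ lev (Tht s τ) (k + 1)) : Dlog τ m u ∈ lev (Tht s τ) k := by
  have hτ : τ ∈ Tht s τ := Set.mem_insert _ _
  have h1 := (mem_lev _ _ _).1 hu τ hτ
  have h2 := (mem_lev _ _ _).1 (lev_succ _ _ h1) τ hτ
  have h3 := (mem_lev _ _ _).1 (lev_succ _ _ h2) τ hτ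
  rw [Dlog_apply]
  exact zsmul_mem (add_mem (sub_mem (zsmul_mem h1 _) (zsmul_mem h2 _)) (zsmul_mem h3 _)) _

theorem ext_LS (hτ : ∀ a b, τ (s.br a b) = s.br (τ a) b + s.br a (τ b) + s.br (τ a) (τ b))
    (hW : ∀ a, a ∈ lev (Tht s τ) 4) (hm : ∀ a : A, (36 * m) • a = a) :
    ∃ t : LS (A × ℤ), (∀ a b i j, t.br (a, i) (b, j) = (s.br a b + i • Dlog τ m b - j • Dlog τ m a, 0)) ∧
      ∀ b, t.mul (t.mul (0, 1) (b, 0)) (-(0, 1)) = (b + τ b, 0) := by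
  have mτ : τ ∈ Tht s τ := Set.mem_insert _ _
  have mad : ∀ a, s.ad a ∈ Tht s τ := fun a => Set.mem_insert_of_mem _ ⟨a, rfl⟩
  have W : ∀ θ₁ ∈ Tht s τ, ∀ θ₂ ∈ Tht s τ, ∀ θ₃ ∈ Tht s τ, ∀ θ₄ ∈ Tht s τ, ∀ b, θ₁ (θ₂ (θ₃ (θ₄ b))) = 0 := by
    intro θ₁ h₁ θ₂ h₂ θ₃ h₃ θ₄ h₄ b
    have := hW b
    simp only [mem_lev] at this
    exact this θ₄ h₄ θ₃ h₃ θ₂ h₂ θ₁ h₁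
  have w03 : ∀ a b, s.br a (τ (τ (τ b))) = 0 := fun a b => W _ (mad a) τ mτ τ mτ τ mτ b
  have w4 : ∀ b, τ (τ (τ (τ b))) = 0 := fun b => W _ mτ τ mτ τ mτ τ mτ b
  have w30 : ∀ a b, s.br (τ (τ (τ a))) b = 0 := fun a b => by rw [s.skew, w03, neg_zero]
  have w12 : ∀ a b, s.br (τ a) (τ (τ b)) = 0 := fun a b => by
    have := hτ a (τ (τ b))
    have h0 : τ (s.br a (τ (τ b))) = 0 := W τ mτ _ (mad a) τ mτ τ mτ b
    rw [w03, w03, h0] at this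
    simpa using this.symm
  have w21 : ∀ a b, s.br (τ (τ a)) (τ b) = 0 := fun a b => by rw [s.skew, w12, neg_zero]
  set D := Dlog τ m with hD
  have Dd : ∀ a, D a = m • ((6:ℤ) • τ a - (3:ℤ) • τ (τ a) + (2:ℤ) • τ (τ (τ a))) := Dlog_apply τ m
  have hder : ∀ a b, D (s.br a b) = s.br (D a) b + s.br a (D b) := by
    intro a b
    simp only [Dd, hτ, map_add, s.zsmul_l, s.zsmul_r, s.add_l, s.add_r, s.sub_l, s.sub_r, w03, w30, w12, w21, w4,
      s.zero_l, s.zero_r, map_zero]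
    module
  have hl : ∀ k (c : A) (i : ℤ) u, u ∈ lev (Tht s τ) (k + 1) → s.br c u + i • D u ∈ lev (Tht s τ) k :=
    fun k c i u hu => add_mem ((mem_lev _ _ _).1 hu _ (mad c)) (zsmul_mem (Dlog_lev s τ m hu) _)
  let br : A × ℤ → A × ℤ → A × ℤ := fun u v => (s.br u.1 v.1 + u.2 • D v.1 - v.2 • D u.1, 0)
  have hbr : ∀ u v, br u v = (s.br u.1 v.1 + u.2 • D v.1 - v.2 • D u.1, 0) := fun _ _ => rfl
  let t : LS (A × ℤ) :=
    { br := br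
      add_l := by
        rintro ⟨a, i⟩ ⟨b, j⟩ ⟨c, k⟩
        simp only [hbr, Prod.mk_add_mk, Prod.mk.injEq, s.add_l, map_add]
        exact ⟨by module, by simp⟩
      add_r := by
        rintro ⟨a, i⟩ ⟨b, j⟩ ⟨c, k⟩
        simp only [hbr, Prod.mk_add_mk, Prod.mk.injEq, s.add_r, map_add]
        exact ⟨by module, by simp⟩
      self := by
        rintro ⟨a, i⟩
        simp [hbr, s.self]
      jac := by
        rintro ⟨a, i⟩ ⟨b, j⟩ ⟨c, k⟩
        simp only [hbr, Prod.mk_sub_mk, Prod.mk.injEq, s.add_l, s.add_r, s.sub_l, s.sub_r, s.zsmul_l, s.zsmul_r,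
          map_add, map_sub, map_zsmul, hder, s.jac, zero_smul, sub_zero, and_true]
        rw [s.skew b (D a)]
        module
      nil := by
        rintro ⟨a, i⟩ ⟨b, j⟩ ⟨c, k⟩ ⟨d, l⟩ ⟨f, n⟩
        have h3 : s.br d f + l • D f - n • D d ∈ lev (Tht s τ) 3 :=
          sub_mem (hl 3 d l f (hW f)) (zsmul_mem (Dlog_lev s τ m (hW d)) _)
        have h2 := hl 2 c k _ h3
        have h1 := hl 1 b j _ h2
        have h0 := AddSubgroup.mem_bot.1 (hl 0 a i _ h1)
        simp only [hbr, zero_smul, sub_zero, h0, Prod.mk_zero_zero] }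
  refine ⟨t, fun a b i j => rfl, fun b => ?_⟩
  have tb : ∀ u v, t.br u v = (s.br u.1 v.1 + u.2 • D v.1 - v.2 • D u.1, 0) := hbr
  rw [t.conj]
  simp only [tb, s.zero_l, one_smul, zero_smul, sub_zero, zero_add, Prod.smul_mk, smul_zero, Prod.mk_add_mk, add_zero,
    Prod.mk.injEq, and_true]
  simp only [Dd, map_zsmul, map_add, map_sub, w4, map_zero, smul_zero, add_zero, sub_zero]
  have m1 := hm (τ b)
  have m2 := hm (τ (τ b))
  have m3 := hm (τ (τ (τ b)))
  linear_combination (norm := module) m1 + (18 * m) • m2 + (216 * m ^ 2 - 12 * m) • m3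
end ext

section grp
variable {A : Type} [AddCommGroup A]

def LS.E (_ : LS A) : Type := A

instance (s : LS A) : Group s.E where
  mul := s.mul
  one := (0 : A)
  inv := fun a => @Neg.neg A _ a
  mul_assoc := s.mul_assoc
  one_mul := s.zero_mul'
  mul_one := s.mul_zero'
  inv_mul_cancel := s.neg_mul'

def LS.e (s : LS A) (a : A) : s.E := a

lemma LS.e_mul (s : LS A) (a b : A) : s.e (s.mul a b) = s.e a * s.e b := rfl
lemma LS.e_zero (s : LS A) : s.e 0 = 1 := rfl
lemma LS.e_neg (s : LS A) (a : A) : s.e (-a) = (s.e a)⁻¹ := rfl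
lemma LS.e_inj (s : LS A) {a b : A} (h : s.e a = s.e b) : a = b := h
lemma LS.e_nsmul (s : LS A) (a : A) (n : ℕ) : s.e (n • a) = s.e a ^ n := by
  induction n with
  | zero => simp [s.e_zero]
  | succ k ih =>
    rw [pow_succ, ← ih, ← s.e_mul, s.mul_of_br (by rw [s.nsmul_l, s.self, smul_zero]), succ_nsmul]
lemma LS.e_zsmul (s : LS A) (a : A) (n : ℤ) : s.e (n • a) = s.e a ^ n := by
  obtain ⟨m, rfl | rfl⟩ := n.eq_nat_or_neg
  · simpa using s.e_nsmul a m
  · rw [neg_smul, s.e_neg, zpow_neg]; simpa using s.e_nsmul a m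

lemma quotLS {B : Type} [AddCommGroup B] (q : A →+ B) (hq : Function.Surjective q) (br : A → A → A)
    (add_l : ∀ a b c, br (a + b) c = br a c + br b c)
    (add_r : ∀ a b c, br a (b + c) = br a b + br a c)
    (hk : ∀ c, q c = 0 → ∀ b, q (br c b) = 0)
    (self : ∀ a, br a a = 0)
    (jac : ∀ a b c, q (br (br a b) c) = q (br a (br b c)) - q (br b (br a c)))
    (nil : ∀ a b c d e, q (br a (br b (br c (br d e)))) = 0) :
    ∃ t : LS B, ∀ a b, t.br (q a) (q b) = q (br a b) := by
  have skew : ∀ a b, br a b = - br b a := fun a b => by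
    have := self (a + b)
    rw [add_l, add_r, add_r, self, self] at this
    simp only [zero_add, add_zero] at this
    exact eq_neg_of_add_eq_zero_left this
  have hk1 : ∀ a a' b, q a = q a' → q (br a b) = q (br a' b) := fun a a' b h => by
    have h1 := hk (a - a') (by rw [map_sub, h, sub_self]) b
    have h2 := add_l (a - a') a' b
    rw [sub_add_cancel] at h2
    rw [h2, map_add, h1, zero_add]
  have hk2 : ∀ a b b', q b = q b' → q (br a b) = q (br a b') := fun a b b' h => by
    rw [skew, skew a b', map_neg, map_neg, hk1 b b' a h]
  obtain ⟨g, hg⟩ := hq.hasRightInverse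
  have key : ∀ a b, q (br (g (q a)) (g (q b))) = q (br a b) := fun a b => by
    rw [hk1 _ a _ (hg _), hk2 _ _ b (hg _)]
  refine ⟨⟨fun a b => q (br (g a) (g b)), ?_, ?_, ?_, ?_, ?_⟩, key⟩
  · refine hq.forall₃.2 fun a b c => ?_
    rw [← map_add, key, key, key, add_l, map_add]
  · refine hq.forall₃.2 fun a b c => ?_
    rw [← map_add, key, key, key, add_r, map_add]
  · refine hq.forall.2 fun a => ?_
    rw [key, self, map_zero]
  · refine hq.forall₃.2 fun a b c => ?_
    simp only [key, jac]
  · refine hq.forall₃.2 fun a b c => hq.forall₂.2 fun d e => ?_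
    simp only [key, nil]

lemma map_mulLS {B : Type} [AddCommGroup B] (s : LS A) (t : LS B) (q : A →+ B)
    (h : ∀ a b, t.br (q a) (q b) = q (s.br a b)) (a b : A) : t.mul (q a) (q b) = q (s.mul a b) := by
  simp only [LS.mul, map_add, map_sub, map_zsmul, h]

theorem lazard_ext {G : Type} [Group G] (s : LS A) (ι : A → G) (hinj : Function.Injective ι)
    (hι : ∀ a b, ι (s.mul a b) = ι a * ι b) (g : G) (σ : A → A) (hσ : ∀ a, g * ι a * g⁻¹ = ι (σ a))
    (hσs : Function.Surjective σ)
    (t : LS (A × ℤ)) (D : A →+ A) (ht : ∀ a b i j, t.br (a, i) (b, j) = (s.br a b + i • D b - j • D a, 0))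
    (htc : ∀ b, t.mul (t.mul (0, 1) (b, 0)) (-(0, 1)) = (σ b, 0))
    (tf : ∀ a : A, (6:ℤ) • a = 0 → a = 0)
    (p : ℕ) (z : A) (hz : ι z = g ^ p) (hp : ∀ i : ℤ, (∃ a, g ^ i = ι a) → (p : ℤ) ∣ i)
    (hgen : ∀ h, ∃ a, ∃ i : ℤ, h = ι a * g ^ i) (hDz : D z = 0) :
    ∃ (B : Type) (_ : AddCommGroup B) (r : LS B) (f : B → G), Function.Bijective f ∧
      ∀ a b, f (r.mul a b) = f a * f b := by
  let γ : t.E := t.e (0, 1)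
  let j : A → t.E := fun a => t.e (a, 0)
  have hj : ∀ a b, j (s.mul a b) = j a * j b := fun a b => by
    simp only [j, ← t.e_mul]; congr 1
    simp [LS.mul, ht]
  have hιz : ∀ a (n : ℤ), ι (n • a) = ι a ^ n := by
    let F : s.E →* G := MonoidHom.mk' (fun a => ι a) hι
    intro a n
    exact (congrArg F (s.e_zsmul a n)).trans (map_zpow F _ _)
  have hjz : ∀ a (n : ℤ), j (n • a) = j a ^ n := by
    intro a n
    simp only [j, ← t.e_zsmul]; congr 1; simp
  have ι0 : ι 0 = 1 := by simpa using hιz 0 0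
  have j0 : j 0 = 1 := by simpa using hjz 0 0
  have hγ : ∀ i : ℤ, γ ^ i = t.e (0, i) := fun i => by
    simp only [γ, ← t.e_zsmul]; congr 1; simp
  have c1 : ∀ a, γ * j a * γ⁻¹ = j (σ a) := htc
  have cj : ∀ (i : ℤ) a, ∃ b, γ ^ i * j a * (γ ^ i)⁻¹ = j b ∧ g ^ i * ι a * (g ^ i)⁻¹ = ι b := by
    intro i
    induction i using Int.induction_on with
    | zero => intro a; exact ⟨a, by simp⟩
    | succ i ih =>
      intro a
      obtain ⟨b, h1, h2⟩ := ih (σ a)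
      refine ⟨b, ?_, ?_⟩
      · rw [← h1, ← c1, zpow_add_one]; group
      · rw [← h2, ← hσ, zpow_add_one]; group
    | pred i ih =>
      intro a
      obtain ⟨a, rfl⟩ := hσs a
      obtain ⟨b, h1, h2⟩ := ih a
      refine ⟨b, ?_, ?_⟩
      · rw [← h1, ← c1, zpow_sub_one]; group
      · rw [← h2, ← hσ, zpow_sub_one]; group
  let R : t.E → G → Prop := fun u h => ∃ a, ∃ i : ℤ, u = j a * γ ^ i ∧ h = ι a * g ^ i
  have Rmul : ∀ u u' h h', R u h → R u' h' → R (u * u') (h * h') := by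
    rintro _ _ _ _ ⟨a, i, rfl, rfl⟩ ⟨b, k, rfl, rfl⟩
    obtain ⟨c, h1, h2⟩ := cj i b
    refine ⟨s.mul a c, i + k, ?_, ?_⟩
    · rw [hj, ← h1, zpow_add]; group
    · rw [hι, ← h2, zpow_add]; group
  have Rinv : ∀ u h, R u h → R u⁻¹ h⁻¹ := by
    rintro _ _ ⟨a, i, rfl, rfl⟩
    obtain ⟨c, h1, h2⟩ := cj (-i) ((-1 : ℤ) • a)
    refine ⟨c, -i, ?_, ?_⟩
    · rw [← h1, hjz]; group
    · rw [← h2, hιz]; group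
  have coord : ∀ a (i : ℤ), ∃ b, j a * γ ^ i = t.e (b, i) := by
    intro a i
    rw [hγ]
    refine ⟨(t.mul (a, 0) (0, i)).1, ?_⟩
    change t.e (t.mul (a, 0) (0, i)) = _
    congr 1
    ext <;> simp [LS.mul, ht]
  have Rtot : ∀ u, ∃ h, R u h := by
    rintro ⟨a, i⟩
    have : ∃ b, t.e (a, i) * (γ ^ i)⁻¹ = j b := by
      rw [hγ, ← t.e_neg]
      refine ⟨(t.mul (a, i) (-(0, i))).1, ?_⟩
      change t.e (t.mul (a, i) (-(0, i))) = _
      simp only [j]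
      congr 1
      ext <;> simp [LS.mul, ht]
    obtain ⟨b, hb⟩ := this
    exact ⟨ι b * g ^ i, b, i, by rw [← hb]; simp; rfl, rfl⟩
  have Rsurj : ∀ h, ∃ u, R u h := fun h => by
    obtain ⟨a, i, rfl⟩ := hgen h
    exact ⟨_, a, i, rfl, rfl⟩
  have Rone : ∀ h, R 1 h → h = 1 := by
    rintro h ⟨a, i, h1, rfl⟩
    obtain ⟨b, hb⟩ := coord a i
    have h2 := t.e_inj ((hb.symm.trans h1.symm).trans t.e_zero.symm)
    have h3 : i = 0 := congrArg Prod.snd h2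
    subst h3
    rw [zpow_zero, mul_one] at h1
    have : a = 0 := congrArg Prod.fst (t.e_inj (h1.symm.trans t.e_zero.symm))
    rw [this, ι0]; simp
  have Runiq : ∀ u h h', R u h → R u h' → h = h' := fun u h h' h1 h2 => by
    have := Rone _ (by simpa using Rmul _ _ _ _ h1 (Rinv _ _ h2))
    exact mul_inv_eq_one.1 this
  let c : A × ℤ := (-z, (p : ℤ))
  have hc : ∀ k : ℤ, t.e (k • c) = j ((-k) • z) * γ ^ (k * p) := fun k => by
    rw [hγ, ← t.e_mul]
    congr 1
    rw [t.mul_of_br]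
    · simp [c]
    · simp [ht, hDz, s.zero_r]
  have cc : ∀ v, t.br c v = 0 := by
    have h1 : ∀ b, t.br c (b, 0) = 0 := by
      intro b
      apply t.br_of_comm
      · rintro ⟨a, i⟩ h
        simp only [Prod.smul_mk, Prod.mk_eq_zero] at h
        rw [tf a h.1]
        have : i = 0 := by have := h.2; simp at this; exact this
        rw [this]; rfl
      · apply t.e_inj
        rw [t.e_mul, t.e_mul]
        have e1 := hc 1
        rw [one_smul, one_mul] at e1
        obtain ⟨d, h1, h2⟩ := cj p b
        have e2 : j d = j z * j b * (j z)⁻¹ := by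
          have : ι d = ι (s.mul (s.mul z b) ((-1 : ℤ) • z)) := by
            rw [← h2, hι, hι, hιz, hz]; simp
          rw [hinj this, hj, hj, hjz]; simp
        rw [e2] at h1
        have e3 : j ((-1 : ℤ) • z) = (j z)⁻¹ := by rw [hjz]; simp
        rw [e1, e3]
        change (j z)⁻¹ * γ ^ (p : ℤ) * j b = j b * ((j z)⁻¹ * γ ^ (p : ℤ))
        have h3 : γ ^ (p : ℤ) * j b = j z * j b * (j z)⁻¹ * γ ^ (p : ℤ) := by
          rw [← h1]; group
        rw [mul_assoc, h3]; group
    rintro ⟨b, i⟩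
    have h2 := h1 b
    simp only [c, ht, zero_smul, sub_zero, Prod.mk_eq_zero, and_true] at h2 ⊢
    rw [h2]; simp [hDz]
  have cck : ∀ (k : ℤ) v, t.br (k • c) v = 0 := fun k v => by rw [t.zsmul_l, cc, smul_zero]
  let C := AddSubgroup.zmultiples c
  have RC : ∀ u : A × ℤ, R (t.e u) 1 ↔ u ∈ C := by
    intro u
    constructor
    · rintro ⟨a, i, h1, h2⟩
      obtain ⟨k, hk⟩ := hp i ⟨(-1 : ℤ) • a, by
        rw [hιz, zpow_neg_one]; exact eq_inv_of_mul_eq_one_right h2.symm⟩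
      have h3 : ι a = ι ((-k) • z) := by
        rw [hιz, hz, ← zpow_natCast, ← zpow_mul, eq_inv_of_mul_eq_one_left h2.symm, ← zpow_neg, hk]
        congr 1; ring
      rw [hinj h3, hk, mul_comm, ← hc] at h1
      exact AddSubgroup.mem_zmultiples_iff.2 ⟨k, (t.e_inj h1).symm⟩
    · intro h
      obtain ⟨k, rfl⟩ := AddSubgroup.mem_zmultiples_iff.1 h
      refine ⟨_, _, hc k, ?_⟩
      rw [hιz, hz, ← zpow_natCast, ← zpow_mul, ← zpow_add]
      rw [show (p : ℤ) * -k + k * p = 0 by ring, zpow_zero]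
  choose Φ hΦ using Rtot
  have Φmul : ∀ u v : A × ℤ, Φ (t.e (t.mul u v)) = Φ (t.e u) * Φ (t.e v) := fun u v =>
    Runiq _ _ _ (hΦ _) (Rmul _ _ _ _ (hΦ _) (hΦ _))
  have Φeq : ∀ u v : A × ℤ, Φ (t.e u) = Φ (t.e v) ↔ u - v ∈ C := by
    intro u v
    constructor
    · intro h
      have h1 := Rmul _ _ _ _ (hΦ (t.e u)) (Rinv _ _ (hΦ (t.e v)))
      rw [h, mul_inv_cancel, ← t.e_neg, ← t.e_mul, RC] at h1
      obtain ⟨k, hk⟩ := AddSubgroup.mem_zmultiples_iff.1 h1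
      have h2 : u = t.mul (k • c) v := by
        rw [hk, t.mul_assoc, t.neg_mul', t.mul_zero']
      rw [t.mul_of_br (cck k v)] at h2
      rw [h2, add_sub_cancel_right]
      exact AddSubgroup.mem_zmultiples_iff.2 ⟨k, rfl⟩
    · intro h
      obtain ⟨k, hk⟩ := AddSubgroup.mem_zmultiples_iff.1 h
      have h2 : u = t.mul (k • c) v := by
        rw [t.mul_of_br (cck k v), hk]; abel
      have h3 : Φ (t.e (k • c)) = 1 := Runiq _ _ _ (hΦ _) ((RC _).2 (AddSubgroup.mem_zmultiples_iff.2 ⟨k, rfl⟩))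
      rw [h2, Φmul, h3, one_mul]
  obtain ⟨r, hr⟩ := quotLS (QuotientAddGroup.mk' C) (QuotientAddGroup.mk'_surjective C) t.br t.add_l t.add_r (by
    intro u hu b
    obtain ⟨k, rfl⟩ := AddSubgroup.mem_zmultiples_iff.1 ((QuotientAddGroup.eq_zero_iff u).1 hu)
    rw [cck, map_zero]) t.self (fun a b c => by rw [t.jac, map_sub]) (fun a b c d e => by rw [t.nil, map_zero])
  let f : (A × ℤ) ⧸ C → G := fun b => Φ (t.e b.out)
  have hf : ∀ u : A × ℤ, f (QuotientAddGroup.mk' C u) = Φ (t.e u) := fun u => by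
    apply (Φeq _ _).2
    rw [← QuotientAddGroup.eq_iff_sub_mem]
    exact QuotientAddGroup.out_eq' _
  refine ⟨(A × ℤ) ⧸ C, inferInstance, r, f, ⟨?_, ?_⟩, ?_⟩
  · refine (QuotientAddGroup.mk'_surjective C).forall₂.2 fun u v h => ?_
    rw [hf, hf, Φeq] at h
    exact QuotientAddGroup.eq_iff_sub_mem.2 h
  · intro h
    obtain ⟨u, hu⟩ := Rsurj h
    exact ⟨QuotientAddGroup.mk' C u, (hf u).trans (Runiq _ _ _ (hΦ _) hu)⟩
  · refine (QuotientAddGroup.mk'_surjective C).forall₂.2 fun u v => ?_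
    rw [map_mulLS t r _ hr, hf, hf, hf, Φmul]
end grp

lemma int_lte {p : ℕ} (hp : p.Prime) (h5 : 5 ≤ p) (m : ℕ) (hm : 1 ≤ m) (l : ℤ) (h : (p ^ (m + 1) : ℤ) ∣ l ^ p - 1) :
    (p ^ m : ℤ) ∣ l - 1 := by
  have := Fact.mk hp
  have hpl : (p : ℤ) ∣ l ^ p - 1 := (dvd_pow_self _ (by omega)).trans h
  have h1 : (p : ℤ) ∣ l - 1 := by
    rw [← ZMod.intCast_zmod_eq_zero_iff_dvd] at hpl ⊢ <;> simpa using hpl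
  have h2 : ¬ (p : ℤ) ∣ l := by
    intro h2
    have h3 : (p : ℤ) ∣ 1 := by simpa using dvd_sub h2 h1
    exact (Nat.prime_iff_prime_int.1 hp).not_unit (isUnit_of_dvd_one h3)
  have h3 := Int.emultiplicity_pow_sub_pow hp (hp.odd_of_ne_two (by omega)) (x := l) (y := 1) h1 h2 p
  rw [one_pow] at h3
  have h4 : emultiplicity p p = 1 := by
    simpa using Nat.Prime.emultiplicity_self hp
  rw [h4] at h3
  have h5 := pow_dvd_iff_le_emultiplicity.1 h
  rw [h3] at h5
  apply pow_dvd_iff_le_emultiplicity.2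
  push_cast at h5
  exact (ENat.add_le_add_iff_right (by simp)).1 h5

section laz
variable {A : Type} [AddCommGroup A]

lemma p2A [Finite A] {p e n : ℕ} (hp : p.Prime) (he : ∀ a : A, (p ^ e : ℕ) • a = 0) (x : A)
    (hx : (p ^ (e - 1) : ℕ) • x ≠ 0) (hA : Nat.card A = p ^ n) (hn : n ≤ e + 2) :
    ∀ a : A, ∃ i : ℤ, p ^ 2 • a = i • p ^ 2 • x := by
  have := Fact.mk hp
  have : NeZero (p ^ e) := ⟨(pow_pos hp.pos e).ne'⟩
  obtain ⟨φ, hφ⟩ := exists_phi hp he x hx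
  have hYc : Nat.card φ.ker ∣ p ^ 2 := by
    have h1 : φ.ker.index = p ^ e := by
      rw [AddSubgroup.index_ker]
      have : φ.range = ⊤ := by
        rw [AddMonoidHom.range_eq_top]
        intro t; exact ⟨t.val • x, by simp [hφ]⟩
      rw [this]; simp
    have h2 := φ.ker.card_mul_index
    rw [h1, hA] at h2
    have h3 : p ^ n ∣ p ^ 2 * p ^ e := by
      rw [← pow_add]; exact pow_dvd_pow p (by omega)
    rw [← h2] at h3
    exact Nat.dvd_of_mul_dvd_mul_right (pow_pos hp.pos _) h3
  have hY2 : ∀ y, φ y = 0 → p ^ 2 • y = 0 := fun y hy => by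
    have h1 : Nat.card φ.ker • (⟨y, hy⟩ : φ.ker) = 0 := card_nsmul_eq_zero'
    obtain ⟨m, hm⟩ := hYc
    have h2 : Nat.card φ.ker • y = 0 := congrArg Subtype.val h1
    rw [hm, mul_comm, mul_smul, h2, smul_zero]
  intro a
  have h := hY2 (a - ((φ a).val : ℤ) • x) (by simp [hφ])
  refine ⟨(φ a).val, ?_⟩
  rw [smul_sub, sub_eq_zero] at h
  rw [h, smul_comm]

lemma FE_tht (s : LS A) (σ : A →+ A) (hσ : ∀ a b, σ (s.br a b) = s.br (σ a) (σ b))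
    (hs : Function.Surjective σ) (τ : A →+ A) (hτ : ∀ a, τ a = σ a - a) (hn : ∃ n : ℕ, ∀ a, τ^[n] a = 0) :
    FE (Tht s τ) := by
  intro U V hVU hU hV
  have mτ : τ ∈ Tht s τ := Set.mem_insert _ _
  have mad : ∀ a, s.ad a ∈ Tht s τ := fun a => Set.mem_insert_of_mem _ ⟨a, rfl⟩
  obtain ⟨u0, h0U, h0V⟩ := SetLike.exists_of_lt hVU
  have step : ∀ u ∈ U, (∀ a b c d, s.br a (s.br b (s.br c (s.br d u))) = 0) := fun u _ a b c d => s.nil _ _ _ _ _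
  have st1 : ∃ u ∈ U, u ∉ V ∧ ∀ a, s.br a u ∈ V := by
    by_contra hcon
    push Not at hcon
    obtain ⟨a, ha⟩ := hcon u0 h0U h0V
    have hUa : ∀ u ∈ U, ∀ a, s.br a u ∈ U := fun u hu a => hU _ (mad a) u hu
    have m1 := hUa _ h0U a
    obtain ⟨b, hb⟩ := hcon _ m1 ha
    have m2 := hUa _ m1 b
    obtain ⟨c, hc⟩ := hcon _ m2 hb
    have m3 := hUa _ m2 c
    obtain ⟨d, hd⟩ := hcon _ m3 hc
    rw [s.nil] at hd
    exact hd V.zero_mem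
  obtain ⟨u, huU, huV, hu⟩ := st1
  have hVσ : ∀ v ∈ V, σ v ∈ V := fun v hv => by
    have := V.add_mem (hV τ mτ v hv) hv
    rwa [hτ, sub_add_cancel] at this
  obtain ⟨n, hn⟩ := hn
  have hx : ∃ n, τ^[n] u ∈ V := ⟨n, by rw [hn]; exact V.zero_mem⟩
  classical
  have hall : ∀ k, τ^[k] u ∈ U ∧ ∀ a, s.br a (τ^[k] u) ∈ V := by
    intro k
    induction k with
    | zero => exact ⟨huU, hu⟩
    | succ k ih =>
      rw [Function.iterate_succ_apply']
      refine ⟨hU τ mτ _ ih.1, fun a => ?_⟩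
      obtain ⟨b, rfl⟩ := hs a
      rw [hτ, s.sub_r, ← hσ]
      exact V.sub_mem (hVσ _ (ih.2 b)) (ih.2 _)
  set k := Nat.find hx with hk
  have hk1 : τ^[k] u ∈ V := Nat.find_spec hx
  have hk0 : k ≠ 0 := by intro h; rw [h] at hk1; exact huV hk1
  obtain ⟨l, hl⟩ := Nat.exists_eq_succ_of_ne_zero hk0
  refine ⟨τ^[l] u, (hall l).1, Nat.find_min hx (by omega), ?_⟩
  intro θ hθ
  rcases hθ with rfl | ⟨a, rfl⟩
  · rw [← Function.iterate_succ_apply' θ]; rw [hl] at hk1; exact hk1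
  · exact (hall l).2 a

lemma tau_nilp {p e N : ℕ} (hp : p.Prime) (he : ∀ a : A, (p ^ e : ℕ) • a = 0) (σ τ : A →+ A)
    (hτ : ∀ a, τ a = σ a - a) (hN : ∀ a, σ^[p ^ N] a = a) : ∃ n : ℕ, ∀ a, τ^[n] a = 0 := by
  let S : AddMonoid.End A := σ
  let T : AddMonoid.End A := τ
  have h1 : T + 1 = S := by
    ext a; change τ a + a = σ a; rw [hτ, sub_add_cancel]
  have h2 : S ^ p ^ N = 1 := by
    ext a; rw [AddMonoid.End.coe_pow]; exact hN a
  obtain ⟨r, hr⟩ := Commute.exists_add_pow_prime_pow_eq hp (Commute.one_right T) N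
  rw [h1, h2, one_pow] at hr
  have h3 : T ^ p ^ N = (p : AddMonoid.End A) * (-(T * r)) := by
    have : T ^ p ^ N + (p * T * 1 * r) = 0 := by
      have := hr.symm
      rw [add_right_comm] at this
      simpa using this
    rw [eq_neg_of_add_eq_zero_left this]; simp [mul_assoc]
  refine ⟨p ^ N * e, fun a => ?_⟩
  have h4 : T ^ (p ^ N * e) = 0 := by
    rw [pow_mul, h3, Commute.mul_pow (Nat.cast_commute _ _)]
    ext a
    change ((p : AddMonoid.End A) ^ e) _ = 0
    rw [← Nat.cast_pow, AddMonoid.End.natCast_apply, he]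
  have := congrArg (fun F : AddMonoid.End A => F a) h4
  exact (congrFun (AddMonoid.End.coe_pow _ T _).symm a).trans this

end laz

def Laz (G : Type) [Group G] : Prop := ∃ (B : Type) (_ : AddCommGroup B) (r : LS B) (f : B → G),
  Function.Bijective f ∧ ∀ a b, f (r.mul a b) = f a * f b

lemma exists_max {G : Type} [Group G] {p e : ℕ} (hp : p.Prime) (he : 1 ≤ e) (h : Monoid.exponent G = p ^ e) :
    ∃ x : G, orderOf x = p ^ e ∧ x ^ p ^ (e - 1) ≠ 1 := by
  by_contra hcon
  push Not at hcon
  have := Fact.mk hp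
  have h1 : ∀ x : G, x ^ p ^ (e - 1) = 1 := by
    intro x
    by_contra hx
    apply hx
    apply hcon
    obtain ⟨m, rfl⟩ : ∃ m, e = m + 1 := ⟨e - 1, by omega⟩
    exact orderOf_eq_prime_pow (by simpa using hx) (by rw [← h]; exact Monoid.pow_exponent_eq_one x)
  have h2 := Monoid.exponent_dvd_of_forall_pow_eq_one h1
  rw [h, Nat.pow_dvd_pow_iff_le_right hp.one_lt] at h2
  omega

lemma tf6 {A : Type} [AddCommGroup A] {p e : ℕ} (hp : p.Prime) (h5 : 5 ≤ p) (he : ∀ a : A, (p ^ e : ℕ) • a = 0) (a : A)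
    (h : (6:ℤ) • a = 0) : a = 0 := by
  have hc : Nat.Coprime 6 (p ^ e) := by
    apply Nat.Coprime.pow_right
    rw [Nat.coprime_comm, hp.coprime_iff_not_dvd]
    intro h
    have : p ∣ 2 * 3 := h
    rcases (hp.dvd_mul).1 this with h | h
    · have := Nat.le_of_dvd (by norm_num) h; omega
    · have := Nat.le_of_dvd (by norm_num) h; omega
  have h1 : addOrderOf a ∣ 6 := addOrderOf_dvd_of_nsmul_eq_zero (by exact_mod_cast h)
  have h2 : addOrderOf a ∣ p ^ e := addOrderOf_dvd_of_nsmul_eq_zero (he a)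
  have h3 := Nat.dvd_gcd h1 h2
  rw [hc] at h3
  exact AddMonoid.addOrderOf_eq_one_iff.1 (Nat.dvd_one.1 h3)

theorem lazard_step {G : Type} [Group G] [Finite G] {p e f : ℕ} (hp : p.Prime) (h5 : 5 ≤ p) (he4 : 4 ≤ e) (hf : f ≤ 2)
    (hG : Nat.card G = p ^ (e + f + 1)) (hex : Monoid.exponent G = p ^ e) (H : Subgroup G)
    (hH : Nat.card H = p ^ (e + f)) (x : H) (hx : x ^ p ^ (e - 1) ≠ 1) (hl : Laz H) : Laz G := by
  have := Fact.mk hp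
  obtain ⟨A, _, s, f0, ⟨finj, fsurj⟩, hf0⟩ := hl
  have : Finite A := Finite.of_injective f0 finj
  have hA : Nat.card A = p ^ (e + f) := by rw [← hH]; exact Nat.card_congr (Equiv.ofBijective f0 ⟨finj, fsurj⟩)
  let F0 : s.E →* H := MonoidHom.mk' (fun a => f0 a) hf0
  have fpow : ∀ a (n : ℕ), f0 (n • a) = f0 a ^ n := fun a n => (congrArg F0 (s.e_nsmul a n)).trans (map_pow F0 _ _)
  have fone : f0 0 = 1 := by simpa using fpow 0 0
  have he : ∀ a : A, (p ^ e : ℕ) • a = 0 := fun a => by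
    apply finj
    rw [fpow, fone]
    apply Subtype.ext
    rw [← hex]
    simpa using Monoid.pow_exponent_eq_one (f0 a : G)
  obtain ⟨xa, rfl⟩ := fsurj x
  have hxa : (p ^ (e - 1) : ℕ) • xa ≠ 0 := fun h => hx (by rw [← fpow, h, fone])
  have tf := tf6 hp h5 he
  have hidx : H.index = p := by
    have := H.card_mul_index
    rw [hH, hG, pow_succ] at this
    exact Nat.eq_of_mul_eq_mul_left (pow_pos hp.pos _) this
  have hnor : H.Normal := by
    apply Subgroup.normal_of_index_eq_minFac_card
    rw [hidx, hG, Nat.Prime.pow_minFac hp (by omega)]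
  have hQ : Nat.card (G ⧸ H) = p := hidx
  obtain ⟨g, hg⟩ : ∃ g, g ∉ H := by
    by_contra hcon
    push Not at hcon
    have : H = ⊤ := by ext; simp [hcon]
    rw [this, Subgroup.index_top] at hidx
    omega
  have hgq : (QuotientGroup.mk g : G ⧸ H) ≠ 1 := fun h => hg ((QuotientGroup.eq_one_iff g).1 h)
  let ι : A → G := fun a => f0 a
  have hinj : Function.Injective ι := fun a b h => finj (Subtype.ext h)
  have hι : ∀ a b, ι (s.mul a b) = ι a * ι b := fun a b => by simp [ι, hf0]
  have hιr : ∀ h ∈ H, ∃ a, ι a = h := fun h hh => by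
    obtain ⟨a, ha⟩ := fsurj ⟨h, hh⟩
    exact ⟨a, by simp [ι, ha]⟩
  have hιH : ∀ a, ι a ∈ H := fun a => (f0 a).2
  have cσ : ∀ a, ∃ b, g * ι a * g⁻¹ = ι b := fun a => by
    obtain ⟨b, hb⟩ := hιr _ (hnor.conj_mem _ (hιH a) g); exact ⟨b, hb.symm⟩
  choose σ hσ using cσ
  have hσs : Function.Surjective σ := fun a => by
    obtain ⟨b, hb⟩ := hιr _ (hnor.conj_mem _ (hιH a) g⁻¹)
    refine ⟨b, hinj ?_⟩
    rw [← hσ, hb]; group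
  have hσm : ∀ a b, σ (s.mul a b) = s.mul (σ a) (σ b) := fun a b => hinj (by
    rw [← hσ, hι, hι, ← hσ, ← hσ]; group)
  obtain ⟨σadd, σbr⟩ := hom_lie s s σ tf hσm
  let S : A →+ A := AddMonoidHom.mk' σ σadd
  let τ : A →+ A := S - AddMonoidHom.id A
  have hτ : ∀ a, τ a = σ a - a := fun a => rfl
  have σit : ∀ (k : ℕ) a, ι (σ^[k] a) = g ^ k * ι a * (g ^ k)⁻¹ := by
    intro k
    induction k with
    | zero => intro a; simp
    | succ k ih => intro a; rw [Function.iterate_succ_apply, ih, ← hσ, pow_succ, mul_inv_rev]; simp only [mul_assoc]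
  obtain ⟨z, hz⟩ := hιr (g ^ p) (by
    rw [← QuotientGroup.eq_one_iff, QuotientGroup.mk_pow, ← hQ]; exact pow_card_eq_one')
  have σz : σ z = z := hinj (by rw [← hσ, hz]; group)
  have σp : ∀ b, σ^[p] b = s.mul (s.mul z b) (-z) := fun b => hinj (by
    rw [σit, hι, hι, ← hz]
    have : ι (-z) = (ι z)⁻¹ := by
      apply eq_inv_of_mul_eq_one_right
      rw [← hι, s.mul_neg']; simp [ι, fone]
    rw [this])
  have hp2 := p2A hp he xa hxa hA (by omega)
  have adx : ∀ a, s.br a (p ^ 2 • xa) = 0 := fun a => by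
    obtain ⟨i, hi⟩ := hp2 a
    rw [s.nsmul_r, ← s.nsmul_l, hi, s.zsmul_l, s.nsmul_l, s.self]; simp
  have hC : ∀ θ ∈ Tht s τ, ∃ k : ℤ, θ (p ^ 2 • xa) = k • p ^ (e - 1) • xa := by
    rintro θ (rfl | ⟨a, rfl⟩)
    · obtain ⟨l, hl⟩ := hp2 (σ xa)
      have e1 : σ (p ^ 2 • xa) = l • p ^ 2 • xa := by
        have : σ (p ^ 2 • xa) = p ^ 2 • σ xa := map_nsmul S _ _
        rw [this, hl]
      have e2 : ∀ k : ℕ, σ^[k] (p ^ 2 • xa) = (l ^ k) • p ^ 2 • xa := by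
        intro k
        induction k with
        | zero => simp
        | succ k ih =>
          rw [Function.iterate_succ_apply', ih]
          have : ∀ (n : ℤ) a, σ (n • a) = n • σ a := fun n a => map_zsmul S n a
          rw [this, e1, pow_succ l, mul_smul]
      have e3 := e2 p
      rw [σp, s.conj, adx] at e3
      simp only [s.zero_r, smul_zero, add_zero] at e3
      have e4 : (l ^ p - 1) • p ^ 2 • xa = 0 := by rw [sub_smul, one_smul, ← e3, sub_self]
      have hox : addOrderOf (p ^ 2 • xa) = p ^ ((e - 3) + 1) := by
        apply addOrderOf_eq_prime_pow
        · rw [← mul_smul, ← pow_add, show e - 3 + 2 = e - 1 by omega]; exact hxa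
        · rw [← mul_smul, ← pow_add, show e - 3 + 1 + 2 = e by omega]; exact he xa
      have e5 := addOrderOf_dvd_iff_zsmul_eq_zero.2 e4
      rw [hox] at e5
      obtain ⟨k, hk⟩ := int_lte hp h5 (e - 3) (by omega) l (by exact_mod_cast e5)
      refine ⟨k, ?_⟩
      rw [hτ, e1]
      have : l • p ^ 2 • xa - p ^ 2 • xa = (l - 1) • p ^ 2 • xa := by rw [sub_smul, one_smul]
      rw [this, hk, mul_comm, mul_smul]
      congr 1
      rw [← natCast_zsmul, ← natCast_zsmul, ← mul_smul]
      congr 1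
      push_cast
      rw [← pow_add]; congr 1; omega
    · exact ⟨0, by rw [zero_smul]; exact adx a⟩
  have hnil : ∃ n : ℕ, ∀ a, τ^[n] a = 0 := tau_nilp (N := e) hp he S τ hτ (fun a => hinj (by
    change ι (σ^[p ^ e] a) = _
    rw [σit, ← hex, Monoid.pow_exponent_eq_one]; simp))
  have hFE : FE (Tht s τ) := FE_tht s S σbr hσs τ hτ hnil
  have hw := words_zero hp he4 he xa hxa hA (by omega) hFE hC
  obtain ⟨m, hm⟩ : ∃ m : ℤ, ∀ a : A, (36 * m) • a = a := by
    have hc : IsCoprime (36 : ℤ) ((p ^ e : ℕ) : ℤ) := by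
      rw [show (36:ℤ) = ((36:ℕ):ℤ) by norm_num, Nat.isCoprime_iff_coprime]
      apply Nat.Coprime.pow_right
      rw [Nat.coprime_comm, hp.coprime_iff_not_dvd]
      intro h
      have : p ∣ 2 ^ 2 * 3 ^ 2 := h
      rcases (hp.dvd_mul).1 this with h | h
      · have := Nat.le_of_dvd (by norm_num) (hp.dvd_of_dvd_pow h); omega
      · have := Nat.le_of_dvd (by norm_num) (hp.dvd_of_dvd_pow h); omega
    obtain ⟨m, b, hb⟩ := hc
    refine ⟨m, fun a => ?_⟩
    have : (36 * m) = 1 - b * ((p ^ e : ℕ) : ℤ) := by linarith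
    rw [this, sub_smul, mul_smul, natCast_zsmul, he]; simp
  obtain ⟨t, ht, htc⟩ := ext_LS s τ m (fun a b => by
      simp only [hτ, σbr, s.sub_l, s.sub_r]; abel)
    (fun a => by
      simp only [mem_lev]
      intro θ₁ h₁ θ₂ h₂ θ₃ h₃ θ₄ h₄
      exact hw θ₄ h₄ θ₃ h₃ θ₂ h₂ θ₁ h₁ a) hm
  refine lazard_ext s ι hinj hι g σ hσ hσs t (Dlog τ m) ht (fun b => ?_) tf p z hz ?_ ?_ ?_
  · rw [htc, hτ, add_sub_cancel]
  · rintro i ⟨a, ha⟩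
    have h1 : g ^ i ∈ H := ha ▸ hιH a
    rw [← QuotientGroup.eq_one_iff, QuotientGroup.mk_zpow] at h1
    have h2 : orderOf (QuotientGroup.mk g : G ⧸ H) = p :=
      orderOf_eq_prime (by rw [← hQ]; exact pow_card_eq_one') hgq
    rw [← h2]
    exact orderOf_dvd_iff_zpow_eq_one.2 h1
  · intro h
    obtain ⟨i, hi⟩ := Subgroup.mem_zpowers_iff.1 (mem_zpowers_of_prime_card hQ hgq (g' := (QuotientGroup.mk h : G ⧸ H)))
    have h1 : h * (g ^ i)⁻¹ ∈ H := by
      rw [← QuotientGroup.eq_one_iff, QuotientGroup.mk_mul, QuotientGroup.mk_inv, QuotientGroup.mk_zpow, hi]; simp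
    obtain ⟨a, ha⟩ := hιr _ h1
    exact ⟨a, i, by rw [ha]; group⟩
  · rw [Dlog_apply, hτ, σz, sub_self]; simp

theorem lazard {p e : ℕ} (hp : p.Prime) (h5 : 5 ≤ p) (he4 : 4 ≤ e) : ∀ f ≤ 3, ∀ (G : Type) [Group G] [Finite G],
    Nat.card G = p ^ (e + f) → Monoid.exponent G = p ^ e → Laz G := by
  have := Fact.mk hp
  intro f
  induction f with
  | zero =>
    intro _ G _ _ hG hex
    obtain ⟨x, hx, -⟩ := exists_max hp (by omega) hex
    have hcy : IsCyclic G := isCyclic_of_orderOf_eq_card x (by rw [hx, hG, add_zero])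
    refine ⟨ZMod (Nat.card G), inferInstance, ⟨fun _ _ => 0, ?_, ?_, ?_, ?_, ?_⟩,
      fun a => zmodCyclicMulEquiv hcy (Multiplicative.ofAdd a), ?_, ?_⟩
    any_goals simp
    · exact (zmodCyclicMulEquiv hcy).bijective.comp Multiplicative.ofAdd.bijective
    · intro a b
      simp [LS.mul]
  | succ f ih =>
    intro hf G _ _ hG hex
    obtain ⟨x, hx, hx1⟩ := exists_max hp (by omega) hex
    obtain ⟨H, hH, hxH⟩ := Sylow.exists_subgroup_card_pow_prime_le p (n := e) (m := e + f)
      (by rw [hG]; exact pow_dvd_pow p (by omega)) (Subgroup.zpowers x) (by rw [Nat.card_zpowers, hx]) (by omega)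
    have hxm : x ∈ H := hxH (Subgroup.mem_zpowers x)
    have hHe : Monoid.exponent H = p ^ e := by
      apply Nat.dvd_antisymm
      · rw [← hex]; exact Monoid.exponent_dvd_of_forall_pow_eq_one (fun h => Subtype.ext (by
          simpa using Monoid.pow_exponent_eq_one (h : G)))
      · rw [← hx, ← Subgroup.orderOf_mk x hxm]; exact Monoid.order_dvd_exponent _
    exact lazard_step hp h5 he4 (by omega) hG hex H hH ⟨x, hxm⟩
      (fun h => hx1 (congrArg Subtype.val h)) (ih (by omega) H hH hHe)

def Cnt {C : Type*} (R : C → C → Prop) (P : C → Prop) (N : ℕ) : Prop :=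
  ∃ (I : Type) (_ : Finite I) (rep : I → C), Nat.card I = N ∧ (∀ i, P (rep i)) ∧
    (∀ c, P c → ∃ i, R c (rep i)) ∧ ∀ i j, R (rep i) (rep j) → i = j

lemma Cnt.split {C : Type*} {R : C → C → Prop} {P : C → Prop} {N₁ N₂ : ℕ} (Q : C → Prop)
    (hQ : ∀ c d, P c → P d → R c d → (Q c ↔ Q d)) (h1 : Cnt R (fun c => P c ∧ Q c) N₁)
    (h2 : Cnt R (fun c => P c ∧ ¬ Q c) N₂) : Cnt R P (N₁ + N₂) := by
  obtain ⟨I, _, r, hI, a1, a2, a3⟩ := h1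
  obtain ⟨J, _, t, hJ, b1, b2, b3⟩ := h2
  refine ⟨I ⊕ J, inferInstance, Sum.elim r t, by rw [Nat.card_sum, hI, hJ], ?_, ?_, ?_⟩
  · rintro (i | j)
    · exact (a1 i).1
    · exact (b1 j).1
  · intro c hc
    by_cases hq : Q c
    · obtain ⟨i, hi⟩ := a2 c ⟨hc, hq⟩; exact ⟨Sum.inl i, hi⟩
    · obtain ⟨i, hi⟩ := b2 c ⟨hc, hq⟩; exact ⟨Sum.inr i, hi⟩
  · rintro (i | i) (j | j) h
    · rw [a3 i j h]
    · exact absurd ((hQ _ _ (a1 i).1 (b1 j).1 h).1 (a1 i).2) (b1 j).2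
    · exact absurd ((hQ _ _ (b1 i).1 (a1 j).1 h).2 (a1 j).2) (b1 i).2
    · rw [b3 i j h]

lemma Cnt.congr {C : Type*} {R : C → C → Prop} {P Q : C → Prop} {N : ℕ} (h : Cnt R P N) (hPQ : ∀ c, P c ↔ Q c) : Cnt R Q N := by
  have : P = Q := funext fun c => propext (hPQ c)
  rwa [← this]

lemma Cnt.one {C : Type*} {R : C → C → Prop} {P : C → Prop} (c₀ : C) (h0 : P c₀) (h : ∀ c, P c → R c c₀) : Cnt R P 1 :=
  ⟨Unit, inferInstance, fun _ => c₀, by simp, fun _ => h0, fun c hc => ⟨(), h c hc⟩, fun _ _ _ => rfl⟩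

lemma Cnt.bridge {C D : Type*} {R : C → C → Prop} {S : D → D → Prop} {P : C → Prop} {Q : D → Prop} {N : ℕ}
    (h : Cnt R P N) (M : D → C → Prop) (ex : ∀ c, P c → ∃ L, Q L ∧ M L c) (cov : ∀ L, Q L → ∃ c, P c ∧ M L c)
    (iso : ∀ L L' c, M L c → M L' c → S L L') (tr : ∀ L L' c, S L L' → M L' c → M L c)
    (R1 : ∀ L c c', M L c → M L c' → R c c') (R2 : ∀ L c c', M L c → R c c' → M L c') : Cnt S Q N := by
  obtain ⟨I, _, r, hI, a1, a2, a3⟩ := h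
  choose L hL using fun i => ex (r i) (a1 i)
  refine ⟨I, inferInstance, L, hI, fun i => (hL i).1, fun K hK => ?_, fun i j hij => ?_⟩
  · obtain ⟨c, hc, hM⟩ := cov K hK
    obtain ⟨i, hi⟩ := a2 c hc
    exact ⟨i, iso _ _ _ (R2 _ _ _ hM hi) (hL i).2⟩
  · exact a3 i j (R1 _ _ _ (hL i).2 (tr _ _ _ hij (hL j).2))

structure LR where
  A : Type
  [g : AddCommGroup A]
  s : LS A

attribute [instance] LR.g

def LIso (L M : LR) : Prop := ∃ f : L.A ≃+ M.A, ∀ a b, f (L.s.br a b) = M.s.br (f a) (f b)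

def TT (p e : ℕ) (L : LR) : Prop :=
  Nat.card L.A = p ^ (e + 3) ∧ (∀ a : L.A, (p ^ e : ℕ) • a = 0) ∧ ∃ x : L.A, (p ^ (e - 1) : ℕ) • x ≠ 0

lemma expE {L : LR} {p e : ℕ} (hp : p.Prime) (he : 1 ≤ e) :
    Monoid.exponent L.s.E = p ^ e ↔ ((∀ a : L.A, (p ^ e : ℕ) • a = 0) ∧ ∃ x : L.A, (p ^ (e - 1) : ℕ) • x ≠ 0) := by
  constructor
  · intro h
    refine ⟨fun a => L.s.e_inj (by rw [L.s.e_nsmul, ← h]; exact Monoid.pow_exponent_eq_one _), ?_⟩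
    obtain ⟨x, -, hx⟩ := exists_max hp he h
    exact ⟨x, fun h => hx ((L.s.e_nsmul x _).symm.trans h)⟩
  · rintro ⟨h, x, hx⟩
    have h1 : Monoid.exponent L.s.E ∣ p ^ e := Monoid.exponent_dvd_of_forall_pow_eq_one
      (fun a => (L.s.e_nsmul a _).symm.trans (h a))
    obtain ⟨k, hk, hk'⟩ := (Nat.dvd_prime_pow hp).1 h1
    rw [hk']
    congr 1
    by_contra hne
    apply hx
    have : p ^ k ∣ p ^ (e - 1) := pow_dvd_pow p (by omega)
    obtain ⟨m, hm⟩ := this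
    refine L.s.e_inj ?_
    rw [L.s.e_nsmul, hm, ← hk', pow_mul, Monoid.pow_exponent_eq_one, one_pow, L.s.e_zero]

theorem psi_of_cnt {p n N : ℕ} (hp : p.Prime) (h5 : 5 ≤ p) (hn : 7 ≤ n) (h : Cnt LIso (TT p (n - 3)) N) :
    PsiCoexp p n 3 = N := by
  obtain ⟨I, _, r, hI, a1, a2, a3⟩ := h
  have hfin : ∀ i, Finite (r i).A := fun i => Nat.finite_of_card_ne_zero (by rw [(a1 i).1]; exact pow_ne_zero _ hp.ne_zero)
  have hnn : n - 3 + 3 = n := by omega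
  have eqv : ∀ i, Nonempty (Fin (p ^ n) ≃ (r i).s.E) := fun i => by
    have h1 : Nat.card (r i).s.E = p ^ n := (a1 i).1.trans (by rw [hnn])
    have : Finite (r i).s.E := hfin i
    exact ⟨(finCongr h1.symm).trans (Finite.equivFin _).symm⟩
  let ε := fun i => (eqv i).some
  let G : I → Group (Fin (p ^ n)) := fun i => (ε i).group
  have me : ∀ i, Nonempty (@MulEquiv (Fin (p ^ n)) (r i).s.E (mulOfGroup _ (G i)) _) := fun i => by
    letI := G i
    exact ⟨(ε i).mulEquiv⟩
  have hG : ∀ i, (letI := G i; ∃ e : ℕ, Monoid.exponent (Fin (p ^ n)) = p ^ e ∧ n - e = 3) := fun i => by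
    letI := G i
    refine ⟨n - 3, ?_, by omega⟩
    have := (expE (L := r i) hp (by omega)).2 (a1 i).2
    rw [← this]
    exact Monoid.exponent_eq_of_mulEquiv (ε i).mulEquiv
  rw [← hI]
  symm
  unfold PsiCoexp groupClassCount
  refine Nat.card_congr (Equiv.ofBijective (fun i => Quot.mk _ ⟨G i, hG i⟩) ⟨?_, ?_⟩)
  · intro i j hij
    have h1 := Quot.eqvGen_exact hij
    have h2 : Nonempty (@MulEquiv (Fin (p ^ n)) (Fin (p ^ n)) (mulOfGroup _ (G i)) (mulOfGroup _ (G j))) := by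
      refine (Equivalence.eqvGen_iff (r := fun s t : {s : Group (Fin (p ^ n)) // (letI := s; ∃ e : ℕ, Monoid.exponent (Fin (p ^ n)) = p ^ e ∧ n - e = 3)} =>
        Nonempty (@MulEquiv (Fin (p ^ n)) (Fin (p ^ n)) (mulOfGroup _ s.1) (mulOfGroup _ t.1))) ⟨?_, ?_, ?_⟩).1 h1
      · intro s; exact ⟨@MulEquiv.refl _ (mulOfGroup _ s.1)⟩
      · rintro s t ⟨f⟩; exact ⟨@MulEquiv.symm _ _ (mulOfGroup _ s.1) (mulOfGroup _ t.1) f⟩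
      · rintro s t u ⟨f⟩ ⟨g⟩; exact ⟨@MulEquiv.trans _ _ _ (mulOfGroup _ s.1) (mulOfGroup _ t.1) (mulOfGroup _ u.1) f g⟩
    obtain ⟨f⟩ := h2
    obtain ⟨fi⟩ := me i
    obtain ⟨fj⟩ := me j
    obtain ⟨F⟩ : Nonempty ((r i).s.E ≃* (r j).s.E) :=
      ⟨@MulEquiv.trans _ _ _ _ (mulOfGroup _ (G i)) _ (@MulEquiv.symm _ _ (mulOfGroup _ (G i)) _ fi)
        (@MulEquiv.trans _ _ _ (mulOfGroup _ (G i)) (mulOfGroup _ (G j)) _ f fj)⟩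
    obtain ⟨h3, h4⟩ := hom_lie (r i).s (r j).s F (tf6 hp h5 (a1 j).2.1) (fun a b => F.map_mul a b)
    exact a3 i j ⟨AddEquiv.mk' F.toEquiv h3, h4⟩
  · intro q
    obtain ⟨⟨s, hs⟩, rfl⟩ := Quot.exists_rep q
    letI := s
    obtain ⟨e, he, hne⟩ := hs
    obtain rfl : e = n - 3 := by omega
    obtain ⟨B, _, t, f, hf, hfm⟩ := lazard hp h5 (by omega) 3 le_rfl (Fin (p ^ n)) (by simp [hnn]) he
    let L : LR := ⟨B, t⟩
    obtain ⟨F⟩ : Nonempty (@MulEquiv L.s.E (Fin (p ^ n)) _ s.toMul) := ⟨@MulEquiv.mk' _ _ _ s.toMul (Equiv.ofBijective f hf) hfm⟩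
    have hL : TT p (n - 3) L := by
      refine ⟨?_, (expE hp (by omega)).1 ?_⟩
      · rw [hnn]; exact (Nat.card_congr (Equiv.ofBijective f hf)).trans (by simp)
      · rw [← he]; exact Monoid.exponent_eq_of_mulEquiv F
    obtain ⟨i, k, hk⟩ := a2 L hL
    refine ⟨i, Quot.sound ?_⟩
    obtain ⟨fi⟩ := me i
    have hmul : ∀ a b : L.A, k (L.s.mul a b) = (r i).s.mul (k a) (k b) := fun a b => (map_mulLS L.s (r i).s k.toAddMonoidHom (fun a b => (hk a b).symm) a b).symm
    let K : L.s.E ≃* (r i).s.E := MulEquiv.mk' k.toEquiv hmul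
    exact ⟨@MulEquiv.trans _ _ _ (mulOfGroup _ (G i)) _ (mulOfGroup _ s) fi (@MulEquiv.trans _ _ _ _ _ (mulOfGroup _ s) K.symm F)⟩

lemma LIso.refl (L : LR) : LIso L L := ⟨AddEquiv.refl _, fun _ _ => rfl⟩
lemma LIso.symm {L M : LR} (h : LIso L M) : LIso M L := by
  obtain ⟨f, hf⟩ := h
  exact ⟨f.symm, fun a b => f.injective (by rw [hf]; simp)⟩

def Pres {Z : Type} [AddCommGroup Z] (Lat : Z → Prop) (F : Z → Z → Z) (L : LR) : Prop :=
  ∃ q : Z →+ L.A, Function.Surjective q ∧ (∀ v, q v = 0 ↔ Lat v) ∧ ∀ a b, L.s.br (q a) (q b) = q (F a b)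

section pres
variable {Z : Type} [AddCommGroup Z] {Lat : Z → Prop} {F F' : Z → Z → Z} {L M : LR}

lemma Pres.iso (h : Pres Lat F L) (h' : Pres Lat F M) : LIso L M := by
  obtain ⟨q, q1, q2, q3⟩ := h
  obtain ⟨r, r1, r2, r3⟩ := h'
  have hk : q.ker = r.ker := by ext v; simp [AddMonoidHom.mem_ker, q2, r2]
  let f := ((QuotientAddGroup.quotientKerEquivOfSurjective q q1).symm.trans
    (QuotientAddGroup.quotientAddEquivOfEq hk)).trans (QuotientAddGroup.quotientKerEquivOfSurjective r r1)
  have hf : ∀ v, f (q v) = r v := fun v => by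
    have : (QuotientAddGroup.quotientKerEquivOfSurjective q q1).symm (q v) = (v : Z ⧸ q.ker) := by
      rw [AddEquiv.symm_apply_eq]; rfl
    simp only [f, AddEquiv.trans_apply, this]
    rfl
  refine ⟨f, fun a b => ?_⟩
  obtain ⟨a, rfl⟩ := q1 a
  obtain ⟨b, rfl⟩ := q1 b
  rw [q3, hf, hf, hf, r3]

lemma Pres.tr (h : LIso L M) (h' : Pres Lat F M) : Pres Lat F L := by
  obtain ⟨f, hf⟩ := h.symm
  obtain ⟨r, r1, r2, r3⟩ := h'
  refine ⟨f.toAddMonoidHom.comp r, f.surjective.comp r1, fun v => ?_, fun a b => ?_⟩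
  · rw [← r2]; exact f.map_eq_zero_iff
  · change L.s.br (f (r a)) (f (r b)) = f (r (F a b))
    rw [← r3, hf]

lemma Pres.two [Module.Projective ℤ Z] (h : Pres Lat F L) (h' : Pres Lat F' L) :
    ∃ T T' : Z →+ Z, (∀ v, Lat (T v) ↔ Lat v) ∧ (∀ v, Lat (T (T' v) - v)) ∧
      ∀ a b, Lat (T (F' a b) - F (T a) (T b)) := by
  obtain ⟨q, q1, q2, q3⟩ := h
  obtain ⟨r, r1, r2, r3⟩ := h'
  obtain ⟨T, hT⟩ := Module.projective_lifting_property q.toIntLinearMap r.toIntLinearMap q1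
  obtain ⟨T', hT'⟩ := Module.projective_lifting_property r.toIntLinearMap q.toIntLinearMap r1
  have hT : ∀ v, q (T v) = r v := fun v => LinearMap.congr_fun hT v
  have hT' : ∀ v, r (T' v) = q v := fun v => LinearMap.congr_fun hT' v
  refine ⟨T.toAddMonoidHom, T'.toAddMonoidHom, fun v => ?_, fun v => ?_, fun a b => ?_⟩
  · rw [← q2, ← r2, ← hT]; rfl
  · rw [← q2, map_sub, sub_eq_zero]; exact (hT _).trans (hT' _)
  · rw [← q2, map_sub, sub_eq_zero]
    change q (T _) = q (F (T a) (T b))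
    rw [← q3, hT, hT, hT, r3]

lemma Pres.chg [Finite L.A] {p e : ℕ} (he : ∀ a : L.A, (p ^ e : ℕ) • a = 0) (h : Pres Lat F L) (T : Z →+ Z)
    (h1 : ∀ v, Lat v → Lat (T v)) (h2 : ∀ v, ∃ v' w, T v' = v + p • w)
    (h3 : ∀ a b, Lat (T (F' a b) - F (T a) (T b))) : Pres Lat F' L := by
  obtain ⟨q, q1, q2, q3⟩ := h
  have hs : Function.Surjective (q.comp T) := by
    intro a
    have key : ∀ k : ℕ, ∃ v b, a = q (T v) + p ^ k • b := by
      intro k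
      induction k with
      | zero => exact ⟨0, a, by simp⟩
      | succ k ih =>
        obtain ⟨v, b, hb⟩ := ih
        obtain ⟨b, rfl⟩ := q1 b
        obtain ⟨v', w, hw⟩ := h2 b
        refine ⟨v + p ^ k • v', - q w, ?_⟩
        rw [hb, map_add, map_add, map_nsmul, map_nsmul, hw, map_add, map_nsmul, smul_add, ← mul_smul, ← pow_succ, smul_neg]
        abel
    obtain ⟨v, b, hb⟩ := key e
    exact ⟨v, by rw [hb, he, add_zero]; rfl⟩
  refine ⟨q.comp T, hs, fun v => ⟨fun hv => ?_, fun hv => (q2 _).2 (h1 v hv)⟩, fun a b => ?_⟩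
  · have hle : q.ker ≤ (q.comp T).ker := fun v hv => (q2 _).2 (h1 v ((q2 v).1 hv))
    let f : L.A →+ L.A := AddMonoidHom.liftOfSurjective q q1 ⟨q.comp T, hle⟩
    have hf : ∀ v, f (q v) = q (T v) := fun v =>
      AddMonoidHom.liftOfRightInverse_comp_apply q _ (Function.rightInverse_surjInv q1) ⟨q.comp T, hle⟩ v
    have fs : Function.Surjective f := fun a => by
      obtain ⟨v, hv⟩ := hs a; exact ⟨q v, (hf v).trans hv⟩
    have fi := Finite.injective_iff_surjective.2 fs
    rw [← q2]
    apply fi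
    rw [hf, map_zero]; exact hv
  · change L.s.br (q (T a)) (q (T b)) = q (T _)
    rw [q3, ← sub_eq_zero, ← map_sub, ← neg_sub, map_neg, (q2 _).2 (h3 a b), neg_zero]

lemma Pres.ex (hL : ∃ Λ : AddSubgroup Z, ∀ v, v ∈ Λ ↔ Lat v)
    (hw : ∀ a b c, Lat c → Lat (F (a + c) b - F a b) ∧ Lat (F b (a + c) - F b a))
    (hl : ∀ a b c, Lat (F (a + b) c - (F a c + F b c))) (hr : ∀ a b c, Lat (F c (a + b) - (F c a + F c b)))
    (hs : ∀ a, Lat (F a a)) (hj : ∀ a b c, Lat (F (F a b) c - (F a (F b c) - F b (F a c))))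
    (hn : ∀ a b c d e, Lat (F a (F b (F c (F d e))))) :
    ∃ (Λ : AddSubgroup Z) (s : LS (Z ⧸ Λ)), (∀ v, v ∈ Λ ↔ Lat v) ∧ Pres Lat F ⟨Z ⧸ Λ, s⟩ := by
  obtain ⟨Λ, hΛ⟩ := hL
  let q : Z →+ Z ⧸ Λ := QuotientAddGroup.mk' Λ
  have hq : Function.Surjective q := QuotientAddGroup.mk'_surjective Λ
  have q0 : ∀ v, q v = 0 ↔ Lat v := fun v => by rw [← hΛ]; exact QuotientAddGroup.eq_zero_iff v
  have qe : ∀ v w, Lat (v - w) → q v = q w := fun v w h => by rw [← sub_eq_zero, ← map_sub, q0]; exact h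
  have qe' : ∀ v w, q v = q w → Lat (w - v) := fun v w h => by rw [← q0, map_sub, h, sub_self]
  let σ := Function.surjInv hq
  have hσ : ∀ a, q (σ a) = a := Function.surjInv_eq hq
  let br : Z ⧸ Λ → Z ⧸ Λ → Z ⧸ Λ := fun a b => q (F (σ a) (σ b))
  have hb : ∀ a b, br (q a) (q b) = q (F a b) := fun a b => by
    have e1 := qe' _ _ (hσ (q a)).symm
    have e2 := qe' _ _ (hσ (q b)).symm
    have f1 := qe _ _ (hw a (σ (q b)) _ e1).1
    have f2 := qe _ _ (hw b a _ e2).2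
    rw [add_sub_cancel] at f1 f2
    exact f1.trans f2
  let s : LS (Z ⧸ Λ) :=
    { br := br
      add_l := fun a b c => by
        obtain ⟨a, rfl⟩ := hq a; obtain ⟨b, rfl⟩ := hq b; obtain ⟨c, rfl⟩ := hq c
        rw [← map_add, hb, hb, hb, ← map_add]; exact qe _ _ (hl _ _ _)
      add_r := fun c a b => by
        obtain ⟨a, rfl⟩ := hq a; obtain ⟨b, rfl⟩ := hq b; obtain ⟨c, rfl⟩ := hq c
        rw [← map_add, hb, hb, hb, ← map_add]; exact qe _ _ (hr _ _ _)
      self := fun a => by obtain ⟨a, rfl⟩ := hq a; rw [hb]; exact (q0 _).2 (hs a)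
      jac := fun a b c => by
        obtain ⟨a, rfl⟩ := hq a; obtain ⟨b, rfl⟩ := hq b; obtain ⟨c, rfl⟩ := hq c
        simp only [hb]; rw [← map_sub]; exact qe _ _ (hj a b c)
      nil := fun a b c d e => by
        obtain ⟨a, rfl⟩ := hq a; obtain ⟨b, rfl⟩ := hq b; obtain ⟨c, rfl⟩ := hq c
        obtain ⟨d, rfl⟩ := hq d; obtain ⟨e, rfl⟩ := hq e
        simp only [hb]; exact (q0 _).2 (hn a b c d e) }
  exact ⟨Λ, s, hΛ, q, hq, q0, hb⟩

end pres

lemma powreps {p : ℕ} [Fact p.Prime] (k : ℕ) : ∃ (I : Type) (_ : Finite I) (r : I → ZMod p),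
    Nat.card I = Nat.gcd (p - 1) k ∧ (∀ i, r i ≠ 0) ∧ (∀ c, c ≠ 0 → ∃ i, ∃ t, t ≠ 0 ∧ r i = t ^ k * c) ∧
    ∀ i j t, t ≠ 0 → r i = t ^ k * r j → i = j := by
  let H : Subgroup (ZMod p)ˣ := (powMonoidHom k).range
  refine ⟨(ZMod p)ˣ ⧸ H, inferInstance, fun i => (i.out : (ZMod p)ˣ), ?_, fun i => Units.ne_zero _, ?_, ?_⟩
  · rw [← Subgroup.index_eq_card, IsCyclic.index_powMonoidHom_range, Nat.card_eq_fintype_card, ZMod.card_units]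
  · intro c hc
    obtain ⟨⟨t, ht⟩, h⟩ := QuotientGroup.mk_out_eq_mul H (Units.mk0 c hc)
    obtain ⟨u, rfl⟩ := ht
    refine ⟨(QuotientGroup.mk (Units.mk0 c hc)), u, u.ne_zero, ?_⟩
    simp only [h]; simp [mul_comm]
  · intro i j t ht h
    rw [← QuotientGroup.out_eq' i, ← QuotientGroup.out_eq' j, QuotientGroup.eq]
    refine ⟨(Units.mk0 t ht)⁻¹, ?_⟩
    have h' : i.out = (Units.mk0 t ht) ^ k * j.out := Units.ext (by simpa using h)
    rw [h', powMonoidHom_apply, mul_inv_rev, inv_pow]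
    simp [mul_comm]

lemma ker_eqv {Z A B : Type} [AddCommGroup Z] [AddCommGroup A] [AddCommGroup B] (q : Z →+ A) (r : Z →+ B)
    (hr : Function.Surjective r) (h : ∀ v, q v = 0 ↔ r v = 0) : Nat.card q.range = Nat.card B := by
  have hk : q.ker = r.ker := by ext v; simp [AddMonoidHom.mem_ker, h]
  exact Nat.card_congr (((QuotientAddGroup.quotientKerEquivRange q).symm.trans
    (QuotientAddGroup.quotientAddEquivOfEq hk)).trans (QuotientAddGroup.quotientKerEquivOfSurjective r hr)).toEquiv

lemma ker_surj {Z A : Type} [AddCommGroup Z] [AddCommGroup A] [Finite A] {q : Z →+ A}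
    (h : Nat.card q.range = Nat.card A) : Function.Surjective q := by
  rw [← AddMonoidHom.range_eq_top]
  exact AddSubgroup.eq_top_of_card_eq _ h

def Lat3 (p e : ℕ) (v : ℤ × ℤ) : Prop := (p:ℤ) ^ e ∣ v.1 ∧ (p:ℤ) ^ 3 ∣ v.2
def Lat21 (p e : ℕ) (v : ℤ × ℤ × ℤ) : Prop := (p:ℤ) ^ e ∣ v.1 ∧ (p:ℤ) ^ 2 ∣ v.2.1 ∧ (p:ℤ) ∣ v.2.2
def Lat111 (p e : ℕ) (v : ℤ × ℤ × ℤ × ℤ) : Prop :=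
  (p:ℤ) ^ e ∣ v.1 ∧ (p:ℤ) ∣ v.2.1 ∧ (p:ℤ) ∣ v.2.2.1 ∧ (p:ℤ) ∣ v.2.2.2

section cards
variable {A : Type} [AddCommGroup A] {p e : ℕ}

lemma c0 (n : ℕ) (i : ℤ) : Int.castAddHom (ZMod n) i = 0 ↔ (n:ℤ) ∣ i := ZMod.intCast_zmod_eq_zero_iff_dvd i n
lemma cs (n : ℕ) : Function.Surjective (Int.castAddHom (ZMod n)) := ZMod.intCast_surjective

lemma card3 (q : ℤ × ℤ →+ A) (h : ∀ v, q v = 0 ↔ Lat3 p e v) : Nat.card q.range = p ^ (e + 3) := by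
  rw [ker_eqv q ((Int.castAddHom (ZMod (p ^ e))).prodMap (Int.castAddHom (ZMod (p ^ 3)))) ((cs _).prodMap (cs _))]
  · simp [Nat.card_prod, Nat.card_zmod, pow_add]
  · intro v; rw [h]
    change _ ↔ (_, _) = ((0, 0) : ZMod (p ^ e) × ZMod (p ^ 3))
    rw [Prod.mk.injEq]; erw [c0, c0]; simp [Lat3]

lemma card21 (q : ℤ × ℤ × ℤ →+ A) (h : ∀ v, q v = 0 ↔ Lat21 p e v) : Nat.card q.range = p ^ (e + 3) := by
  rw [ker_eqv q ((Int.castAddHom (ZMod (p ^ e))).prodMap ((Int.castAddHom (ZMod (p ^ 2))).prodMap (Int.castAddHom (ZMod p))))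
    ((cs _).prodMap ((cs _).prodMap (cs _)))]
  · simp only [Nat.card_prod, Nat.card_zmod]; ring
  · intro v; rw [h]
    change _ ↔ (_, _, _) = ((0, 0, 0) : ZMod (p ^ e) × ZMod (p ^ 2) × ZMod p)
    rw [Prod.mk.injEq, Prod.mk.injEq]; erw [c0, c0, c0]; simp [Lat21]

lemma card111 (q : ℤ × ℤ × ℤ × ℤ →+ A) (h : ∀ v, q v = 0 ↔ Lat111 p e v) : Nat.card q.range = p ^ (e + 3) := by
  rw [ker_eqv q ((Int.castAddHom (ZMod (p ^ e))).prodMap ((Int.castAddHom (ZMod p)).prodMap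
    ((Int.castAddHom (ZMod p)).prodMap (Int.castAddHom (ZMod p)))))
    ((cs _).prodMap ((cs _).prodMap ((cs _).prodMap (cs _))))]
  · simp only [Nat.card_prod, Nat.card_zmod]; ring
  · intro v; rw [h]
    change _ ↔ (_, _, _, _) = ((0, 0, 0, 0) : ZMod (p ^ e) × ZMod p × ZMod p × ZMod p)
    rw [Prod.mk.injEq, Prod.mk.injEq, Prod.mk.injEq]; erw [c0, c0, c0, c0]; simp [Lat111]

lemma splitx [Finite A] (hp : p.Prime) (h : ∀ a : A, (p ^ e : ℕ) • a = 0) (x : A) (hx : (p ^ (e - 1) : ℕ) • x ≠ 0) :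
    ∃ K : AddSubgroup A, (∀ a, ∃ i : ℤ, ∃ k ∈ K, a = i • x + k) ∧
      (∀ i : ℤ, ∀ k ∈ K, i • x + k = 0 → (p:ℤ) ^ e ∣ i ∧ k = 0) ∧ p ^ e * Nat.card K = Nat.card A := by
  obtain ⟨φ, hφ⟩ := exists_phi hp h x hx
  have hs : Function.Surjective φ := fun a => by
    obtain ⟨i, rfl⟩ := ZMod.intCast_surjective a
    exact ⟨i • x, by rw [map_zsmul, hφ]; simp⟩
  refine ⟨φ.ker, fun a => ?_, fun i k hk hik => ?_, ?_⟩
  · obtain ⟨i, hi⟩ := ZMod.intCast_surjective (φ a)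
    refine ⟨i, a - i • x, ?_, by abel⟩
    rw [AddMonoidHom.mem_ker, map_sub, map_zsmul, hφ, ← hi]; simp
  · have h1 := congrArg φ hik
    rw [map_add, hk, map_zsmul, hφ, map_zero, add_zero, zsmul_one] at h1
    have h2 := (ZMod.intCast_zmod_eq_zero_iff_dvd i (p ^ e)).1 h1
    push_cast at h2
    refine ⟨h2, ?_⟩
    obtain ⟨j, rfl⟩ := h2
    have h3 := h x
    rw [← natCast_zsmul] at h3
    push_cast at h3
    rw [mul_comm, mul_smul, h3] at hik
    simpa using hik
  · have := φ.ker.card_mul_index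
    rw [AddSubgroup.index_ker, AddMonoidHom.range_eq_top.2 hs, AddSubgroup.card_top, Nat.card_zmod] at this
    rw [← this, mul_comm]

lemma zn {n : ℕ} {a : A} {i : ℤ} (h : n • a = 0) (hi : (n:ℤ) ∣ i) : i • a = 0 := by
  obtain ⟨j, rfl⟩ := hi
  rw [mul_comm, mul_smul, natCast_zsmul, h, smul_zero]

def lin2 (x y : A) : ℤ × ℤ →+ A := (zmultiplesHom A x).coprod (zmultiplesHom A y)
def lin3 (x y w : A) : ℤ × ℤ × ℤ →+ A := (zmultiplesHom A x).coprod (lin2 y w)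
def lin4 (x y w z : A) : ℤ × ℤ × ℤ × ℤ →+ A := (zmultiplesHom A x).coprod (lin3 y w z)
lemma lin2_apply (x y : A) (v) : lin2 x y v = v.1 • x + v.2 • y := by simp [lin2]
lemma lin3_apply (x y w : A) (v) : lin3 x y w v = v.1 • x + (v.2.1 • y + v.2.2 • w) := by simp [lin3, lin2]
lemma lin4_apply (x y w z : A) (v) : lin4 x y w z v = v.1 • x + (v.2.1 • y + (v.2.2.1 • w + v.2.2.2 • z)) := by
  simp [lin4, lin3, lin2]

lemma types [Finite A] (hp : p.Prime) (hc : Nat.card A = p ^ (e + 3)) (h : ∀ a : A, (p ^ e : ℕ) • a = 0) (x : A)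
    (hx : (p ^ (e - 1) : ℕ) • x ≠ 0) :
    (∃ y, ∀ v, lin2 x y v = 0 ↔ Lat3 p e v) ∨ (∃ y w, ∀ v, lin3 x y w v = 0 ↔ Lat21 p e v) ∨
    (∀ a, ∃ i : ℤ, p • (a - i • x) = 0) := by
  obtain ⟨K, g1, g2, g3⟩ := splitx hp h x hx
  have hK : Nat.card K = p ^ 3 := by
    rw [hc, pow_add] at g3; exact Nat.eq_of_mul_eq_mul_left (pow_pos hp.pos _) g3
  have hxe : ∀ i : ℤ, (p:ℤ) ^ e ∣ i → i • x = 0 := fun i hi => zn (h x) (by exact_mod_cast hi)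
  have k3 : ∀ k : K, (p ^ 3 : ℕ) • k = 0 := fun k => by rw [← hK]; exact card_nsmul_eq_zero'
  by_cases c3 : ∃ y : K, (p ^ (3 - 1) : ℕ) • y ≠ 0
  · left
    obtain ⟨y, hy⟩ := c3
    obtain ⟨K', -, l2, -⟩ := splitx hp k3 y hy
    refine ⟨y, fun v => ?_⟩
    rw [lin2_apply]
    constructor
    · intro hv
      obtain ⟨a1, a2⟩ := g2 v.1 _ (K.zsmul_mem y.2 v.2) hv
      exact ⟨a1, (l2 v.2 0 K'.zero_mem (by rw [add_zero]; exact Subtype.ext a2)).1⟩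
    · rintro ⟨a1, a2⟩
      have : v.2 • y = 0 := zn (k3 y) (by exact_mod_cast a2)
      have : v.2 • (y:A) = 0 := congrArg Subtype.val this
      rw [hxe _ a1, this, add_zero]
  right
  push Not at c3
  by_cases c2 : ∃ y : K, (p ^ (2 - 1) : ℕ) • y ≠ 0
  · left
    obtain ⟨y, hy⟩ := c2
    obtain ⟨K', -, l2, l3⟩ := splitx (e := 2) hp c3 y hy
    have hK' : Nat.card K' = p := by
      rw [hK, pow_succ p 2] at l3; exact Nat.eq_of_mul_eq_mul_left (pow_pos hp.pos _) l3
    have : Nontrivial K' := Finite.one_lt_card_iff_nontrivial.1 (by rw [hK']; exact hp.one_lt)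
    obtain ⟨w, hw⟩ := exists_ne (0 : K')
    have k1 : ∀ k : K', (p ^ 1 : ℕ) • k = 0 := fun k => by
      have : Nat.card K' • k = 0 := card_nsmul_eq_zero'
      rwa [hK', ← pow_one p] at this
    obtain ⟨K'', -, m2, -⟩ := splitx hp k1 w (by simpa using hw)
    refine ⟨y, (w : K), fun v => ?_⟩
    rw [lin3_apply]
    constructor
    · intro hv
      obtain ⟨a1, a2⟩ := g2 v.1 _ (K.add_mem (K.zsmul_mem y.2 v.2.1) (K.zsmul_mem (w : K).2 v.2.2)) hv
      obtain ⟨b1, b2⟩ := l2 v.2.1 _ (K'.zsmul_mem w.2 v.2.2) (Subtype.ext a2)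
      exact ⟨a1, b1, by simpa using (m2 v.2.2 0 K''.zero_mem (by rw [add_zero]; exact Subtype.ext b2)).1⟩
    · rintro ⟨a1, a2, a3⟩
      have : v.2.1 • y = 0 := zn (c3 y) (by exact_mod_cast a2)
      have e2 : v.2.1 • (y:A) = 0 := congrArg Subtype.val this
      have : v.2.2 • w = 0 := zn (k1 w) (by simpa using a3)
      have e3 : v.2.2 • ((w : K) : A) = 0 := congrArg (fun t : K' => ((t : K) : A)) this
      rw [hxe _ a1, e2, e3]; simp
  right
  push Not at c2
  intro a
  obtain ⟨i, k, hk, rfl⟩ := g1 a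
  refine ⟨i, ?_⟩
  have := c2 ⟨k, hk⟩
  rw [add_sub_cancel_left]
  simpa using congrArg Subtype.val this

end cards

structure FC (K : Type) where
  (a01 b01 z01 b02 z02 z03 b12 z12 z13 z23 : K)
structure PM (K : Type) where
  (u k1 k2 k3 m11 m12 m13 m21 m22 m23 m31 m32 m33 g1 g2 g3 : K)

section t111
variable {K : Type} [Field K]
def fl (c : FC K) (v w : K × K × K × K) : K × K × K × K :=
  (c.z01 * (v.1 * w.2.1 - v.2.1 * w.1) + c.z02 * (v.1 * w.2.2.1 - v.2.2.1 * w.1) + c.z03 * (v.1 * w.2.2.2 - v.2.2.2 * w.1)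
    + c.z12 * (v.2.1 * w.2.2.1 - v.2.2.1 * w.2.1) + c.z13 * (v.2.1 * w.2.2.2 - v.2.2.2 * w.2.1)
    + c.z23 * (v.2.2.1 * w.2.2.2 - v.2.2.2 * w.2.2.1), 0, c.a01 * (v.1 * w.2.1 - v.2.1 * w.1),
   c.b01 * (v.1 * w.2.1 - v.2.1 * w.1) + c.b02 * (v.1 * w.2.2.1 - v.2.2.1 * w.1) + c.b12 * (v.2.1 * w.2.2.1 - v.2.2.1 * w.2.1))
def PM.N (P : PM K) (v : K × K × K × K) : K × K × K × K :=
  (P.u * v.1, P.k1 * v.1 + P.m11 * v.2.1 + P.m21 * v.2.2.1 + P.m31 * v.2.2.2,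
    P.k2 * v.1 + P.m12 * v.2.1 + P.m22 * v.2.2.1 + P.m32 * v.2.2.2, P.k3 * v.1 + P.m13 * v.2.1 + P.m23 * v.2.2.1 + P.m33 * v.2.2.2)
def PM.W (P : PM K) (v : K × K × K × K) : K × K × K × K :=
  (P.u * v.1 + P.g1 * v.2.1 + P.g2 * v.2.2.1 + P.g3 * v.2.2.2, P.m11 * v.2.1 + P.m21 * v.2.2.1 + P.m31 * v.2.2.2,
    P.m12 * v.2.1 + P.m22 * v.2.2.1 + P.m32 * v.2.2.2, P.m13 * v.2.1 + P.m23 * v.2.2.1 + P.m33 * v.2.2.2)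
def PM.det (P : PM K) : K := P.m11 * (P.m22 * P.m33 - P.m23 * P.m32) - P.m12 * (P.m21 * P.m33 - P.m23 * P.m31)
  + P.m13 * (P.m21 * P.m32 - P.m22 * P.m31)
def R111 (c c' : FC K) : Prop := ∃ P : PM K, P.u ≠ 0 ∧ P.det ≠ 0 ∧ ∀ v w, fl c (P.N v) (P.N w) = P.W (fl c' v w)
def J111 (c : FC K) : Prop := c.b12 * c.z03 = - c.b01 * c.z23 + c.b02 * c.z13 ∧ c.a01 * c.z23 = 0
end t111

section p111
variable {p : ℕ} [Fact p.Prime] {e : ℕ}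

def cK (p : ℕ) (v : ℤ × ℤ × ℤ × ℤ) : ZMod p × ZMod p × ZMod p × ZMod p := (v.1, v.2.1, v.2.2.1, v.2.2.2)
def JK (p e : ℕ) (w : ZMod p × ZMod p × ZMod p × ZMod p) : ℤ × ℤ × ℤ × ℤ :=
  ((p:ℤ) ^ (e - 1) * (w.1.val : ℤ), (w.2.1.val : ℤ), (w.2.2.1.val : ℤ), (w.2.2.2.val : ℤ))
def F111 (e : ℕ) (c : FC (ZMod p)) (v w : ℤ × ℤ × ℤ × ℤ) := JK p e (fl c (cK p v) (cK p w))

lemma zdvd (i : ℤ) : (p:ℤ) ∣ i ↔ (i : ZMod p) = 0 := (ZMod.intCast_zmod_eq_zero_iff_dvd i p).symm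

lemma pe_dvd (he : 1 ≤ e) (i : ℤ) : (p:ℤ) ^ e ∣ (p:ℤ) ^ (e - 1) * i ↔ (p:ℤ) ∣ i := by
  have hp0 : (p:ℤ) ^ (e - 1) ≠ 0 := pow_ne_zero _ (by exact_mod_cast (Fact.out : p.Prime).ne_zero)
  rw [show (p:ℤ) ^ e = p ^ (e - 1) * p by rw [← pow_succ]; congr 1; omega]
  exact mul_dvd_mul_iff_left hp0

lemma lat_iff (he : 1 ≤ e) (v : ℤ × ℤ × ℤ × ℤ) (t : ℤ) (h : v.1 = (p:ℤ) ^ (e - 1) * t) :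
    Lat111 p e v ↔ (t : ZMod p) = 0 ∧ (v.2.1 : ZMod p) = 0 ∧ (v.2.2.1 : ZMod p) = 0 ∧ (v.2.2.2 : ZMod p) = 0 := by
  rw [Lat111, h, pe_dvd he]; simp only [zdvd]

lemma lat_cK (he : 1 ≤ e) {v : ℤ × ℤ × ℤ × ℤ} (h : Lat111 p e v) : cK p v = 0 := by
  obtain ⟨h1, h2, h3, h4⟩ := h
  have := (dvd_pow_self (p:ℤ) (show e ≠ 0 by omega)).trans h1
  rw [zdvd] at *
  simp [cK, *]

lemma cK_add (v w) : cK p (v + w) = cK p v + cK p w := by simp [cK]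
lemma cK_sub (v w) : cK p (v - w) = cK p v - cK p w := by simp [cK]


lemma cK_JK (he : 2 ≤ e) (w) : cK p (JK p e w) = (0, w.2) := by
  simp [cK, JK, show e - 1 ≠ 0 by omega]

lemma lat_J (he : 2 ≤ e) (w) : Lat111 p e (JK p e w) ↔ w = 0 := by
  rw [lat_iff (by omega) _ (w.1.val : ℤ) rfl]
  obtain ⟨a, b, c, d⟩ := w
  simp [JK]

lemma lat111_sub : ∃ Λ : AddSubgroup (ℤ × ℤ × ℤ × ℤ), ∀ v, v ∈ Λ ↔ Lat111 p e v :=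
  ⟨{ carrier := {v | Lat111 p e v}
     add_mem' := fun {a b} ha hb => ⟨dvd_add ha.1 hb.1, dvd_add ha.2.1 hb.2.1, dvd_add ha.2.2.1 hb.2.2.1, dvd_add ha.2.2.2 hb.2.2.2⟩
     zero_mem' := ⟨dvd_zero _, dvd_zero _, dvd_zero _, dvd_zero _⟩
     neg_mem' := fun {a} ha => ⟨(dvd_neg).2 ha.1, (dvd_neg).2 ha.2.1, (dvd_neg).2 ha.2.2.1, (dvd_neg).2 ha.2.2.2⟩ }, fun v => Iff.rfl⟩

lemma lat_lin (he : 2 ≤ e) (a b c w : ZMod p × ZMod p × ZMod p × ZMod p) (h : w = a - (b + c)) :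
    Lat111 p e (JK p e a - (JK p e b + JK p e c)) ↔ w = 0 := by
  rw [lat_iff (by omega) _ ((a.1.val : ℤ) - (b.1.val + c.1.val)) (by simp [JK]; ring), h]
  simp [JK, Prod.ext_iff]

lemma ex111 (he : 2 ≤ e) (c : FC (ZMod p)) (hc : J111 c) : ∃ (Λ : AddSubgroup (ℤ × ℤ × ℤ × ℤ)) (s : LS ((ℤ × ℤ × ℤ × ℤ) ⧸ Λ)),
    (∀ v, v ∈ Λ ↔ Lat111 p e v) ∧ Pres (Lat111 p e) (F111 e c) ⟨_, s⟩ := by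
  have l0 : Lat111 p e 0 := by simp [Lat111]
  obtain ⟨j1, j2⟩ := hc
  refine Pres.ex lat111_sub ?_ ?_ ?_ ?_ ?_ ?_
  · intro a b c' h
    have := lat_cK (by omega) h
    simp only [F111, cK_add, this, add_zero, sub_self]
    exact ⟨l0, l0⟩
  · intro a b c'
    simp only [F111]
    refine (lat_lin he _ _ _ 0 ?_).2 rfl
    simp only [cK_add]
    ext <;> simp [fl] <;> ring
  · intro a b c'
    simp only [F111]
    refine (lat_lin he _ _ _ 0 ?_).2 rfl
    simp only [cK_add]
    ext <;> simp [fl] <;> ring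
  · intro a
    rw [F111, lat_J he]
    ext <;> simp [fl, mul_comm, sub_self]
  · intro a b c'
    simp only [F111, cK_JK he]
    have : ∀ x y z : ℤ × ℤ × ℤ × ℤ, x - (y - z) = x - (y + (-z)) := fun x y z => by abel
    rw [show JK p e (fl c (0, (fl c (cK p a) (cK p b)).2) (cK p c')) - (JK p e (fl c (cK p a) (0, (fl c (cK p b) (cK p c')).2)) -
       JK p e (fl c (cK p b) (0, (fl c (cK p a) (cK p c')).2)))
       = -(JK p e (fl c (cK p a) (0, (fl c (cK p b) (cK p c')).2)) -
       (JK p e (fl c (0, (fl c (cK p a) (cK p b)).2) (cK p c')) +  JK p e (fl c (cK p b) (0, (fl c (cK p a) (cK p c')).2)))) by abel]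
    have key := (lat_lin he (fl c (cK p a) (0, (fl c (cK p b) (cK p c')).2)) (fl c (0, (fl c (cK p a) (cK p b)).2) (cK p c'))
       (fl c (cK p b) (0, (fl c (cK p a) (cK p c')).2)) 0 ?_).2 rfl
    · obtain ⟨Λ, hΛ⟩ := lat111_sub (p := p) (e := e)
      rw [← hΛ] at key ⊢; exact Λ.neg_mem key
    obtain ⟨a0, a1, a2, a3⟩ := cK p a
    obtain ⟨b0, b1, b2, b3⟩ := cK p b
    obtain ⟨c0, c1, c2, c3⟩ := cK p c'
    ext
    · simp [fl]
      linear_combination (-(a0*(b1*c2-b2*c1)-a1*(b0*c2-b2*c0)+a2*(b0*c1-b1*c0))) * j1 +((a0*(b1*c3-b3*c1)-a1*(b0*c3-b3*c0)+a3*(b0*c1-b1*c0)))* j2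
    · simp [fl]
    · simp [fl]
    · simp [fl]; ring
  · intro a b c' d e'
    simp only [F111, cK_JK he]
    rw [lat_J he]
    ext <;> simp [fl]
    
lemma lin4v (a b c d v : ℤ × ℤ × ℤ × ℤ) : lin4 a b c d v = v.1 • a + (v.2.1 • b + (v.2.2.1 • c + v.2.2.2 • d)) := lin4_apply _ _ _ _ _

lemma T_lin (T : (ℤ × ℤ × ℤ × ℤ) →+ (ℤ × ℤ × ℤ × ℤ)) (v) :
    T v = v.1 • T (1,0,0,0) + (v.2.1 • T (0,1,0,0) + (v.2.2.1 • T (0,0,1,0) + v.2.2.2 • T (0,0,0,1))) := by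
  rw [← map_zsmul, ← map_zsmul, ← map_zsmul, ← map_zsmul, ← map_add, ← map_add, ← map_add]
  congr 1
  ext <;> simp

lemma R1_111 (he : 2 ≤ e) {c c' : FC (ZMod p)} {L : LR} (h : Pres (Lat111 p e) (F111 e c) L)
    (h' : Pres (Lat111 p e) (F111 e c') L) : R111 c c' := by
  obtain ⟨T, T', h1, h2, h3⟩ := h.two h'
  have hp0 : (p:ℤ) ≠ 0 := by exact_mod_cast (Fact.out : p.Prime).ne_zero
  have hg : ∀ v : ℤ × ℤ × ℤ × ℤ, Lat111 p e ((p:ℤ) • v) → ∃ g, (T v).1 = (p:ℤ) ^ (e - 1) * g := fun v hv => by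
    have := ((h1 _).2 hv).1
    rw [map_zsmul] at this
    change _ ∣ (p:ℤ) * (T v).1 at this
    rw [show (p:ℤ) ^ e = p * p ^ (e - 1) by rw [← pow_succ']; congr 1; omega] at this
    exact (mul_dvd_mul_iff_left hp0).1 this
  obtain ⟨g1, hg1⟩ := hg (0,1,0,0) (by simp [Lat111])
  obtain ⟨g2, hg2⟩ := hg (0,0,1,0) (by simp [Lat111])
  obtain ⟨g3, hg3⟩ := hg (0,0,0,1) (by simp [Lat111])
  let P : PM (ZMod p) := ⟨(T (1,0,0,0)).1, (T (1,0,0,0)).2.1, (T (1,0,0,0)).2.2.1, (T (1,0,0,0)).2.2.2,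
    (T (0,1,0,0)).2.1, (T (0,1,0,0)).2.2.1, (T (0,1,0,0)).2.2.2, (T (0,0,1,0)).2.1, (T (0,0,1,0)).2.2.1, (T (0,0,1,0)).2.2.2,
    (T (0,0,0,1)).2.1, (T (0,0,0,1)).2.2.1, (T (0,0,0,1)).2.2.2, g1, g2, g3⟩
  have hN : ∀ v, cK p (T v) = P.N (cK p v) := fun v => by
    rw [T_lin T v]
    ext <;> simp [cK, PM.N, P, hg1, hg2, hg3, show e - 1 ≠ 0 by omega] <;> ring
  have hNN : ∀ v, P.N (cK p (T' v)) = cK p v := fun v => by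
    rw [← hN, ← sub_eq_zero, ← cK_sub, lat_cK (by omega) (h2 v)]
  have hu : P.u ≠ 0 := fun h => by
    have := congrArg Prod.fst (hNN (1,0,0,0))
    simp [PM.N, h, cK] at this
  refine ⟨P, hu, ?_, fun v w => ?_⟩
  · have hz : ∀ v : ℤ × ℤ × ℤ × ℤ, v.1 = 0 → (cK p (T' v)).1 = 0 := fun v hv => by
      have := congrArg Prod.fst (hNN v)
      simpa [PM.N, cK, hv, hu] using this
    have a1 := hNN (0,1,0,0)
    have a2 := hNN (0,0,1,0)
    have a3 := hNN (0,0,0,1)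
    have z1 := hz (0,1,0,0) rfl
    have z2 := hz (0,0,1,0) rfl
    have z3 := hz (0,0,0,1) rfl
    simp only [PM.N, z1, z2, z3] at a1 a2 a3
    generalize (cK p (T' (0,1,0,0))).2 = w1 at *
    generalize (cK p (T' (0,0,1,0))).2 = w2 at *
    generalize (cK p (T' (0,0,0,1))).2 = w3 at *
    simp [cK] at a1 a2 a3
    have := Matrix.det_ne_zero_of_right_inverse (A := !![P.m11, P.m21, P.m31; P.m12, P.m22, P.m32; P.m13, P.m23, P.m33])
      (B := !![w1.1, w2.1, w3.1; w1.2.1, w2.2.1, w3.2.1; w1.2.2, w2.2.2, w3.2.2]) (by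
        ext i j; fin_cases i <;> fin_cases j <;> simp [Matrix.mul_apply, Fin.sum_univ_three, a1, a2, a3])
    rw [Matrix.det_fin_three] at this
    simp at this
    intro hd
    apply this
    rw [← hd, PM.det]; ring
  · have hs : ∀ v, ∃ v', cK p v' = v := fun v => ⟨(v.1.val, v.2.1.val, v.2.2.1.val, v.2.2.2.val), by simp [cK]⟩
    obtain ⟨v, rfl⟩ := hs v
    obtain ⟨w, rfl⟩ := hs w
    have := h3 v w
    rw [F111, F111, hN, hN] at this
    generalize fl c' (cK p v) (cK p w) = x at *
    generalize fl c (P.N (cK p v)) (P.N (cK p w)) = y at *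
    rw [T_lin] at this
    rw [lat_iff (by omega) _ ((x.1.val:ℤ) * (T (1,0,0,0)).1 + x.2.1.val * g1 + x.2.2.1.val * g2 + x.2.2.2.val * g3 - y.1.val)
      (by simp [JK, hg1, hg2, hg3]; ring)] at this
    simp [JK, show e - 1 ≠ 0 by omega] at this
    obtain ⟨b1, b2, b3, b4⟩ := this
    ext
    · simp [PM.W, P]; linear_combination -(1:ZMod p)*b1
    · simp [PM.W, P]; linear_combination -(1:ZMod p)*b2
    · simp [PM.W, P]; linear_combination -(1:ZMod p)*b3
    · simp [PM.W, P]; linear_combination -(1:ZMod p)*b4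

lemma R2_111 (he : 2 ≤ e) {c c' : FC (ZMod p)} {L : LR} [Finite L.A] (hL : ∀ a : L.A, (p ^ e : ℕ) • a = 0)
    (h : Pres (Lat111 p e) (F111 e c) L) (hR : R111 c c') : Pres (Lat111 p e) (F111 e c') L := by
  obtain ⟨P, hu, hd, hP⟩ := hR
  let T : (ℤ × ℤ × ℤ × ℤ) →+ (ℤ × ℤ × ℤ × ℤ) := lin4 (P.u.val, P.k1.val, P.k2.val, P.k3.val)
    ((p:ℤ) ^ (e - 1) * P.g1.val, P.m11.val, P.m12.val, P.m13.val) ((p:ℤ) ^ (e - 1) * P.g2.val, P.m21.val, P.m22.val, P.m23.val)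
    ((p:ℤ) ^ (e - 1) * P.g3.val, P.m31.val, P.m32.val, P.m33.val)
  have hN : ∀ v, cK p (T v) = P.N (cK p v) := fun v => by
    simp only [T, lin4v]
    ext <;> simp [cK, PM.N, show e - 1 ≠ 0 by omega] <;> ring
  have hp0 : (p:ℤ) ^ (e - 1) ≠ 0 := pow_ne_zero _ (by exact_mod_cast (Fact.out : p.Prime).ne_zero)
  have hs : ∀ v, ∃ v', cK p v' = v := fun v => ⟨(v.1.val, v.2.1.val, v.2.2.1.val, v.2.2.2.val), by simp [cK]⟩
  refine h.chg (p := p) (e := e) hL T (fun v hv => ?_) (fun v => ?_) (fun a b => ?_)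
  · have h0 := lat_cK (by omega) hv
    obtain ⟨t, ht⟩ := hv.1
    rw [show (p:ℤ) ^ e = p ^ (e - 1) * p by rw [← pow_succ]; congr 1; omega] at ht
    rw [lat_iff (by omega) _ (p * t * P.u.val + v.2.1 * P.g1.val + v.2.2.1 * P.g2.val + v.2.2.2 * P.g3.val)
      (by simp only [T, lin4v]; simp [ht]; ring)]
    have h4 := hN v
    simp only [cK, Prod.mk_eq_zero] at h0
    obtain ⟨z0, z1, z2, z3⟩ := h0
    simp only [PM.N, cK, z0, z1, z2, z3] at h4
    simp at h4
    refine ⟨by simp [z1, z2, z3], h4.2.1, h4.2.2.1, h4.2.2.2⟩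
  · obtain ⟨x0, x1, x2, x3, hx⟩ : ∃ x0 x1 x2 x3, cK p v = (x0, x1, x2, x3) := ⟨_, _, _, _, rfl⟩
    obtain ⟨v', hv'⟩ := hs (x0 / P.u,
      ((x1 - P.k1 * (x0 / P.u)) * (P.m22 * P.m33 - P.m32 * P.m23) - (x2 - P.k2 * (x0 / P.u)) * (P.m21 * P.m33 - P.m31 * P.m23)
        + (x3 - P.k3 * (x0 / P.u)) * (P.m21 * P.m32 - P.m31 * P.m22)) / P.det,
      (-(x1 - P.k1 * (x0 / P.u)) * (P.m12 * P.m33 - P.m32 * P.m13) + (x2 - P.k2 * (x0 / P.u)) * (P.m11 * P.m33 - P.m31 * P.m13)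
        - (x3 - P.k3 * (x0 / P.u)) * (P.m11 * P.m32 - P.m31 * P.m12)) / P.det,
      ((x1 - P.k1 * (x0 / P.u)) * (P.m12 * P.m23 - P.m22 * P.m13) - (x2 - P.k2 * (x0 / P.u)) * (P.m11 * P.m23 - P.m21 * P.m13)
        + (x3 - P.k3 * (x0 / P.u)) * (P.m11 * P.m22 - P.m21 * P.m12)) / P.det)
    have h4 : cK p (T v' - v) = 0 := by
      rw [cK_sub, hN, hv', hx]
      obtain ⟨d, hd'⟩ : ∃ d, P.det = d := ⟨_, rfl⟩
      rw [hd'] at hd ⊢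
      rw [PM.det] at hd'
      ext <;> simp only [PM.N, Prod.fst_sub, Prod.snd_sub, Prod.fst_zero, Prod.snd_zero]
      · field_simp; ring
      all_goals
        generalize x0 / P.u = y
        field_simp
        rw [← hd']
        ring
    simp only [cK, Prod.mk_eq_zero, ← zdvd] at h4
    obtain ⟨⟨w0, q0⟩, ⟨w1, q1⟩, ⟨w2, q2⟩, ⟨w3, q3⟩⟩ := h4
    refine ⟨v', (w0, w1, w2, w3), ?_⟩
    rw [← sub_eq_iff_eq_add']
    ext
    · simpa using q0
    · simpa using q1
    · simpa using q2
    · simpa using q3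
  · rw [F111, F111, hN, hN, hP]
    generalize fl c' (cK p a) (cK p b) = x
    simp only [T, lin4v]
    rw [lat_iff (by omega) _ ((x.1.val:ℤ) * P.u.val + x.2.1.val * P.g1.val + x.2.2.1.val * P.g2.val + x.2.2.2.val * P.g3.val - (P.W x).1.val)
      (by simp [JK]; ring)]
    simp [JK, show e - 1 ≠ 0 by omega, PM.W]
    refine ⟨by ring, by ring, by ring, by ring⟩
end p111

section cov
variable {p e : ℕ}

def cyc (p k : ℕ) (L : LR) : Prop := ∃ x : L.A, ∀ a, ∃ i : ℤ, (p ^ k : ℕ) • (a - i • x) = 0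

lemma cyc.iso {k : ℕ} {L M : LR} (h : LIso L M) (hc : cyc p k L) : cyc p k M := by
  obtain ⟨f, -⟩ := h
  obtain ⟨x, hx⟩ := hc
  refine ⟨f x, fun a => ?_⟩
  obtain ⟨i, hi⟩ := hx (f.symm a)
  refine ⟨i, ?_⟩
  have := congrArg f hi
  rw [map_nsmul, map_sub, map_zsmul] at this
  simpa using this

lemma TT.iso {L M : LR} (h : LIso L M) (hc : TT p e L) : TT p e M := by
  obtain ⟨f, -⟩ := h
  obtain ⟨h1, h2, x, hx⟩ := hc
  refine ⟨by rw [← h1]; exact Nat.card_congr f.symm.toEquiv, fun a => ?_, f x, fun h => hx ?_⟩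
  · have := congrArg f (h2 (f.symm a)); rw [map_nsmul] at this; simpa using this
  · rw [← map_nsmul] at h; exact f.map_eq_zero_iff.1 h

lemma TT.fin {L : LR} (hp : p.Prime) (h : TT p e L) : Finite L.A :=
  Nat.finite_of_card_ne_zero (by rw [h.1]; exact pow_ne_zero _ hp.ne_zero)

lemma sup_card {A : Type} [AddCommGroup A] [Finite A] (hp : p.Prime) (H : AddSubgroup A) (u : A) (hu : p • u = 0) :
    Nat.card (H ⊔ AddSubgroup.zmultiples u : AddSubgroup A) ≤ Nat.card H * p := by
  let f : H × AddSubgroup.zmultiples u → (H ⊔ AddSubgroup.zmultiples u : AddSubgroup A) := fun v =>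
    ⟨v.1 + v.2, AddSubgroup.add_mem_sup v.1.2 v.2.2⟩
  have hf : Function.Surjective f := by
    rintro ⟨a, ha⟩
    obtain ⟨y, hy, z, hz, rfl⟩ := AddSubgroup.mem_sup.1 ha
    exact ⟨(⟨y, hy⟩, ⟨z, hz⟩), rfl⟩
  refine (Nat.card_le_card_of_surjective f hf).trans ?_
  rw [Nat.card_prod, Nat.card_zmultiples]
  exact Nat.mul_le_mul_left _ (Nat.le_of_dvd hp.pos (addOrderOf_dvd_of_nsmul_eq_zero hu))

lemma mem_bez {A : Type} [AddCommGroup A] (hp : p.Prime) (H : AddSubgroup A) {u : A} (hu : p • u = 0) {i : ℤ}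
    (h : i • u ∈ H) (hn : u ∉ H) : (p:ℤ) ∣ i := by
  by_contra hd
  have hc : IsCoprime (p:ℤ) i := (Int.prime_iff_natAbs_prime.2 (by simpa using hp)).coprime_iff_not_dvd.2 hd
  obtain ⟨a, b, hab⟩ := hc
  apply hn
  have : u = b • i • u := by
    rw [← mul_smul, show b * i = 1 - a * p by linarith, sub_smul, one_smul, mul_smul, natCast_zsmul, hu, smul_zero, sub_zero]
  rw [this]; exact H.zsmul_mem h b

lemma mem_sz {A : Type} [AddCommGroup A] {H : AddSubgroup A} {u a : A} (h : a ∈ H ⊔ AddSubgroup.zmultiples u) :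
    ∃ (i : ℤ) (y : A), y ∈ H ∧ a = i • u + y := by
  obtain ⟨y, hy, z, hz, rfl⟩ := AddSubgroup.mem_sup.1 h
  obtain ⟨i, rfl⟩ := AddSubgroup.mem_zmultiples_iff.1 hz
  exact ⟨i, y, hy, add_comm _ _⟩

lemma vsm {A : Type} [AddCommGroup A] [NeZero p] {u : A} (hu : p • u = 0) {w : ZMod p} (i : ℤ) (h : w = i) :
    (w.val : ℤ) • u = i • u := by
  rw [← sub_eq_zero, ← sub_smul]
  refine zn hu ?_
  rw [← ZMod.intCast_zmod_eq_zero_iff_dvd]; simp [h]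

lemma flag [Fact p.Prime] (he : 2 ≤ e) {L : LR} (hT : TT p e L) (hc : cyc p 1 L) :
    ∃ c : FC (ZMod p), J111 c ∧ Pres (Lat111 p e) (F111 e c) L := by
  have hp : p.Prime := Fact.out
  have := hT.fin hp
  obtain ⟨A, s⟩ := L
  obtain ⟨hcard, hexp, x0, hx0⟩ := hT
  obtain ⟨x, hx⟩ := hc
  simp only [pow_one] at hx hcard hexp x0 hx0 x
  have hxp : (p ^ (e - 1) : ℕ) • x ≠ 0 := by
    intro h
    obtain ⟨i, hi⟩ := hx x0
    apply hx0
    have : (p ^ (e - 1) : ℕ) • (x0 - i • x) = 0 := by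
      rw [show p ^ (e - 1) = p ^ (e - 2) * p by rw [← pow_succ]; congr 1; omega, mul_smul, hi, smul_zero]
    rw [smul_sub, smul_comm, h, smul_zero, sub_zero] at this
    exact this
  set z := (p ^ (e - 1) : ℕ) • x with hz
  have pz : p • z = 0 := by
    rw [hz, ← mul_smul, ← pow_succ', show e - 1 + 1 = e by omega]; exact hexp x
  have brp : ∀ a b, p • s.br a b = 0 := by
    intro a b
    obtain ⟨i, hi⟩ := hx a
    obtain ⟨j, hj⟩ := hx b
    have h1 : s.br a b = s.br (a - i • x) b + i • (s.br x (b - j • x)) := by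
      rw [s.sub_l, s.sub_r, s.zsmul_l, s.zsmul_r, s.self]; simp
    rw [h1, smul_add, ← s.nsmul_l, hi, s.zero_l, smul_comm, ← s.nsmul_r, hj, s.zero_r]; simp
  have bz : ∀ a, s.br a z = 0 := fun a => by
    rw [hz, s.nsmul_r, show p ^ (e - 1) = p ^ (e - 2) * p by rw [← pow_succ]; congr 1; omega, mul_smul, brp, smul_zero]
  let μ : A →+ A := AddMonoidHom.mk' (fun a => p • a) (fun a b => smul_add p a b)
  have hΩm : ∀ a, a ∈ μ.ker ↔ p • a = 0 := fun a => AddMonoidHom.mem_ker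
  have hΩ : Nat.card μ.ker = p ^ 4 := by
    have h1 := μ.ker.card_mul_index
    rw [AddSubgroup.index_ker] at h1
    have h2 : μ.range = AddSubgroup.zmultiples (p • x) := by
      ext a
      rw [AddMonoidHom.mem_range, AddSubgroup.mem_zmultiples_iff]
      constructor
      · rintro ⟨b, rfl⟩
        obtain ⟨i, hi⟩ := hx b
        refine ⟨i, ?_⟩
        rw [smul_sub, sub_eq_zero] at hi
        change _ = p • b
        rw [hi, smul_comm]
      · rintro ⟨i, rfl⟩
        exact ⟨i • x, smul_comm _ _ _⟩
    have h3 : addOrderOf (p • x) = p ^ (e - 2 + 1) := by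
      refine addOrderOf_eq_prime_pow ?_ ?_
      · rw [← mul_smul, ← pow_succ, show e - 2 + 1 = e - 1 by omega]; exact hxp
      · rw [← mul_smul, ← pow_succ, show e - 2 + 1 + 1 = e by omega]; exact hexp x
    rw [h2, Nat.card_zmultiples, h3, hcard, show e + 3 = 4 + (e - 2 + 1) by omega, pow_add p 4] at h1
    exact Nat.eq_of_mul_eq_mul_right (pow_pos hp.pos _) h1
  have fe := FE_tht s (AddMonoidHom.id A) (fun _ _ => rfl) (fun a => ⟨a, rfl⟩) 0 (fun a => by simp) ⟨1, fun a => rfl⟩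
  have hst : ∀ (U : AddSubgroup A), (∀ a, ∀ u ∈ U, s.br a u ∈ U) → ∀ θ ∈ Tht s 0, ∀ u ∈ U, θ u ∈ U := by
    rintro U hU θ (rfl | ⟨a, rfl⟩) u hu
    · exact U.zero_mem
    · exact hU a u hu
  have step : ∀ V : AddSubgroup A, V ≤ μ.ker → Nat.card V ≤ p ^ 3 → (∀ a, ∀ u ∈ V, s.br a u ∈ V) →
      ∃ u, p • u = 0 ∧ u ∉ V ∧ ∀ a, s.br a u ∈ V := by
    intro V hV hVc hs
    have hlt : V < μ.ker := lt_of_le_of_ne hV (by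
      rintro rfl; rw [hΩ] at hVc
      exact absurd hVc (not_le.2 (pow_lt_pow_right₀ hp.one_lt (by norm_num))))
    obtain ⟨u, h1, h2, h3⟩ := fe μ.ker V hlt (hst _ (fun a u _ => (hΩm _).2 (brp a u))) (hst _ hs)
    exact ⟨u, (hΩm u).1 h1, h2, fun a => h3 _ (Set.mem_insert_of_mem _ ⟨a, rfl⟩)⟩
  have stab : ∀ (V : AddSubgroup A) (u : A), (∀ a, ∀ v ∈ V, s.br a v ∈ V) → (∀ a, s.br a u ∈ V) →
      ∀ a, ∀ v ∈ V ⊔ AddSubgroup.zmultiples u, s.br a v ∈ V ⊔ AddSubgroup.zmultiples u := by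
    intro V u h1 h2 a v hv
    obtain ⟨i, y, hy, rfl⟩ := mem_sz hv
    rw [s.add_r, s.zsmul_r]
    exact le_sup_left (a := V) (V.add_mem (V.zsmul_mem (h2 a) i) (h1 a y hy))
  set V0 := AddSubgroup.zmultiples z with hV0
  have le0 : V0 ≤ μ.ker := by rw [hV0, AddSubgroup.zmultiples_le]; exact (hΩm z).2 pz
  have st0 : ∀ a, ∀ v ∈ V0, s.br a v ∈ V0 := by
    intro a v hv
    obtain ⟨i, rfl⟩ := AddSubgroup.mem_zmultiples_iff.1 hv
    rw [s.zsmul_r, bz, smul_zero]; exact V0.zero_mem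
  have cd0 : Nat.card V0 ≤ p := by
    rw [hV0, Nat.card_zmultiples]; exact Nat.le_of_dvd hp.pos (addOrderOf_dvd_of_nsmul_eq_zero pz)
  obtain ⟨u3, p3, n3, b3⟩ := step V0 le0 (cd0.trans (Nat.le_self_pow (by norm_num) p)) st0
  set V1 := V0 ⊔ AddSubgroup.zmultiples u3 with hV1
  have st1 := stab V0 u3 st0 b3
  have le1 : V1 ≤ μ.ker := sup_le le0 (by rw [AddSubgroup.zmultiples_le]; exact (hΩm _).2 p3)
  have cd1 : Nat.card V1 ≤ p * p := (sup_card hp V0 u3 p3).trans (Nat.mul_le_mul_right _ cd0)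
  obtain ⟨u2, p2, n2, b2⟩ := step V1 le1 (cd1.trans (by rw [← pow_two]; exact Nat.pow_le_pow_right hp.pos (by norm_num))) st1
  set V2 := V1 ⊔ AddSubgroup.zmultiples u2 with hV2
  have st2 := stab V1 u2 st1 b2
  have le2 : V2 ≤ μ.ker := sup_le le1 (by rw [AddSubgroup.zmultiples_le]; exact (hΩm _).2 p2)
  have cd2 : Nat.card V2 ≤ p * p * p := (sup_card hp V1 u2 p2).trans (Nat.mul_le_mul_right _ cd1)
  obtain ⟨u1, p1, n1, b1⟩ := step V2 le2 (cd2.trans (by rw [← pow_three']) ) st2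
  have ze : ∀ i : ℤ, i • x = 0 ↔ (p:ℤ) ^ e ∣ i := by
    intro i
    have : addOrderOf x = p ^ e := by
      have := addOrderOf_eq_prime_pow (p := p) (n := e - 1) (x := x) hxp (by rw [show e - 1 + 1 = e by omega]; exact hexp x)
      rwa [show e - 1 + 1 = e by omega] at this
    rw [← addOrderOf_dvd_iff_zsmul_eq_zero, this]; push_cast; rfl
  have g01 : V0 ≤ V1 := le_sup_left
  have g12 : V1 ≤ V2 := le_sup_left
  have m3 : u3 ∈ V1 := le_sup_right (a := V0) (AddSubgroup.mem_zmultiples u3)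
  have m2 : u2 ∈ V2 := le_sup_right (a := V1) (AddSubgroup.mem_zmultiples u2)
  have ker : ∀ v, lin4 x u1 u2 u3 v = 0 ↔ Lat111 p e v := by
    intro v
    rw [lin4_apply]
    constructor
    · intro h
      have hh := congrArg (fun t => p • t) h
      simp only [smul_add, smul_zero, smul_comm p, p1, p2, p3, add_zero] at hh
      rw [← natCast_zsmul, ← mul_smul, ze] at hh
      obtain ⟨t, ht⟩ : (p:ℤ) ^ (e - 1) ∣ v.1 := by
        rw [show (p:ℤ) ^ e = p ^ (e - 1) * p by rw [← pow_succ]; congr 1; omega] at hh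
        exact (mul_dvd_mul_iff_right (by exact_mod_cast hp.ne_zero)).1 hh
      have hvx : v.1 • x = t • z := by
        rw [ht, hz, ← natCast_zsmul, ← mul_smul]; push_cast; rw [mul_comm]
      have hx0 : v.1 • x ∈ V0 := by rw [hvx]; exact V0.zsmul_mem (AddSubgroup.mem_zmultiples z) t
      have d1 : (p:ℤ) ∣ v.2.1 := mem_bez hp V2 p1 (by
        rw [show v.2.1 • u1 = -(v.1 • x + (v.2.2.1 • u2 + v.2.2.2 • u3)) by
          rw [eq_neg_iff_add_eq_zero, ← h]; abel]
        exact V2.neg_mem (V2.add_mem (g12 (g01 hx0)) (V2.add_mem (V2.zsmul_mem m2 _) (g12 (V1.zsmul_mem m3 _))))) n1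
      rw [zn p1 d1, zero_add] at h
      have d2 : (p:ℤ) ∣ v.2.2.1 := mem_bez hp V1 p2 (by
        rw [show v.2.2.1 • u2 = -(v.1 • x + v.2.2.2 • u3) by
          rw [eq_neg_iff_add_eq_zero, ← h]; abel]
        exact V1.neg_mem (V1.add_mem (g01 hx0) (V1.zsmul_mem m3 _))) n2
      rw [zn p2 d2, zero_add] at h
      have d3 : (p:ℤ) ∣ v.2.2.2 := mem_bez hp V0 p3 (by
        rw [show v.2.2.2 • u3 = -(v.1 • x) by
          rw [eq_neg_iff_add_eq_zero, ← h]; abel]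
        exact V0.neg_mem hx0) n3
      rw [zn p3 d3, add_zero, ze] at h
      exact ⟨h, d1, d2, d3⟩
    · rintro ⟨h, d1, d2, d3⟩
      rw [(ze _).2 h, zn p1 d1, zn p2 d2, zn p3 d3]; simp
  have e0 : ∀ a ∈ V0, ∃ i : ℤ, a = i • z := fun a ha => by
    obtain ⟨i, rfl⟩ := AddSubgroup.mem_zmultiples_iff.1 ha; exact ⟨i, rfl⟩
  have e1 : ∀ a ∈ V1, ∃ i j : ℤ, a = i • u3 + j • z := fun a ha => by
    obtain ⟨i, y, hy, rfl⟩ := mem_sz ha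
    obtain ⟨j, rfl⟩ := e0 y hy; exact ⟨i, j, rfl⟩
  have e2 : ∀ a ∈ V2, ∃ i j k : ℤ, a = i • u2 + (j • u3 + k • z) := fun a ha => by
    obtain ⟨i, y, hy, rfl⟩ := mem_sz ha
    obtain ⟨j, k, rfl⟩ := e1 y hy; exact ⟨i, j, k, rfl⟩
  obtain ⟨z03, h03⟩ := e0 _ (b3 x)
  obtain ⟨z13, h13⟩ := e0 _ (b3 u1)
  obtain ⟨z23, h23⟩ := e0 _ (b3 u2)
  obtain ⟨b02, z02, h02⟩ := e1 _ (b2 x)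
  obtain ⟨b12, z12, h12⟩ := e1 _ (b2 u1)
  obtain ⟨a01, b01, z01, h01⟩ := e2 _ (b1 x)
  have sk := s.skew
  have zz : ∀ i : ℤ, i • z = 0 → (i : ZMod p) = 0 := by
    intro i hi
    rw [← zdvd]
    by_contra hd
    have := mem_bez hp ⊥ pz (i := i) (by rw [hi]; exact (⊥ : AddSubgroup A).zero_mem) (by
      rw [AddSubgroup.mem_bot]; exact hxp)
    exact hd this
  have bz' : ∀ a, s.br z a = 0 := fun a => by rw [sk, bz, neg_zero]
  refine ⟨⟨a01, b01, z01, b02, z02, z03, b12, z12, z13, z23⟩, ⟨?_, ?_⟩, lin4 x u1 u2 u3, ?_, ker, fun v w => ?_⟩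
  · have := s.jac x u1 u2
    rw [h01, h12, h02] at this
    simp only [s.add_l, s.add_r, s.zsmul_l, s.zsmul_r, bz, bz', s.self, h03, h13, sk u3 u2, h23] at this
    have := zz (b12 * z03 - (- b01 * z23 + b02 * z13)) (by
      rw [← sub_eq_zero] at this
      rw [← neg_eq_zero, ← this]; module)
    push_cast at this
    simp only
    linear_combination this
  · have := s.jac x u1 u3
    rw [h01, h13, h03] at this
    simp only [s.add_l, s.add_r, s.zsmul_l, s.zsmul_r, bz, bz', s.self, h23] at this
    have := zz (a01 * z23) (by
      rw [← sub_eq_zero] at this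
      rw [← this]; module)
    push_cast at this
    exact this
  · exact ker_surj (by rw [card111 _ ker]; exact hcard.symm)
  · have hxx : ∀ t : ℤ, ((p:ℤ) ^ (e - 1) * t) • x = t • z := fun t => by
      rw [hz, ← natCast_zsmul, ← mul_smul]; push_cast; rw [mul_comm]
    obtain ⟨v0, v1, v2, v3⟩ := v
    obtain ⟨w0, w1, w2, w3⟩ := w
    simp only [F111, lin4_apply, JK, hxx]
    simp only [fl, cK]
    rw [vsm pz (z01 * (v0 * w1 - v1 * w0) + z02 * (v0 * w2 - v2 * w0) + z03 * (v0 * w3 - v3 * w0)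
      + z12 * (v1 * w2 - v2 * w1) + z13 * (v1 * w3 - v3 * w1)
      + z23 * (v2 * w3 - v3 * w2)) (by push_cast; ring),
      vsm p1 0 (by simp), vsm p2 (a01 * (v0 * w1 - v1 * w0)) (by push_cast; ring),
      vsm p3 (b01 * (v0 * w1 - v1 * w0) + b02 * (v0 * w2 - v2 * w0) + b12 * (v1 * w2 - v2 * w1)) (by push_cast; ring)]
    simp only [s.add_l, s.add_r, s.zsmul_l, s.zsmul_r, s.self, sk u1 x, sk u2 x, sk u3 x, sk u2 u1, sk u3 u1, sk u3 u2,
      h01, h02, h03, h12, h13, h23]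
    module

lemma pres_TT111 [Fact p.Prime] (he : 2 ≤ e) {L : LR} {F} (h : Pres (Lat111 p e) F L) : TT p e L ∧ cyc p 1 L := by
  have hp : p.Prime := Fact.out
  obtain ⟨q, q1, q2, -⟩ := h
  refine ⟨⟨?_, fun a => ?_, q (1,0,0,0), ?_⟩, q (1,0,0,0), fun a => ?_⟩
  · rw [← card111 q q2, AddMonoidHom.range_eq_top.2 q1, AddSubgroup.card_top]
  · obtain ⟨v, rfl⟩ := q1 a
    rw [← map_nsmul, q2]
    have h1 : ∀ t : ℤ, (p:ℤ) ∣ p ^ e * t := fun t => (dvd_pow_self (p:ℤ) (by omega)).mul_right t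
    simp [Lat111, h1]
  · rw [← map_nsmul, Ne, q2]
    simp only [Lat111]
    intro h
    have := h.1
    simp at this
    have h2 := Int.le_of_dvd (by have := hp.pos; positivity) this
    have h3 : p ^ (e-1) < p ^ e := pow_lt_pow_right₀ hp.one_lt (by omega)
    exact absurd h2 (not_le.2 (by exact_mod_cast h3))
  · obtain ⟨v, rfl⟩ := q1 a
    refine ⟨v.1, ?_⟩
    rw [← map_zsmul, ← map_sub, ← map_nsmul, q2]
    simp [Lat111]

lemma R111.rel [Fact p.Prime] {c c' : FC (ZMod p)} (hc : J111 c) : R111 c c' ↔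
    ∃ L, TT p 2 L ∧ Pres (Lat111 p 2) (F111 2 c) L ∧ Pres (Lat111 p 2) (F111 2 c') L := by
  constructor
  · intro h
    obtain ⟨Λ, s, -, hP⟩ := ex111 (e := 2) le_rfl c hc
    have hT := (pres_TT111 le_rfl hP).1
    have := hT.fin Fact.out
    exact ⟨_, hT, hP, R2_111 le_rfl hT.2.1 hP h⟩
  · rintro ⟨L, -, h1, h2⟩
    exact R1_111 le_rfl h1 h2

lemma R111.symm [Fact p.Prime] {c c' : FC (ZMod p)} (hc : J111 c) (h : R111 c c') : R111 c' c := by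
  obtain ⟨L, -, h1, h2⟩ := (R111.rel hc).1 h
  exact R1_111 le_rfl h2 h1

lemma R111.trans [Fact p.Prime] {c c' c'' : FC (ZMod p)} (hc : J111 c) (h : R111 c c') (h' : R111 c' c'') : R111 c c'' := by
  obtain ⟨L, hT, h1, h2⟩ := (R111.rel hc).1 h
  have := hT.fin Fact.out
  exact R1_111 le_rfl h1 (R2_111 le_rfl hT.2.1 h2 h')

lemma cnt111 [Fact p.Prime] (he : 2 ≤ e) {N : ℕ} (h : Cnt (R111 (K := ZMod p)) J111 N) :
    Cnt LIso (fun L => TT p e L ∧ cyc p 1 L) N := by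
  refine h.bridge (fun L c => TT p e L ∧ Pres (Lat111 p e) (F111 e c) L) ?_ ?_ ?_ ?_ ?_ ?_
  · intro c hc
    obtain ⟨Λ, s, -, hP⟩ := ex111 he c hc
    exact ⟨_, pres_TT111 he hP, (pres_TT111 he hP).1, hP⟩
  · rintro L ⟨h1, h2⟩
    obtain ⟨c, hc, hP⟩ := flag he h1 h2
    exact ⟨c, hc, h1, hP⟩
  · exact fun L L' c h h' => h.2.iso h'.2
  · exact fun L L' c h h' => ⟨h'.1.iso h.symm, h'.2.tr h⟩
  · exact fun L c c' h h' => R1_111 he h.2 h'.2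
  · intro L c c' h h'
    have := h.1.fin Fact.out
    exact ⟨h.1, R2_111 he h.1.2.1 h.2 h'⟩
end cov

lemma Cnt.sub {C D : Type*} {R : C → C → Prop} {P : C → Prop} {Rs : D → D → Prop} {Pd : D → Prop} {N : ℕ}
    (h : Cnt Rs Pd N) (t : D → C) (hP : ∀ d, Pd d → P (t d)) (cov : ∀ c, P c → ∃ d, Pd d ∧ R c (t d))
    (tr : ∀ c c' c'', P c → R c c' → R c' c'' → R c c'') (R1 : ∀ d d', R (t d) (t d') → Rs d d')
    (R2 : ∀ d d', Rs d d' → R (t d) (t d')) : Cnt R P N := by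
  obtain ⟨I, _, r, hI, a1, a2, a3⟩ := h
  refine ⟨I, inferInstance, fun i => t (r i), hI, fun i => hP _ (a1 i), fun c hc => ?_, fun i j hij => a3 i j (R1 _ _ hij)⟩
  obtain ⟨d, hd, h1⟩ := cov c hc
  obtain ⟨i, hi⟩ := a2 d hd
  exact ⟨i, tr _ _ _ hc h1 (R2 _ _ hi)⟩

section leaf
variable {C : Type*} {R : C → C → Prop} {P : C → Prop} {p : ℕ} [Fact p.Prime]

lemma Cnt.pw (k : ℕ) (t : ZMod p → C) (h0 : ∀ s, s ≠ 0 → P (t s))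
    (cov : ∀ c, P c → ∃ s, s ≠ 0 ∧ ∀ a, a ≠ 0 → R c (t (a ^ k * s)))
    (inj : ∀ s s', s ≠ 0 → s' ≠ 0 → R (t s) (t s') → ∃ a, a ≠ 0 ∧ s' = a ^ k * s) : Cnt R P (Nat.gcd (p - 1) k) := by
  obtain ⟨I, hI, r, hc, r0, r1, r2⟩ := powreps (p := p) k
  refine ⟨I, hI, fun i => t (r i), hc, fun i => h0 _ (r0 i), fun c h => ?_, fun i j hij => ?_⟩
  · obtain ⟨s, hs, h1⟩ := cov c h
    obtain ⟨i, a, ha, h2⟩ := r1 s hs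
    exact ⟨i, by simp only [h2]; exact h1 a ha⟩
  · obtain ⟨a, ha, h1⟩ := inj _ _ (r0 i) (r0 j) hij
    exact (r2 j i a ha h1).symm

lemma Cnt.sq (h5 : 5 ≤ p) (t : ZMod p → C) (h0 : ∀ s, s ≠ 0 → P (t s))
    (cov : ∀ c, P c → ∃ s, s ≠ 0 ∧ ∀ a, a ≠ 0 → R c (t (a ^ 2 * s)))
    (inj : ∀ s s', s ≠ 0 → s' ≠ 0 → R (t s) (t s') → ∃ a, a ≠ 0 ∧ s' = a ^ 2 * s) : Cnt R P 2 := by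
  have := Cnt.pw 2 t h0 cov inj
  rwa [Nat.gcd_eq_right] at this
  have h2 := (Fact.out : p.Prime).eq_two_or_odd
  omega

lemma Cnt.all (t : ZMod p → C) (h0 : ∀ s, P (t s)) (cov : ∀ c, P c → ∃ s, R c (t s))
    (inj : ∀ s s', R (t s) (t s') → s = s') : Cnt R P p :=
  ⟨ZMod p, inferInstance, t, Nat.card_zmod p, h0, cov, inj⟩

lemma Cnt.nz (t : ZMod p → C) (h0 : ∀ s, s ≠ 0 → P (t s)) (cov : ∀ c, P c → ∃ s, s ≠ 0 ∧ R c (t s))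
    (inj : ∀ s s', s ≠ 0 → s' ≠ 0 → R (t s) (t s') → s = s') : Cnt R P (p - 1) := by
  refine ⟨{s : ZMod p // s ≠ 0}, inferInstance, fun s => t s, ?_, fun s => h0 _ s.2, fun c h => ?_, fun i j hij => ?_⟩
  · rw [← Nat.card_congr unitsEquivNeZero, Nat.card_eq_fintype_card, ZMod.card_units]
  · obtain ⟨s, hs, h1⟩ := cov c h
    exact ⟨⟨s, hs⟩, h1⟩
  · exact Subtype.ext (inj _ _ i.2 j.2 hij)

end leaf

section k111
variable {K : Type} [Field K]

lemma R111_of {c c' : FC K} (P : PM K) (hu : P.u ≠ 0) (hd : P.det ≠ 0)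
    (h01 : fl c (P.N (1,0,0,0)) (P.N (0,1,0,0)) = P.W (fl c' (1,0,0,0) (0,1,0,0)))
    (h02 : fl c (P.N (1,0,0,0)) (P.N (0,0,1,0)) = P.W (fl c' (1,0,0,0) (0,0,1,0)))
    (h03 : fl c (P.N (1,0,0,0)) (P.N (0,0,0,1)) = P.W (fl c' (1,0,0,0) (0,0,0,1)))
    (h12 : fl c (P.N (0,1,0,0)) (P.N (0,0,1,0)) = P.W (fl c' (0,1,0,0) (0,0,1,0)))
    (h13 : fl c (P.N (0,1,0,0)) (P.N (0,0,0,1)) = P.W (fl c' (0,1,0,0) (0,0,0,1)))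
    (h23 : fl c (P.N (0,0,1,0)) (P.N (0,0,0,1)) = P.W (fl c' (0,0,1,0) (0,0,0,1))) : R111 c c' := by
  refine ⟨P, hu, hd, fun v w => ?_⟩
  have ex : ∀ (X Y : (K × K × K × K) → (K × K × K × K) → K × K × K × K), True := fun _ _ => trivial
  have e1 : ∀ v w, fl c (P.N v) (P.N w) = (v.1 * w.2.1 - v.2.1 * w.1) • fl c (P.N (1,0,0,0)) (P.N (0,1,0,0))
    + (v.1 * w.2.2.1 - v.2.2.1 * w.1) • fl c (P.N (1,0,0,0)) (P.N (0,0,1,0))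
    + (v.1 * w.2.2.2 - v.2.2.2 * w.1) • fl c (P.N (1,0,0,0)) (P.N (0,0,0,1))
    + (v.2.1 * w.2.2.1 - v.2.2.1 * w.2.1) • fl c (P.N (0,1,0,0)) (P.N (0,0,1,0))
    + (v.2.1 * w.2.2.2 - v.2.2.2 * w.2.1) • fl c (P.N (0,1,0,0)) (P.N (0,0,0,1))
    + (v.2.2.1 * w.2.2.2 - v.2.2.2 * w.2.2.1) • fl c (P.N (0,0,1,0)) (P.N (0,0,0,1)) := by
    intro v w
    ext <;> simp [fl, PM.N] <;> ring
  have e2 : ∀ v w, P.W (fl c' v w) = (v.1 * w.2.1 - v.2.1 * w.1) • P.W (fl c' (1,0,0,0) (0,1,0,0))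
    + (v.1 * w.2.2.1 - v.2.2.1 * w.1) • P.W (fl c' (1,0,0,0) (0,0,1,0))
    + (v.1 * w.2.2.2 - v.2.2.2 * w.1) • P.W (fl c' (1,0,0,0) (0,0,0,1))
    + (v.2.1 * w.2.2.1 - v.2.2.1 * w.2.1) • P.W (fl c' (0,1,0,0) (0,0,1,0))
    + (v.2.1 * w.2.2.2 - v.2.2.2 * w.2.1) • P.W (fl c' (0,1,0,0) (0,0,0,1))
    + (v.2.2.1 * w.2.2.2 - v.2.2.2 * w.2.2.1) • P.W (fl c' (0,0,1,0) (0,0,0,1)) := by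
    intro v w
    ext <;> simp [fl, PM.W] <;> ring
  rw [e1, e2, h01, h02, h03, h12, h13, h23]

def Q1 (c : FC K) : Prop := ∀ v w, (fl c v w).2 = 0
def Q2 (c : FC K) : Prop := ∀ v w u, (fl c u (0, (fl c v w).2)).2 = 0
def Q3 (c : FC K) : Prop := ∀ v w, v.1 = 0 → w.1 = 0 → (fl c v w).2 = 0

lemma W0 {P : PM K} (hd : P.det ≠ 0) {v : K × K × K × K} (h : (P.W v).2 = 0) : v.2 = 0 := by
  simp only [PM.W, Prod.mk_eq_zero] at h
  obtain ⟨h1, h2, h3⟩ := h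
  have a1 : P.det * v.2.1 = 0 := by
    rw [PM.det]
    linear_combination (P.m22 * P.m33 - P.m32 * P.m23) * h1 - (P.m21 * P.m33 - P.m31 * P.m23) * h2 + (P.m21 * P.m32 - P.m31 * P.m22) * h3
  have a2 : P.det * v.2.2.1 = 0 := by
    rw [PM.det]
    linear_combination -(P.m12 * P.m33 - P.m32 * P.m13) * h1 + (P.m11 * P.m33 - P.m31 * P.m13) * h2 - (P.m11 * P.m32 - P.m31 * P.m12) * h3
  have a3 : P.det * v.2.2.2 = 0 := by
    rw [PM.det]
    linear_combination (P.m12 * P.m23 - P.m22 * P.m13) * h1 - (P.m11 * P.m23 - P.m21 * P.m13) * h2 + (P.m11 * P.m22 - P.m21 * P.m12) * h3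
  simp only [mul_eq_zero, hd, false_or] at a1 a2 a3
  exact Prod.ext a1 (Prod.ext a2 a3)

lemma Q1.inv {c c' : FC K} (h : R111 c c') (hq : Q1 c) : Q1 c' := by
  obtain ⟨P, -, hd, hP⟩ := h
  intro v w
  apply W0 hd; rw [← hP]; exact hq _ _

lemma Q3.inv {c c' : FC K} (h : R111 c c') (hq : Q3 c) : Q3 c' := by
  obtain ⟨P, -, hd, hP⟩ := h
  intro v w hv hw
  apply W0 hd; rw [← hP]; exact hq _ _ (by simp [PM.N, hv]) (by simp [PM.N, hw])

lemma Q2.inv {c c' : FC K} (h : R111 c c') (hq : Q2 c) : Q2 c' := by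
  obtain ⟨P, -, hd, hP⟩ := h
  intro v w u
  apply W0 hd; rw [← hP]
  have := hq (P.N v) (P.N w) (P.N u)
  rw [hP] at this
  rwa [show P.N (0, (fl c' v w).2) = (0, (P.W (fl c' v w)).2) by simp [PM.N, PM.W]]

lemma Q1_iff (c : FC K) : Q1 c ↔ c.a01 = 0 ∧ c.b01 = 0 ∧ c.b02 = 0 ∧ c.b12 = 0 := by
  constructor
  · intro h
    have h1 := h (1,0,0,0) (0,1,0,0)
    have h2 := h (1,0,0,0) (0,0,1,0)
    have h3 := h (0,1,0,0) (0,0,1,0)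
    simp [fl] at h1 h2 h3
    exact ⟨h1.1, h1.2, h2, h3⟩
  · rintro ⟨h1, h2, h3, h4⟩ v w
    simp [fl, *]

lemma Q2_iff (c : FC K) : Q2 c ↔ c.a01 * c.b02 = 0 ∧ c.a01 * c.b12 = 0 := by
  constructor
  · intro h
    have h1 := h (1,0,0,0) (0,1,0,0) (1,0,0,0)
    have h2 := h (1,0,0,0) (0,1,0,0) (0,1,0,0)
    simp [fl] at h1 h2
    simp; tauto
  · rintro ⟨h1, h2⟩ v w u
    simp only [fl]
    ext
    · rfl
    · simp
    · simp only [mul_zero, zero_mul]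
      simp only [Prod.snd_zero]
      linear_combination (u.1 * (v.1 * w.2.1 - v.2.1 * w.1)) * h1 + (u.2.1 * (v.1 * w.2.1 - v.2.1 * w.1)) * h2

lemma Q3_iff (c : FC K) : Q3 c ↔ c.b12 = 0 := by
  constructor
  · intro h
    have h3 := h (0,1,0,0) (0,0,1,0) rfl rfl
    simpa [fl] using h3
  · intro h v w hv hw
    simp [fl, *]
end k111

section cnt
variable {p : ℕ} [Fact p.Prime]
local notation "𝕂" => ZMod p

lemma R111.inv {Q : FC 𝕂 → Prop} (hQ : ∀ c d, R111 c d → Q c → Q d) (P : FC 𝕂 → Prop) (hJ : ∀ c, P c → J111 c) :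
    ∀ c d, P c → P d → R111 c d → (Q c ↔ Q d) :=
  fun c d hc _ h => ⟨hQ c d h, hQ d c (h.symm (hJ c hc))⟩

def tM2a (d : 𝕂 × 𝕂) : FC 𝕂 := ⟨1, 0, 0, 1, 0, d.1, 0, d.2, 0, 0⟩

def RM2a (d d' : 𝕂 × 𝕂) : Prop := ∃ α γ : 𝕂, α ≠ 0 ∧ γ ≠ 0 ∧ d'.1 = α ^ 2 * γ * d.1 ∧ d'.2 = γ ^ 2 * d.2

lemma RM2a1 (d d' : 𝕂 × 𝕂) (h : R111 (tM2a d) (tM2a d')) : RM2a d d' := by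
  obtain ⟨P, hu, hd, h⟩ := h
  have h01 := h (1,0,0,0) (0,1,0,0)
  have h02 := h (1,0,0,0) (0,0,1,0)
  have h03 := h (1,0,0,0) (0,0,0,1)
  have h12 := h (0,1,0,0) (0,0,1,0)
  simp [fl, PM.N, PM.W, tM2a] at h01 h02 h03 h12
  obtain ⟨-, h1, h2, h3⟩ := h01
  obtain ⟨-, h4, h5, h6⟩ := h02
  have m21 := h1.symm
  have m31 := h4.symm
  have m32 : P.m32 = 0 := by rw [← h5, m21, mul_zero]
  rw [← h2] at h6
  have m22 := h2.symm
  have m33 := h6.symm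
  simp [m21, m31, m32, m22, m33, PM.det, hu] at hd h03 h12
  refine ⟨P.u, P.m11, hu, hd, ?_, ?_⟩
  · apply mul_left_cancel₀ hu
    linear_combination -(1:𝕂) * h03
  · apply mul_left_cancel₀ hu
    linear_combination -(1:𝕂) * h12

lemma RM2a2 (d d' : 𝕂 × 𝕂) (h : RM2a d d') : R111 (tM2a d) (tM2a d') := by
  obtain ⟨α, γ, ha, hg, h1, h2⟩ := h
  refine R111_of ⟨α, 0,0,0, γ,0,0, 0,α*γ,0, 0,0,α^2*γ,0,0,0⟩ ha (by simp [PM.det, ha, hg]) ?_ ?_ ?_ ?_ ?_ ?_ <;>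
  ext <;> simp [fl, PM.N, PM.W, tM2a, h1, h2] <;> ring

lemma cM2a (h5 : 5 ≤ p) : Cnt (R111 (K := 𝕂)) (fun c => ((J111 c ∧ ¬ Q1 c) ∧ ¬ Q2 c) ∧ Q3 c) (4 + Nat.gcd (p - 1) 4) := by
  have key : Cnt RM2a (fun d : 𝕂 × 𝕂 => True) ((1 + 1) + (2 + Nat.gcd (p - 1) 4)) := by
    refine Cnt.split (fun d => d.2 = 0) ?_ (Cnt.split (fun d => d.1 = 0) ?_ ?_ ?_) (Cnt.split (fun d => d.1 = 0) ?_ ?_ ?_)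
    · rintro c d - - ⟨α, γ, ha, hg, h1, h2⟩; simp [h2, hg]
    · rintro c d - - ⟨α, γ, ha, hg, h1, h2⟩; simp [h1, hg, ha]
    · refine Cnt.one (0, 0) (by simp) ?_
      rintro ⟨a, b⟩ h; simp at h
      exact ⟨1, 1, by simp, by simp, by simp [h], by simp [h]⟩
    · refine Cnt.one (1, 0) (by simp) ?_
      rintro ⟨a, b⟩ h; simp at h
      exact ⟨1, a⁻¹, by simp, by simp [h], by simp [h], by simp [h]⟩
    · rintro c d - - ⟨α, γ, ha, hg, h1, h2⟩; simp [h1, hg, ha]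
    · refine Cnt.sq h5 (fun s => (0, s)) (fun s hs => by simp [hs]) ?_ ?_
      · rintro ⟨a, b⟩ h; simp at h
        exact ⟨b, h.1, fun c hc => ⟨1, c, by simp, hc, by simp [h], by simp⟩⟩
      · rintro s s' hs hs' ⟨α, γ, ha, hg, h1, h2⟩
        exact ⟨γ, hg, h2⟩
    · refine Cnt.pw 4 (fun s => (1, s)) (fun s hs => by simp [hs]) ?_ ?_
      · rintro ⟨a, b⟩ h; simp at h
        refine ⟨b / a ^ 2, by simp [h], fun c hc => ⟨c⁻¹, c ^ 2 / a, by simp [hc], by simp [hc, h], ?_, ?_⟩⟩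
        · have := h.2; simp; field_simp
        · have := h.2; simp; field_simp
      · rintro s s' hs hs' ⟨α, γ, ha, hg, h1, h2⟩
        simp at h1 h2
        have : γ = (α⁻¹) ^ 2 := by field_simp; linear_combination -h1
        exact ⟨α⁻¹, by simp [ha], by rw [h2, this]; ring⟩
  rw [show 4 + Nat.gcd (p - 1) 4 = ((1 + 1) + (2 + Nat.gcd (p - 1) 4)) by ring]
  refine key.sub tM2a ?_ ?_ ?_ RM2a1 RM2a2
  · intro d _; simp [Q1_iff, Q2_iff, Q3_iff, J111, tM2a]
  · intro c hc
    rw [Q1_iff, Q2_iff, Q3_iff] at hc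
    obtain ⟨⟨⟨⟨j1, j2⟩, h1⟩, h2⟩, h3⟩ := hc
    have hab : c.a01 * c.b02 ≠ 0 := by rw [h3] at h2; simpa using h2
    have ha := left_ne_zero_of_mul hab
    have hb := right_ne_zero_of_mul hab
    have z23 : c.z23 = 0 := by simpa [ha] using j2
    have z13 : c.z13 = 0 := by simpa [h3, z23, hb] using j1
    refine ⟨(c.a01 * c.b02 * c.z03, c.a01 * c.z12), trivial, ?_⟩
    refine R111_of ⟨1, 0,0,0, 1,0,0, 0,c.a01,c.b01, 0,0,c.a01*c.b02,0,c.z01,c.a01 * c.z02 + c.b01 * c.z03⟩ one_ne_zero (by simp [PM.det, ha, hb]) ?_ ?_ ?_ ?_ ?_ ?_ <;>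
    ext <;> simp [fl, PM.N, PM.W, tM2a, z23, z13, h3] <;> ring
  · exact fun c c' c'' h => R111.trans h.1.1.1
end cnt

section cnt
variable {p : ℕ} [Fact p.Prime]
local notation "𝕂" => ZMod p

def tM2b (d : 𝕂 × 𝕂) : FC 𝕂 := ⟨-1, 0, 0, 0, d.2, 0, 1, 0, d.1, 0⟩
def RM2b (d d' : 𝕂 × 𝕂) : Prop := ∃ α γ : 𝕂, α ≠ 0 ∧ γ ≠ 0 ∧ d'.1 = α ^ 3 * d.1 ∧ d'.2 = γ * α * d.2

lemma RM2b1 (d d' : 𝕂 × 𝕂) (h : R111 (tM2b d) (tM2b d')) : RM2b d d' := by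
  obtain ⟨P, hu, hd, h⟩ := h
  have h01 := h (1,0,0,0) (0,1,0,0)
  have h02 := h (1,0,0,0) (0,0,1,0)
  have h12 := h (0,1,0,0) (0,0,1,0)
  have h13 := h (0,1,0,0) (0,0,0,1)
  simp [fl, PM.N, PM.W, tM2b] at h01 h02 h12 h13
  obtain ⟨-, m21, h2, h3⟩ := h01
  obtain ⟨-, m31, m32, m33⟩ := h12
  obtain ⟨h4, -, h6⟩ := h02
  have m31 := m31.symm
  have m32 := m32.symm
  try simp only [m21, mul_zero, sub_zero] at m33
  have m22 : P.m22 = P.u * P.m11 := h2.symm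
  have m33 := m33.symm
  rw [m22] at m33
  simp [m21, m31, m32, m22, m33, PM.det, hu] at hd h13 h4 h6
  have k1 : P.k1 = 0 := by simpa [hd] using h6
  refine ⟨P.m11, P.u, hd, hu, ?_, ?_⟩
  · apply mul_left_cancel₀ hu
    linear_combination -(1:𝕂) * h13
  · apply mul_left_cancel₀ hu
    rw [k1] at h4
    linear_combination -(1:𝕂) * h4

lemma RM2b2 (d d' : 𝕂 × 𝕂) (h : RM2b d d') : R111 (tM2b d) (tM2b d') := by
  obtain ⟨α, γ, ha, hg, h1, h2⟩ := h
  refine R111_of ⟨γ, 0,0,0, α,0,0, 0,α*γ,0, 0,0,α^2*γ,0,0,0⟩ hg (by simp [PM.det, ha, hg]) ?_ ?_ ?_ ?_ ?_ ?_ <;>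
  ext <;> simp [fl, PM.N, PM.W, tM2b, h1, h2] <;> ring

lemma cM2b : Cnt (R111 (K := 𝕂)) (fun c => ((J111 c ∧ ¬ Q1 c) ∧ ¬ Q2 c) ∧ ¬ Q3 c) (2 + 2 * Nat.gcd (p - 1) 3) := by
  have key : Cnt RM2b (fun d : 𝕂 × 𝕂 => True) ((1 + 1) + (Nat.gcd (p - 1) 3 + Nat.gcd (p - 1) 3)) := by
    refine Cnt.split (fun d => d.1 = 0) ?_ (Cnt.split (fun d => d.2 = 0) ?_ ?_ ?_) (Cnt.split (fun d => d.2 = 0) ?_ ?_ ?_)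
    · rintro c d - - ⟨α, γ, ha, hg, h1, h2⟩; simp [h1, ha]
    · rintro c d - - ⟨α, γ, ha, hg, h1, h2⟩; simp [h2, hg, ha]
    · refine Cnt.one (0, 0) (by simp) ?_
      rintro ⟨a, b⟩ h; simp at h
      exact ⟨1, 1, by simp, by simp, by simp [h], by simp [h]⟩
    · refine Cnt.one (0, 1) (by simp) ?_
      rintro ⟨a, b⟩ h; simp at h
      exact ⟨1, b⁻¹, by simp, by simp [h], by simp [h], by simp [h]⟩
    · rintro c d - - ⟨α, γ, ha, hg, h1, h2⟩; simp [h2, hg, ha]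
    · refine Cnt.pw 3 (fun s => (s, 0)) (fun s hs => by simp [hs]) ?_ ?_
      · rintro ⟨a, b⟩ h; simp at h
        exact ⟨a, h.1, fun c hc => ⟨c, 1, hc, by simp, by simp, by simp [h]⟩⟩
      · rintro s s' hs hs' ⟨α, γ, ha, hg, h1, h2⟩
        exact ⟨α, ha, h1⟩
    · refine Cnt.pw 3 (fun s => (s, 1)) (fun s hs => by simp [hs]) ?_ ?_
      · rintro ⟨a, b⟩ h; simp at h
        have := h.2
        exact ⟨a, h.1, fun c hc => ⟨c, (c * b)⁻¹, hc, by simp [hc, h], by simp, by simp; field_simp⟩⟩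
      · rintro s s' hs hs' ⟨α, γ, ha, hg, h1, h2⟩
        exact ⟨α, ha, h1⟩
  rw [show 2 + 2 * Nat.gcd (p - 1) 3 = ((1 + 1) + (Nat.gcd (p - 1) 3 + Nat.gcd (p - 1) 3)) by ring]
  refine key.sub tM2b ?_ ?_ ?_ RM2b1 RM2b2
  · intro d _; simp [Q1_iff, Q2_iff, Q3_iff, J111, tM2b]
  · intro c hc
    rw [Q1_iff, Q2_iff, Q3_iff] at hc
    obtain ⟨⟨⟨⟨j1, j2⟩, h1⟩, h2⟩, hb⟩ := hc
    have ha : c.a01 ≠ 0 := fun h => by simp [h] at h2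
    have z23 : c.z23 = 0 := by simpa [ha] using j2
    have z03 : c.z03 = c.b02 * c.z13 / c.b12 := by field_simp; linear_combination j1 - c.b01 * z23
    refine ⟨(-(c.a01 * c.b12 * c.z13), - c.a01 * (c.z02 - c.b02 / c.b12 * c.z12)), trivial, ?_⟩
    refine R111_of ⟨1, -c.b02/c.b12,0,0, 1,0,0, 0,-c.a01,-c.b01, 0,0,-c.a01*c.b12,0,-c.z01,-c.a01 * c.z12 - c.b01 * c.z13⟩
      one_ne_zero (by simp [PM.det, ha, hb]) ?_ ?_ ?_ ?_ ?_ ?_ <;>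
    ext <;> simp [fl, PM.N, PM.W, tM2b, z23, z03] <;> field_simp <;> ring
  · exact fun c c' c'' h => R111.trans h.1.1.1

def tM1b (d : 𝕂 × 𝕂 × 𝕂 × 𝕂) : FC 𝕂 := ⟨0, 0, d.2.2.1, 0, d.2.2.2, 0, 1, 0, d.1, d.2.1⟩
def RM1b (d d' : 𝕂 × 𝕂 × 𝕂 × 𝕂) : Prop := ∃ α k a b c e : 𝕂, α ≠ 0 ∧ a * e - b * c ≠ 0 ∧
  α * d'.1 = (a * e - b * c) * (a * d.1 + b * d.2.1) ∧ α * d'.2.1 = (a * e - b * c) * (c * d.1 + e * d.2.1) ∧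
  α * d'.2.2.1 = α * (a * d.2.2.1 + b * d.2.2.2) - k * (a * d.1 + b * d.2.1) ∧
  α * d'.2.2.2 = α * (c * d.2.2.1 + e * d.2.2.2) - k * (c * d.1 + e * d.2.1)

lemma RM1b1 (d d' : 𝕂 × 𝕂 × 𝕂 × 𝕂) (h : R111 (tM1b d) (tM1b d')) : RM1b d d' := by
  obtain ⟨P, hu, hd, h⟩ := h
  have h01 := h (1,0,0,0) (0,1,0,0)
  have h02 := h (1,0,0,0) (0,0,1,0)
  have h12 := h (0,1,0,0) (0,0,1,0)
  have h13 := h (0,1,0,0) (0,0,0,1)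
  have h23 := h (0,0,1,0) (0,0,0,1)
  simp [fl, PM.N, PM.W, tM1b] at h01 h02 h12 h13 h23
  obtain ⟨-, m31, m32, m33⟩ := h12
  have m31 := m31.symm
  have m32 := m32.symm
  have m33 := m33.symm
  have hD : P.m11 * P.m22 - P.m12 * P.m21 ≠ 0 := fun h0 => by
    apply hd; rw [PM.det, m31, m32, m33, h0]; ring
  obtain ⟨a1, a2⟩ := h01
  obtain ⟨b1, b2⟩ := h02
  have k1 : P.k1 = 0 := by
    apply (mul_eq_zero.1 (?_ : (P.m11 * P.m22 - P.m12 * P.m21) * P.k1 = 0)).resolve_left hD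
    linear_combination P.m11 * b2 - P.m21 * a2
  have k2 : P.k2 = 0 := by
    apply (mul_eq_zero.1 (?_ : (P.m11 * P.m22 - P.m12 * P.m21) * P.k2 = 0)).resolve_left hD
    linear_combination P.m12 * b2 - P.m22 * a2
  simp [m31, m32, m33, k1, k2] at h13 h23 a1 b1
  refine ⟨P.u, P.k3, P.m11, P.m12, P.m21, P.m22, hu, hD, ?_, ?_, ?_, ?_⟩
  · linear_combination -(1:𝕂) * h13
  · linear_combination -(1:𝕂) * h23
  · linear_combination -(1:𝕂) * a1
  · linear_combination -(1:𝕂) * b1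

lemma RM1b2 (d d' : 𝕂 × 𝕂 × 𝕂 × 𝕂) (h : RM1b d d') : R111 (tM1b d) (tM1b d') := by
  obtain ⟨α, k, a, b, c, e, ha, hD, h1, h2, h3, h4⟩ := h
  refine R111_of ⟨α, 0,0,k, a,b,0, c,e,0, 0,0,a*e-b*c,0,0,0⟩ ha (by
    rw [PM.det]; intro h0; apply pow_ne_zero 2 hD; linear_combination h0) ?_ ?_ ?_ ?_ ?_ ?_ <;>
  ext <;> simp [fl, PM.N, PM.W, tM1b, h1, h2, h3, h4] <;> ring

lemma cM1b : Cnt (R111 (K := 𝕂)) (fun c => ((J111 c ∧ ¬ Q1 c) ∧ Q2 c) ∧ ¬ Q3 c) 4 := by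
  have i1 : ∀ c d : 𝕂 × 𝕂 × 𝕂 × 𝕂, RM1b c d → ((c.1 = 0 ∧ c.2.1 = 0) ↔ (d.1 = 0 ∧ d.2.1 = 0)) := by
    rintro c d ⟨α, k, a, b, c', e, ha, hD, h1, h2, h3, h4⟩
    constructor
    · rintro ⟨q1, q2⟩; simpa [q1, q2, ha] using And.intro h1 h2
    · rintro ⟨q1, q2⟩
      simp [q1, q2, hD] at h1 h2
      constructor <;> apply (mul_eq_zero.1 (?_ : (a * e - b * c') * _ = 0)).resolve_left hD
      · linear_combination e * h1 - b * h2
      · linear_combination a * h2 - c' * h1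
  have key : Cnt RM1b (fun d : 𝕂 × 𝕂 × 𝕂 × 𝕂 => True) ((1 + 1) + (1 + 1)) := by
    refine Cnt.split (fun d => d.1 = 0 ∧ d.2.1 = 0) (fun c d _ _ => i1 c d)
      (Cnt.split (fun d => d.2.2.1 = 0 ∧ d.2.2.2 = 0) ?_ ?_ ?_) (Cnt.split (fun d => d.1 * d.2.2.2 = d.2.1 * d.2.2.1) ?_ ?_ ?_)
    · rintro c d ⟨-, x1, x2⟩ ⟨-, y1, y2⟩ ⟨α, k, a, b, c', e, ha, hD, h1, h2, h3, h4⟩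
      simp [x1, x2, y1, y2, ha] at h3 h4
      constructor
      · rintro ⟨q1, q2⟩; simpa [q1, q2] using And.intro h3 h4
      · rintro ⟨q1, q2⟩
        rw [q1] at h3; rw [q2] at h4
        constructor <;> apply (mul_eq_zero.1 (?_ : (a * e - b * c') * _ = 0)).resolve_left hD
        · linear_combination b * h4 - e * h3
        · linear_combination c' * h3 - a * h4
    · refine Cnt.one (0, 0, 0, 0) (by simp) ?_
      rintro ⟨a, b, c, d⟩ h; simp at h
      exact ⟨1, 0, 1, 0, 0, 1, by simp, by simp, by simp [h], by simp [h], by simp [h], by simp [h]⟩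
    · refine Cnt.one (0, 0, 1, 0) (by simp) ?_
      rintro ⟨a, b, c, d⟩ ⟨⟨-, h1, h2⟩, h⟩
      simp only at h1 h2 h
      by_cases hc : c = 0
      · have hd : d ≠ 0 := fun hd => h ⟨hc, hd⟩
        exact ⟨1, 0, 0, d⁻¹, 1, 0, by simp, by simp [hd], by simp [h1, h2], by simp [h1, h2], by simp [hd], by simp [hc]⟩
      · exact ⟨1, 0, c⁻¹, 0, -d, c, by simp, by simp [hc], by simp [h1, h2], by simp [h1, h2], by simp [hc], by simp; ring⟩
    · rintro c d - - ⟨α, k, a, b, c', e, ha, hD, h1, h2, h3, h4⟩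
      have : α ^ 2 * (d.1 * d.2.2.2 - d.2.1 * d.2.2.1) = α * (a * e - b * c') ^ 2 * (c.1 * c.2.2.2 - c.2.1 * c.2.2.1) := by
        calc _ = (α * d.1) * (α * d.2.2.2) - (α * d.2.1) * (α * d.2.2.1) := by ring
          _ = _ := by rw [h1, h2, h3, h4]; ring
      rw [← sub_eq_zero, ← sub_eq_zero (a := d.1 * _)]
      constructor
      · intro h0; rw [h0, mul_zero] at this; simpa [ha] using this
      · intro h0; rw [h0, mul_zero] at this; simpa [ha, hD] using this.symm
    · refine Cnt.one (1, 0, 0, 0) (by simp) ?_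
      rintro ⟨a, b, c, d⟩ ⟨⟨-, h1⟩, h⟩
      simp only at h1 h
      by_cases ha : a = 0
      · have hb : b ≠ 0 := fun hd => h1 ⟨ha, hd⟩
        have hc : c = 0 := by simpa [ha, hb] using h
        have hb' : -b⁻¹ ≠ 0 := by simp [hb]
        exact ⟨-b⁻¹, -b⁻¹*(d/b), 0, b⁻¹, 1, 0, hb', by simp [hb], by simp [hb], by simp [ha], by simp [ha,hc]; field_simp; ring, by simp [hc, ha]⟩
      · refine ⟨1, c/a, a⁻¹, 0, -b, a, by simp, by simp [ha], by simp [ha], by simp [mul_comm], by simp; field_simp; ring, ?_⟩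
        simp; field_simp; linear_combination -h
    · refine Cnt.one (1, 0, 0, 1) (by simp) ?_
      rintro ⟨a, b, c, d⟩ ⟨⟨-, -⟩, h⟩
      simp only at h
      rw [← sub_eq_zero] at h
      obtain ⟨D, hD⟩ : ∃ D, D = a * d - b * c := ⟨_, rfl⟩
      rw [← hD] at h
      have hh : d / D * (a / D) - -c / D * (-b / D) = D⁻¹ := by field_simp; rw [hD]; ring
      refine ⟨D⁻¹, 0, d / D, -c/D, -b/D, a/D, by simp [h], ?_, ?_, ?_, ?_, ?_⟩
      · rw [hh]; simp [h]
      all_goals simp only [hh]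
      all_goals field_simp
      all_goals (try rw [hD])
      all_goals ring
  refine key.sub tM1b ?_ ?_ ?_ RM1b1 RM1b2
  · intro d _; simp [Q1_iff, Q2_iff, Q3_iff, J111, tM1b]
  · intro c hc
    rw [Q1_iff, Q2_iff, Q3_iff] at hc
    obtain ⟨⟨⟨⟨j1, j2⟩, h1⟩, h2⟩, hb⟩ := hc
    have ha : c.a01 = 0 := by simpa [hb] using h2.2
    have z03 : c.z03 = (-c.b01 * c.z23 + c.b02 * c.z13) / c.b12 := by field_simp; linear_combination j1
    refine ⟨(c.b12 * c.z13, c.b12 * c.z23, c.z01 - c.b01 / c.b12 * c.z12, c.z02 - c.b02 / c.b12 * c.z12), trivial, ?_⟩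
    refine R111_of ⟨1, -c.b02/c.b12,c.b01/c.b12,0, 1,0,0, 0,1,0, 0,0,c.b12,0,0,c.z12⟩
      one_ne_zero (by simp [PM.det, hb]) ?_ ?_ ?_ ?_ ?_ ?_ <;>
    ext <;> simp [fl, PM.N, PM.W, tM1b, ha, z03] <;> field_simp <;> ring
  · exact fun c c' c'' h => R111.trans h.1.1.1
end cnt

section cnt
variable {p : ℕ} [Fact p.Prime]
local notation "𝕂" => ZMod p

def tM1a (d : 𝕂 × 𝕂 × 𝕂 × 𝕂) : FC 𝕂 := ⟨0, 1, 0, 0, d.2.2.1, d.1, 0, d.2.2.2, d.2.1, 0⟩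
def RM1a (d d' : 𝕂 × 𝕂 × 𝕂 × 𝕂) : Prop := ∃ α β γ η θ : 𝕂, α ≠ 0 ∧ γ ≠ 0 ∧ η ≠ 0 ∧ d'.1 = γ * (α * d.1 + β * d.2.1) ∧
  d'.2.1 = γ ^ 2 * d.2.1 ∧ α * d'.2.2.1 = η * (α * d.2.2.1 + β * d.2.2.2) + θ * (α * d.1 + β * d.2.1) ∧
  α * d'.2.2.2 = γ * (η * d.2.2.2 + θ * d.2.1)

lemma RM1a1 (d d' : 𝕂 × 𝕂 × 𝕂 × 𝕂) (h : R111 (tM1a d) (tM1a d')) : RM1a d d' := by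
  obtain ⟨P, hu, hd, h⟩ := h
  have h01 := h (1,0,0,0) (0,1,0,0)
  have h02 := h (1,0,0,0) (0,0,1,0)
  have h03 := h (1,0,0,0) (0,0,0,1)
  have h12 := h (0,1,0,0) (0,0,1,0)
  have h13 := h (0,1,0,0) (0,0,0,1)
  simp [fl, PM.N, PM.W, tM1a] at h01 h02 h03 h12 h13
  obtain ⟨-, m31, m32, m33⟩ := h01
  have m31 := m31.symm
  have m32 := m32.symm
  have m33 := m33.symm
  simp [m31, m32, m33, hu] at h02 h03 h12 h13
  obtain ⟨h02, m21⟩ := h02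
  simp [m31, m32, m33, m21, hu, PM.det] at hd h02 h03 h12 h13
  refine ⟨P.u, P.k1, P.m11, P.m22, P.m23, hu, hd.1, hd.2.1, ?_, ?_, ?_, ?_⟩
  · apply mul_left_cancel₀ hu
    linear_combination -(1:𝕂) * h03
  · apply mul_left_cancel₀ hu
    linear_combination -(1:𝕂) * h13
  · linear_combination -(1:𝕂) * h02
  · linear_combination -(1:𝕂) * h12

lemma RM1a2 (d d' : 𝕂 × 𝕂 × 𝕂 × 𝕂) (h : RM1a d d') : R111 (tM1a d) (tM1a d') := by
  obtain ⟨α, β, γ, η, θ, ha, hg, he, h1, h2, h3, h4⟩ := h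
  refine R111_of ⟨α,β,0,0, γ,0,0, 0,η,θ, 0,0,α*γ, 0,0,0⟩ ha (by simp [PM.det, ha, hg, he]) ?_ ?_ ?_ ?_ ?_ ?_ <;>
  ext <;> simp [fl, PM.N, PM.W, tM1a, h1, h2, h3, h4] <;> ring

lemma cM1a (h5 : 5 ≤ p) : Cnt (R111 (K := 𝕂)) (fun c => ((J111 c ∧ ¬ Q1 c) ∧ Q2 c) ∧ Q3 c) 9 := by
  have key : Cnt RM1a (fun d : 𝕂 × 𝕂 × 𝕂 × 𝕂 => True) (((1 + 1) + 1 + (1 + 1)) + (2 + 2)) := by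
    refine Cnt.split (fun d => d.2.1 = 0) ?_ (Cnt.split (fun d => d.1 = 0) ?_
      (Cnt.split (fun d => d.2.2.2 = 0) ?_ (Cnt.split (fun d => d.2.2.1 = 0) ?_ ?_ ?_) ?_)
      (Cnt.split (fun d => d.2.2.2 = 0) ?_ ?_ ?_)) (Cnt.split (fun d => d.2.2.1 * d.2.1 - d.2.2.2 * d.1 = 0) ?_ ?_ ?_)
    · rintro c d - - ⟨α, β, γ, η, θ, ha, hg, he, h1, h2, h3, h4⟩; simp [h2, hg]
    · rintro c d ⟨-, q⟩ - ⟨α, β, γ, η, θ, ha, hg, he, h1, h2, h3, h4⟩; simp [h1, hg, ha, q]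
    · rintro c d ⟨⟨-, q⟩, q'⟩ - ⟨α, β, γ, η, θ, ha, hg, he, h1, h2, h3, h4⟩
      rw [← mul_right_inj' (b := d.2.2.2) ha, mul_zero, h4]; simp [q, hg, he]
    · rintro c d ⟨⟨⟨-, q⟩, q'⟩, q''⟩ - ⟨α, β, γ, η, θ, ha, hg, he, h1, h2, h3, h4⟩
      rw [← mul_right_inj' (b := d.2.2.1) ha, mul_zero, h3]; simp [q, q', q'', ha, he]
    · refine Cnt.one (0, 0, 0, 0) (by simp) ?_
      rintro ⟨a, b, c, d⟩ h; simp at h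
      exact ⟨1, 0, 1, 1, 0, by simp [h]⟩
    · refine Cnt.one (0, 0, 1, 0) (by simp) ?_
      rintro ⟨a, b, c, d⟩ h; simp at h
      exact ⟨1, 0, 1, c⁻¹, 0, by simp [h]⟩
    · refine Cnt.one (0, 0, 0, 1) (by simp) ?_
      rintro ⟨a, b, c, d⟩ h; simp at h
      exact ⟨1, -c/d, 1, d⁻¹, 0, by simp [h]⟩
    · rintro c d ⟨⟨-, q⟩, q'⟩ - ⟨α, β, γ, η, θ, ha, hg, he, h1, h2, h3, h4⟩
      rw [← mul_right_inj' (b := d.2.2.2) ha, mul_zero, h4]; simp [q, hg, he]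
    · refine Cnt.one (1, 0, 0, 0) (by simp) ?_
      rintro ⟨a, b, c, d⟩ h; simp at h
      exact ⟨1, 0, a⁻¹, 1, -c/a, by simp [h]⟩
    · refine Cnt.one (1, 0, 0, 1) (by simp) ?_
      rintro ⟨a, b, c, d⟩ h; simp at h
      exact ⟨1, -c/d, a⁻¹, a/d, 0, by simp [h]⟩
    · rintro c d ⟨-, q⟩ - ⟨α, β, γ, η, θ, ha, hg, he, h1, h2, h3, h4⟩
      have : α * (d.2.2.1 * d.2.1 - d.2.2.2 * d.1) = γ ^ 2 * η * α * (c.2.2.1 * c.2.1 - c.2.2.2 * c.1) := by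
        rw [h1, h2]; linear_combination (γ ^ 2 * c.2.1) * h3 - (γ * (α * c.1 + β * c.2.1)) * h4
      rw [← mul_right_inj' (b := d.2.2.1 * d.2.1 - _) ha, mul_zero, this]; simp [hg, he, ha]
    · refine Cnt.sq h5 (fun s => (0, s, 0, 0)) (fun s hs => by simp [hs]) ?_ ?_
      · rintro ⟨a, b, c, d⟩ h; simp at h
        obtain ⟨hb, h⟩ := h
        refine ⟨b, hb, fun γ hc => ⟨1, -a/b, γ, 1, -d/b, by simp, hc, by simp, by simp [hb], by simp, ?_, by simp [hb]⟩⟩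
        simp [hb]; field_simp; linear_combination -h
      · rintro s s' hs hs' ⟨α, β, γ, η, θ, ha, hg, he, h1, h2, h3, h4⟩
        exact ⟨γ, hg, h2⟩
    · refine Cnt.sq h5 (fun s => (0, s, 1, 0)) (fun s hs => by simp [hs]) ?_ ?_
      · rintro ⟨a, b, c, d⟩ h; simp at h
        obtain ⟨hb, h⟩ := h
        obtain ⟨D, hD⟩ : ∃ D, D = c * b - d * a := ⟨_, rfl⟩
        rw [← hD] at h
        refine ⟨b, hb, fun γ hc => ⟨1, -a/b, γ, b / D, -d/D, by simp, hc, by simp [hb, h], by simp [hb], by simp, ?_, ?_⟩⟩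
        · simp; field_simp; rw [hD]; ring
        · simp; field_simp; simp
      · rintro s s' hs hs' ⟨α, β, γ, η, θ, ha, hg, he, h1, h2, h3, h4⟩
        exact ⟨γ, hg, h2⟩
  refine key.sub tM1a ?_ ?_ ?_ RM1a1 RM1a2
  · intro d _; simp [Q1_iff, Q2_iff, Q3_iff, J111, tM1a]
  · intro c hc
    rw [Q1_iff, Q2_iff, Q3_iff] at hc
    obtain ⟨⟨⟨⟨j1, j2⟩, h1⟩, h2⟩, hb⟩ := hc
    by_cases ha : c.a01 = 0
    · by_cases hb2 : c.b02 = 0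
      · have hb1 : c.b01 ≠ 0 := fun h0 => h1 ⟨ha, h0, hb2, hb⟩
        have z23 : c.z23 = 0 := by simpa [hb, hb2, hb1] using j1
        refine ⟨(c.b01 * c.z03, c.b01 * c.z13, c.z02, c.z12), trivial, ?_⟩
        refine R111_of ⟨1,0,0,0, 1,0,0, 0,1,0, 0,0,c.b01,0,0,c.z01⟩
          one_ne_zero (by simp [PM.det, hb1]) ?_ ?_ ?_ ?_ ?_ ?_ <;>
        ext <;> simp [fl, PM.N, PM.W, tM1a, ha, hb, hb2, z23, mul_comm]
      · have j : c.b02 * c.z13 = c.b01 * c.z23 := by rw [hb] at j1; linear_combination -j1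
        refine ⟨(c.b02 * c.z03, c.b02 * c.z23, c.z01 - c.b01/c.b02*c.z02, -c.z12), trivial, ?_⟩
        refine R111_of ⟨1,0,0,0, 0,1,0, 1,-c.b01/c.b02,0, 0,0,c.b02,0,0,c.z02⟩
          one_ne_zero (by simp [PM.det, hb2]) ?_ ?_ ?_ ?_ ?_ ?_ <;>
        ext <;> simp [fl, PM.N, PM.W, tM1a, ha, hb] <;> field_simp <;> (try ring) <;> (try linear_combination j)
    · have hb2 : c.b02 = 0 := by simpa [ha] using h2.1
      have z23 : c.z23 = 0 := by simpa [ha] using j2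
      refine ⟨(c.a01 * c.z02 + c.b01 * c.z03, c.a01 * c.z12 + c.b01 * c.z13, c.z03, c.z13), trivial, ?_⟩
      refine R111_of ⟨1,0,0,0, 1,0,0, 0,0,1, 0,c.a01,c.b01,0,0,c.z01⟩
        one_ne_zero (by simp [PM.det, ha]) ?_ ?_ ?_ ?_ ?_ ?_ <;>
      ext <;> simp [fl, PM.N, PM.W, tM1a, hb, hb2, z23] <;> ring
  · exact fun c c' c'' h => R111.trans h.1.1.1

lemma W1 {P : PM 𝕂} (hu : P.u ≠ 0) (hd : P.det ≠ 0) {v : 𝕂 × 𝕂 × 𝕂 × 𝕂} (h : P.W v = 0) : v = 0 := by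
  have h2 := W0 hd (congrArg Prod.snd h)
  have h1 := congrArg Prod.fst h
  have e1 : v.2.1 = 0 := by rw [h2]; rfl
  have e2 : v.2.2.1 = 0 := by rw [h2]; rfl
  have e3 : v.2.2.2 = 0 := by rw [h2]; rfl
  simp [PM.W, e1, e2, e3, hu] at h1
  exact Prod.ext h1 h2

def Q4 (c : FC 𝕂) : Prop := ∀ v w, fl c v w = 0
def Q5 (c : FC 𝕂) : Prop := ∀ v w, v.1 = 0 → w.1 = 0 → fl c v w = 0
lemma Q4.inv {c c' : FC 𝕂} (h : R111 c c') (hq : Q4 c) : Q4 c' := by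
  obtain ⟨P, hu, hd, hP⟩ := h
  intro v w
  apply W1 hu hd; rw [← hP]; exact hq _ _
lemma Q5.inv {c c' : FC 𝕂} (h : R111 c c') (hq : Q5 c) : Q5 c' := by
  obtain ⟨P, hu, hd, hP⟩ := h
  intro v w hv hw
  apply W1 hu hd; rw [← hP]; exact hq _ _ (by simp [PM.N, hv]) (by simp [PM.N, hw])
def FC.pf (c : FC 𝕂) : 𝕂 := c.z01 * c.z23 - c.z02 * c.z13 + c.z03 * c.z12

set_option maxHeartbeats 1000000 in
lemma cM0_cov (c : FC 𝕂) (h : (J111 c ∧ Q1 c) ∧ ¬ Q5 c) (s : 𝕂) (hs : s ≠ 0) : R111 c ⟨0,0,0,0,0,s * c.pf,0,1,0,0⟩ := by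
  obtain ⟨⟨-, h1⟩, h2⟩ := h
  rw [Q1_iff] at h1
  obtain ⟨q1, q2, q3, q4⟩ := h1
  by_cases r1 : c.z12 = 0
  · by_cases r2 : c.z13 = 0
    · have r3 : c.z23 ≠ 0 := fun r3 => h2 fun v w hv hw => by simp [fl, *]
      refine R111_of ⟨1,0,-c.z03/c.z23,c.z02/c.z23, 0,c.z23⁻¹,0, 0,0,1, s*c.z23,-s*c.z13,s*c.z12, 0,0,0⟩
        one_ne_zero (by simp [PM.det, r3, r1, r2, hs]) ?_ ?_ ?_ ?_ ?_ ?_ <;> ext <;>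
        simp [fl, PM.N, PM.W, FC.pf, q1, q2, q3, q4, r1] <;> (try simp only [r2]) <;> (try field_simp) <;> (try ring)
    · refine R111_of ⟨1,-c.z03/c.z13,0,c.z01/c.z13, c.z13⁻¹,0,0, 0,0,1, s*c.z23,-s*c.z13,s*c.z12, 0,0,0⟩
        one_ne_zero (by simp [PM.det, r2, r1, hs]) ?_ ?_ ?_ ?_ ?_ ?_ <;> ext <;>
        simp [fl, PM.N, PM.W, FC.pf, q1, q2, q3, q4, r1] <;> (try simp only [r2]) <;> (try field_simp) <;> (try ring)
  · refine R111_of ⟨1,-c.z02/c.z12,c.z01/c.z12,0, c.z12⁻¹,0,0, 0,1,0, s*c.z23,-s*c.z13,s*c.z12, 0,0,0⟩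
        one_ne_zero (by simp [PM.det, r1, hs]) ?_ ?_ ?_ ?_ ?_ ?_ <;> ext <;>
        simp [fl, PM.N, PM.W, FC.pf, q1, q2, q3, q4, r1] <;> (try simp only [r2]) <;> (try field_simp) <;> (try ring)

lemma cM0_pf (c c' : FC 𝕂) (a1 : Q1 c) (a2 : Q1 c') (h : R111 c c') : c.pf = 0 ↔ c'.pf = 0 := by
  obtain ⟨P, hu, hd, h⟩ := h
  rw [Q1_iff] at a1 a2
  obtain ⟨b1, b2, b3, b4⟩ := a2
  obtain ⟨a1, a2, a3, a4⟩ := a1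
  have h01 := h (1,0,0,0) (0,1,0,0)
  have h02 := h (1,0,0,0) (0,0,1,0)
  have h03 := h (1,0,0,0) (0,0,0,1)
  have h12 := h (0,1,0,0) (0,0,1,0)
  have h13 := h (0,1,0,0) (0,0,0,1)
  have h23 := h (0,0,1,0) (0,0,0,1)
  simp [fl, PM.N, PM.W, a1, a2, a3, a4, b1, b2, b3, b4] at h01 h02 h03 h12 h13 h23
  have : P.u ^ 2 * c'.pf = P.u * P.det * c.pf := by
    calc _ = (P.u * c'.z01) * (P.u * c'.z23) - (P.u * c'.z02) * (P.u * c'.z13) + (P.u * c'.z03) * (P.u * c'.z12) := by rw [FC.pf]; ring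
      _ = _ := by rw [← h01, ← h02, ← h03, ← h12, ← h13, ← h23, FC.pf, PM.det]; ring
  constructor
  · intro h0; simpa [h0, hu] using this
  · intro h0; simpa [h0, hu, hd] using this

lemma cM0 : Cnt (R111 (K := 𝕂)) (fun c => J111 c ∧ Q1 c) 4 := by
  have : Cnt (R111 (K := 𝕂)) (fun c => J111 c ∧ Q1 c) ((1 + 1) + (1 + 1)) := by
    refine Cnt.split Q5 (R111.inv (fun c d h => Q5.inv h) _ fun c h => h.1)
      (Cnt.split Q4 (R111.inv (fun c d h => Q4.inv h) _ fun c h => h.1.1) ?_ ?_) (Cnt.split (fun c => c.pf = 0) ?_ ?_ ?_)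
    · refine Cnt.one ⟨0,0,0,0,0,0,0,0,0,0⟩ ?_ ?_
      · refine ⟨⟨⟨by simp [J111], by simp [Q1_iff]⟩, fun v w _ _ => ?_⟩, fun v w => ?_⟩ <;> simp [fl] <;> rfl
      · rintro c ⟨-, h⟩
        refine ⟨⟨1,0,0,0,1,0,0,0,1,0,0,0,1,0,0,0⟩, one_ne_zero, by simp [PM.det], fun v w => ?_⟩
        rw [h]; simp [fl, PM.W]; rfl
    · refine Cnt.one ⟨0,0,1,0,0,0,0,0,0,0⟩ ?_ ?_
      · refine ⟨⟨⟨by simp [J111], by simp [Q1_iff]⟩, fun v w hv hw => ?_⟩, fun h => ?_⟩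
        · simp [fl, hv, hw]
        · simpa [fl] using h (1,0,0,0) (0,1,0,0)
      · rintro c ⟨⟨⟨-, h1⟩, h2⟩, h3⟩
        rw [Q1_iff] at h1
        obtain ⟨q1, q2, q3, q4⟩ := h1
        have q5 := h2 (0,1,0,0) (0,0,1,0) rfl rfl
        have q6 := h2 (0,1,0,0) (0,0,0,1) rfl rfl
        have q7 := h2 (0,0,1,0) (0,0,0,1) rfl rfl
        simp [fl, q4] at q5 q6 q7
        by_cases r1 : c.z01 = 0
        · by_cases r2 : c.z02 = 0
          · have r3 : c.z03 ≠ 0 := fun r3 => h3 fun v w => by simp [fl, *]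
            refine R111_of ⟨1,0,0,0, 0,0,c.z03⁻¹, 1,0,0, 0,1,0, 0,0,0⟩
              one_ne_zero (by simp [PM.det, r3]) ?_ ?_ ?_ ?_ ?_ ?_ <;> ext <;> simp [fl, PM.N, PM.W, *]
          · refine R111_of ⟨1,0,0,0, 0,c.z02⁻¹,0, 1,0,0, 0,-c.z03,c.z02, 0,0,0⟩
              one_ne_zero (by simp [PM.det, r2]) ?_ ?_ ?_ ?_ ?_ ?_ <;> ext <;> simp [fl, PM.N, PM.W, *] <;> ring
        · refine R111_of ⟨1,0,0,0, c.z01⁻¹,0,0, -c.z02,c.z01,0, -c.z03,0,c.z01, 0,0,0⟩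
              one_ne_zero (by simp [PM.det, r1]) ?_ ?_ ?_ ?_ ?_ ?_ <;> ext <;> simp [fl, PM.N, PM.W, *] <;> ring
    · exact fun c c' h h' hh => cM0_pf c c' h.1.2 h'.1.2 hh
    · refine Cnt.one ⟨0,0,0,0,0,0,0,1,0,0⟩ ?_ ?_
      · refine ⟨⟨⟨by simp [J111], by simp [Q1_iff]⟩, fun h => ?_⟩, by simp [FC.pf]⟩
        simpa [fl] using h (0,1,0,0) (0,0,1,0)
      · rintro c ⟨h1, h2⟩
        have := cM0_cov c h1 1 one_ne_zero
        rwa [h2, mul_zero] at this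
    · refine Cnt.one ⟨0,0,0,0,0,1,0,1,0,0⟩ ?_ ?_
      · refine ⟨⟨⟨by simp [J111], by simp [Q1_iff]⟩, fun h => ?_⟩, by simp [FC.pf]⟩
        simpa [fl] using h (0,1,0,0) (0,0,1,0)
      · rintro c ⟨h1, h2⟩
        have := cM0_cov c h1 c.pf⁻¹ (inv_ne_zero h2)
        rwa [inv_mul_cancel₀ h2] at this
  exact this

lemma c111 (h5 : 5 ≤ p) : Cnt (R111 (K := 𝕂)) J111 (23 + Nat.gcd (p - 1) 4 + 2 * Nat.gcd (p - 1) 3) := by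
  have := Cnt.split Q1 (R111.inv (fun c d h => Q1.inv h) _ fun c h => h) cM0
    (Cnt.split Q2 (R111.inv (fun c d h => Q2.inv h) _ fun c h => h.1)
      (Cnt.split Q3 (R111.inv (fun c d h => Q3.inv h) _ fun c h => h.1.1) (cM1a h5) cM1b)
      (Cnt.split Q3 (R111.inv (fun c d h => Q3.inv h) _ fun c h => h.1.1) (cM2a h5) cM2b))
  rwa [show 23 + Nat.gcd (p - 1) 4 + 2 * Nat.gcd (p - 1) 3 = 4 + (9 + 4 + (4 + Nat.gcd (p - 1) 4 + (2 + 2 * Nat.gcd (p - 1) 3))) by omega]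
end cnt

structure IC where
  (a β c a1 b1 a2 b2 : ℤ)
structure IP where
  (u k l v m q t h g : ℤ)

section t21
variable (p f : ℕ)
def F21 (c : IC) (v w : ℤ × ℤ × ℤ) : ℤ × ℤ × ℤ :=
  ((p:ℤ)^(f+2) * c.a * (v.1*w.2.1 - v.2.1*w.1) + (p:ℤ)^(f+3) * (c.a1 * (v.1*w.2.2 - v.2.2*w.1) + c.a2 * (v.2.1*w.2.2 - v.2.2*w.2.1)),
   p * (c.β * (v.1*w.2.1 - v.2.1*w.1) + c.b1 * (v.1*w.2.2 - v.2.2*w.1) + c.b2 * (v.2.1*w.2.2 - v.2.2*w.2.1)),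
   c.c * (v.1*w.2.1 - v.2.1*w.1))
def IP.T (P : IP) : (ℤ × ℤ × ℤ) →+ (ℤ × ℤ × ℤ) :=
  lin3 (P.u, P.k, P.l) ((p:ℤ)^(f+2) * P.q, P.v, P.m) ((p:ℤ)^(f+3) * P.g, p * P.h, P.t)
def C21 (P : IP) (c c' : IC) : Prop :=
  ((p:ℤ)^2 ∣ (c'.a * P.u + p * (c'.β * P.q + c'.c * P.g)) - (P.u * P.v * c.a + p * (P.u * P.m * c.a1 + (P.k * P.m - P.l * P.v) * c.a2)) ∧
  (p:ℤ) ∣ (c'.β * P.v + c'.c * P.h) - (P.u * P.v * c.β + P.u * P.m * c.b1 + (P.k * P.m - P.l * P.v) * c.b2) ∧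
  (p:ℤ) ∣ c'.c * P.t - P.u * P.v * c.c) ∧
  ((p:ℤ) ∣ (c'.a1 * P.u + c'.b1 * P.q) - (c.a * P.u * P.h + P.u * P.t * c.a1 + P.k * P.t * c.a2) ∧
  (p:ℤ) ∣ c'.b1 * P.v - (P.u * P.t * c.b1 + P.k * P.t * c.b2)) ∧
  ((p:ℤ) ∣ (c'.a2 * P.u + c'.b2 * P.q) - P.v * P.t * c.a2 ∧
  (p:ℤ) ∣ c'.b2 * P.v - P.v * P.t * c.b2)
def R21 (c c' : IC) : Prop := ∃ P : IP, ¬ (p:ℤ) ∣ P.u ∧ ¬ (p:ℤ) ∣ P.v ∧ ¬ (p:ℤ) ∣ P.t ∧ C21 p P c c'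
def J21 (c : IC) : Prop := (p:ℤ) ∣ c.a * c.b2

variable {p f}
lemma IP.T_apply (P : IP) (v) : P.T p f v = (v.1 * P.u + v.2.1 * ((p:ℤ)^(f+2) * P.q) + v.2.2 * ((p:ℤ)^(f+3) * P.g),
    v.1 * P.k + v.2.1 * P.v + v.2.2 * (p * P.h), v.1 * P.l + v.2.1 * P.m + v.2.2 * P.t) := by
  rw [IP.T, lin3_apply]; ext <;> simp <;> ring

lemma lat21_sub (e : ℕ) : ∃ Λ : AddSubgroup (ℤ × ℤ × ℤ), ∀ v, v ∈ Λ ↔ Lat21 p e v :=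
  ⟨{ carrier := {v | Lat21 p e v}
     add_mem' := fun {a b} ha hb => ⟨dvd_add ha.1 hb.1, dvd_add ha.2.1 hb.2.1, dvd_add ha.2.2 hb.2.2⟩
     zero_mem' := ⟨dvd_zero _, dvd_zero _, dvd_zero _⟩
     neg_mem' := fun {a} ha => ⟨(dvd_neg).2 ha.1, (dvd_neg).2 ha.2.1, (dvd_neg).2 ha.2.2⟩ }, fun v => Iff.rfl⟩

lemma dvs {p X Y : ℤ} (t : ℤ) (h : X = Y + p * t) : p ∣ X ↔ p ∣ Y :=
  dvd_iff_dvd_of_dvd_sub ⟨t, by rw [h]; ring⟩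

lemma dvm {p X Y : ℤ} (s : ℤ) (hs : s ≠ 0) (t : ℤ) (h : X = s * Y + s * p * t) : s * p ∣ X ↔ p ∣ Y := by
  rw [dvs t h, mul_dvd_mul_iff_left hs]

lemma compat (hp : p ≠ 0) (P : IP) (c c' : IC) : C21 p P c c' ↔
    ∀ a b, Lat21 p (f+4) (P.T p f (F21 p f c' a b) - F21 p f c (P.T p f a) (P.T p f b)) := by
  have hp0 : (p:ℤ) ≠ 0 := by exact_mod_cast hp
  have key : (∀ a b, Lat21 p (f+4) (P.T p f (F21 p f c' a b) - F21 p f c (P.T p f a) (P.T p f b))) ↔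
      (Lat21 p (f+4) (P.T p f (F21 p f c' (1,0,0) (0,1,0)) - F21 p f c (P.T p f (1,0,0)) (P.T p f (0,1,0))) ∧
      Lat21 p (f+4) (P.T p f (F21 p f c' (1,0,0) (0,0,1)) - F21 p f c (P.T p f (1,0,0)) (P.T p f (0,0,1))) ∧
      Lat21 p (f+4) (P.T p f (F21 p f c' (0,1,0) (0,0,1)) - F21 p f c (P.T p f (0,1,0)) (P.T p f (0,0,1)))) := by
    refine ⟨fun h => ⟨h _ _, h _ _, h _ _⟩, fun ⟨h1, h2, h3⟩ a b => ?_⟩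
    obtain ⟨Λ, hΛ⟩ := lat21_sub (p := p) (f+4)
    rw [← hΛ] at *
    have := Λ.add_mem (Λ.zsmul_mem h1 (a.1*b.2.1 - a.2.1*b.1)) (Λ.add_mem (Λ.zsmul_mem h2 (a.1*b.2.2 - a.2.2*b.1))
      (Λ.zsmul_mem h3 (a.2.1*b.2.2 - a.2.2*b.2.1)))
    convert this using 1
    simp only [IP.T_apply]
    ext <;> simp [F21] <;> ring
  rw [key, C21]
  simp only [IP.T_apply, Lat21, F21, Prod.fst_sub, Prod.snd_sub]
  have e1 : (p:ℤ)^(f+4) = p^(f+2) * p^2 := by ring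
  have e2 : (p:ℤ)^(f+4) = p^(f+3) * p := by ring
  refine and_congr (and_congr ?_ (and_congr ?_ ?_)) (and_congr (Iff.trans (and_congr ?_ ?_) (and_congr_right fun _ => (and_iff_left ?_).symm)) (Iff.trans (and_congr ?_ ?_) (and_congr_right fun _ => (and_iff_left ?_).symm)))
  · rw [e1]; symm
    exact dvm (p^(f+2)) (pow_ne_zero _ hp0) (c.a * P.k * P.q * p^f + p^(f+1) * P.l * P.q * c.a1) (by ring)
  · rw [pow_two]; symm
    exact dvm (p:ℤ) hp0 (p^f * c'.a * P.k + p^f * p * (c.β * P.k * P.q + c.b1 * P.l * P.q)) (by ring)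
  · symm
    exact dvs (p^(f+1) * c'.a * P.l + c'.β * P.m + c.c * P.k * P.q * p^(f+1)) (by ring)
  · rw [e2]; symm
    exact dvm (p^(f+3)) (pow_ne_zero _ hp0) (p^(f+1) * c.a * P.k * P.g + p^(f+2) * c.a1 * P.l * P.g + c.a2 * P.l * P.h) (by ring)
  · rw [pow_two]; symm
    exact dvm (p:ℤ) hp0 (p^(f+1) * c'.a1 * P.k - c.β * (P.u * P.h - P.k * P.g * p^(f+2)) + c.b1 * P.l * P.g * p^(f+2) + c.b2 * P.l * P.h) (by ring)
  · exact ⟨p^(f+2) * c'.a1 * P.l + c'.b1 * P.m - c.c * (P.u * P.h - P.k * P.g * p^(f+2)), by ring⟩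
  · rw [e2]; symm
    exact dvm (p^(f+3)) (pow_ne_zero _ hp0) (-p^(f+1) * c.a * (P.q * P.h - P.v * P.g) - c.a1 * (p^(f+1) * P.q * P.t - p^(f+2) * P.m * P.g) + c.a2 * P.m * P.h) (by ring)
  · rw [pow_two]; symm
    exact dvm (p:ℤ) hp0 (p^(f+1) * c'.a2 * P.k - p^(f+2) * c.β * (P.q * P.h - P.v * P.g) - c.b1 * (p^(f+1) * P.q * P.t - p^(f+2) * P.m * P.g) + c.b2 * P.m * P.h) (by ring)
  · exact ⟨p^(f+2) * c'.a2 * P.l + c'.b2 * P.m - c.c * (P.q * P.h - P.v * P.g) * p^(f+2), by ring⟩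

lemma ex21 (c : IC) (hc : J21 p c) : ∃ (Λ : AddSubgroup (ℤ × ℤ × ℤ)) (s : LS ((ℤ × ℤ × ℤ) ⧸ Λ)),
    (∀ v, v ∈ Λ ↔ Lat21 p (f+4) v) ∧ Pres (Lat21 p (f+4)) (F21 p f c) ⟨_, s⟩ := by
  obtain ⟨r, hr⟩ := hc
  have l0 : Lat21 p (f+4) 0 := by simp [Lat21]
  have hz : ∀ v, v = 0 → Lat21 p (f+4) v := fun v h => by rw [h]; exact l0
  refine Pres.ex (lat21_sub _) ?_ ?_ ?_ ?_ ?_ ?_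
  · rintro ⟨a, b, d⟩ ⟨x, y, z⟩ ⟨_, _, _⟩ ⟨⟨i, rfl⟩, ⟨j, rfl⟩, ⟨k, rfl⟩⟩
    refine ⟨⟨?_, ?_, ?_⟩, ⟨?_, ?_, ?_⟩⟩ <;> simp only [F21, Prod.fst_sub, Prod.snd_sub, Prod.fst_add, Prod.snd_add]
    · exact ⟨c.a * (p^(f+2) * i * y - j * x) + c.a1 * (p^(f+3) * i * z - k * x) + c.a2 * (p * j * z - k * y), by ring⟩
    · exact ⟨c.β * (p^(f+3) * i * y - p * j * x) + c.b1 * (p^(f+3) * i * z - k * x) + c.b2 * (p * j * z - k * y), by ring⟩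
    · exact ⟨c.c * (p^(f+3) * i * y - p * j * x), by ring⟩
    · exact ⟨-(c.a * (p^(f+2) * i * y - j * x) + c.a1 * (p^(f+3) * i * z - k * x) + c.a2 * (p * j * z - k * y)), by ring⟩
    · exact ⟨-(c.β * (p^(f+3) * i * y - p * j * x) + c.b1 * (p^(f+3) * i * z - k * x) + c.b2 * (p * j * z - k * y)), by ring⟩
    · exact ⟨-(c.c * (p^(f+3) * i * y - p * j * x)), by ring⟩
  · intro a b d; apply hz; ext <;> simp [F21] <;> ring
  · intro a b d; apply hz; ext <;> simp [F21] <;> ring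
  · intro a; apply hz; ext <;> simp [F21] <;> ring_nf <;> simp
  · rintro ⟨x0, x1, x2⟩ ⟨y0, y1, y2⟩ ⟨z0, z1, z2⟩
    refine ⟨?_, ?_, ?_⟩ <;> simp only [F21, Prod.fst_sub, Prod.snd_sub]
    · refine ⟨(x0*(y1*z2-y2*z1)-x1*(y0*z2-y2*z0)+x2*(y0*z1-y1*z0)) * (c.a2 * c.β - r), ?_⟩
      linear_combination (-(x0*(y1*z2-y2*z1)-x1*(y0*z2-y2*z0)+x2*(y0*z1-y1*z0)) * p^(f+3)) * hr
    · exact ⟨(x0*(y1*z2-y2*z1)-x1*(y0*z2-y2*z0)+x2*(y0*z1-y1*z0)) * (p^(f+1) * c.a * c.b1 - p^(f+2) * c.β * c.a1), by ring⟩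
    · exact ⟨(x0*(y1*z2-y2*z1)-x1*(y0*z2-y2*z0)+x2*(y0*z1-y1*z0)) * (-c.c * c.b2 - p^(f+2) * c.c * c.a1), by ring⟩
  · intro a b d g k
    have s1 : ∃ X Y Z : ℤ, F21 p f c g k = (p^(f+2) * X, p * Y, Z) := ⟨_, _, _, by
      rw [F21, show ∀ s t : ℤ, (p:ℤ)^(f+2) * c.a * s + p^(f+3) * t = p^(f+2) * (c.a * s + p * t) by intros; ring]⟩
    obtain ⟨X, Y, Z, h1⟩ := s1
    have s2 : ∃ X Y Z : ℤ, F21 p f c d (F21 p f c g k) = (p^(f+3) * X, p * Y, p * Z) := by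
      rw [h1]
      refine ⟨c.a * (d.1 * Y - d.2.1 * p^(f+1) * X) + (c.a1 * (d.1 * Z - d.2.2 * (p^(f+2) * X)) + c.a2 * (d.2.1 * Z - d.2.2 * (p * Y))),
        c.β * (d.1 * (p * Y) - d.2.1 * (p^(f+2) * X)) + c.b1 * (d.1 * Z - d.2.2 * (p^(f+2) * X)) + c.b2 * (d.2.1 * Z - d.2.2 * (p * Y)),
        c.c * (d.1 * Y - d.2.1 * p^(f+1) * X), ?_⟩
      ext
      · simp [F21]; ring
      · simp [F21]
      · simp [F21]; ring
    obtain ⟨X2, Y2, Z2, h2⟩ := s2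
    have s3 : ∃ X Y Z : ℤ, F21 p f c b (F21 p f c d (F21 p f c g k)) = (p^(f+3) * X, p^2 * Y, p * Z) := by
      rw [h2]
      refine ⟨c.a * (b.1 * Y2 - b.2.1 * p^(f+2) * X2) + p * (c.a1 * (b.1 * Z2 - b.2.2 * (p^(f+2) * X2)) + c.a2 * (b.2.1 * Z2 - b.2.2 * Y2)),
        c.β * (b.1 * Y2 - b.2.1 * p^(f+2) * X2) + c.b1 * (b.1 * Z2 - b.2.2 * (p^(f+2) * X2)) + c.b2 * (b.2.1 * Z2 - b.2.2 * Y2),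
        c.c * (b.1 * Y2 - b.2.1 * p^(f+2) * X2), ?_⟩
      ext
      · simp [F21]; ring
      · simp [F21]; ring
      · simp [F21]; ring
    obtain ⟨X3, Y3, Z3, h3⟩ := s3
    rw [h3]
    refine ⟨?_, ?_, ?_⟩ <;> simp only [F21]
    · exact ⟨c.a * (a.1 * Y3 - a.2.1 * p^(f+1) * X3) + (c.a1 * (a.1 * Z3 - a.2.2 * (p^(f+2) * X3)) + c.a2 * (a.2.1 * Z3 - a.2.2 * p * Y3)), by ring⟩
    · exact ⟨c.β * (a.1 * p * Y3 - a.2.1 * p^(f+2) * X3) + c.b1 * (a.1 * Z3 - a.2.2 * (p^(f+2) * X3)) + c.b2 * (a.2.1 * Z3 - a.2.2 * p * Y3), by ring⟩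
    · exact ⟨c.c * (a.1 * p * Y3 - a.2.1 * p^(f+2) * X3), by ring⟩

lemma lin_T3 (T : (ℤ × ℤ × ℤ) →+ (ℤ × ℤ × ℤ)) (v) :
    T v = lin3 (T (1,0,0)) (T (0,1,0)) (T (0,0,1)) v := by
  rw [lin3_apply, ← map_zsmul, ← map_zsmul, ← map_zsmul, ← map_add, ← map_add]
  congr 1
  ext <;> simp

lemma R1_21 (hp : p.Prime) {c c' : IC} {L : LR} (h : Pres (Lat21 p (f+4)) (F21 p f c) L)
    (h' : Pres (Lat21 p (f+4)) (F21 p f c') L) : R21 p c c' := by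
  obtain ⟨T, T', h1, h2, h3⟩ := h.two h'
  have hp0 : (p:ℤ) ≠ 0 := by exact_mod_cast hp.ne_zero
  have a1 := (h1 ((p:ℤ)^2 • (0,1,0))).2 (by simp [Lat21])
  have a2 := (h1 ((p:ℤ) • (0,0,1))).2 (by simp [Lat21])
  rw [map_zsmul] at a1 a2
  have e1 : (p:ℤ)^(f+2) ∣ (T (0,1,0)).1 := by
    have := a1.1
    rw [show (p:ℤ)^(f+4) = p^2 * p^(f+2) by ring] at this
    exact (mul_dvd_mul_iff_left (pow_ne_zero 2 hp0)).1 this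
  have e2 : (p:ℤ)^(f+3) ∣ (T (0,0,1)).1 := by
    have := a2.1
    rw [show (p:ℤ)^(f+4) = p * p^(f+3) by ring] at this
    exact (mul_dvd_mul_iff_left hp0).1 this
  have e3 : (p:ℤ) ∣ (T (0,0,1)).2.1 := by
    have := a2.2.1
    rw [pow_two] at this
    exact (mul_dvd_mul_iff_left hp0).1 this
  obtain ⟨q, hq⟩ := e1
  obtain ⟨g, hg⟩ := e2
  obtain ⟨k, hk⟩ := e3
  let P : IP := ⟨(T (1,0,0)).1, (T (1,0,0)).2.1, (T (1,0,0)).2.2, (T (0,1,0)).2.1, (T (0,1,0)).2.2, q, (T (0,0,1)).2.2, k, g⟩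
  have hT : T = P.T p f := by
    ext1 v
    rw [lin_T3, IP.T]
    simp only [P, ← hq, ← hg, ← hk]
  rw [hT] at h2 h3
  have pd : ∀ v, Lat21 p (f+4) v → (p:ℤ) ∣ v.1 ∧ (p:ℤ) ∣ v.2.1 ∧ (p:ℤ) ∣ v.2.2 := fun v hv =>
    ⟨(dvd_pow_self _ (by omega)).trans hv.1, (dvd_pow_self _ (by omega)).trans hv.2.1, hv.2.2⟩
  have o1 := (pd _ (h2 (1,0,0))).1
  have o2 := pd _ (h2 (0,1,0))
  have o3 := pd _ (h2 (0,0,1))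
  simp only [IP.T_apply, Prod.fst_sub, Prod.snd_sub] at o1 o2 o3
  generalize T' (1,0,0) = x at *
  generalize T' (0,1,0) = y at *
  generalize T' (0,0,1) = z at *
  have hpi : Prime (p:ℤ) := Nat.prime_iff_prime_int.1 hp
  have n1 : ¬ (p:ℤ) ∣ 1 := hpi.not_dvd_one
  have hu : ¬ (p:ℤ) ∣ P.u := by
    rintro ⟨i, hi⟩
    apply n1
    rw [dvs (i * x.1 + x.2.1 * (p^(f+1) * P.q) + x.2.2 * (p^(f+2) * P.g)) (Y := -1) (by rw [hi]; ring)] at o1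
    rwa [dvd_neg] at o1
  have y1 : (p:ℤ) ∣ y.1 := by
    have := o2.1
    rw [dvs (y.2.1 * (p^(f+1) * P.q) + y.2.2 * (p^(f+2) * P.g)) (Y := y.1 * P.u) (by ring)] at this
    exact (hpi.dvd_or_dvd this).resolve_right hu
  have z1 : (p:ℤ) ∣ z.1 := by
    have := o3.1
    rw [dvs (z.2.1 * (p^(f+1) * P.q) + z.2.2 * (p^(f+2) * P.g)) (Y := z.1 * P.u) (by ring)] at this
    exact (hpi.dvd_or_dvd this).resolve_right hu
  obtain ⟨y1, hy1⟩ := y1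
  obtain ⟨z1, hz1⟩ := z1
  have hv : ¬ (p:ℤ) ∣ P.v := by
    rintro ⟨i, hi⟩
    apply n1
    have := o2.2.1
    rw [dvs (y1 * P.k + i * y.2.1 + y.2.2 * P.h) (Y := -1) (by rw [hi, hy1]; ring)] at this
    rwa [dvd_neg] at this
  have z2 : (p:ℤ) ∣ z.2.1 := by
    have := o3.2.1
    rw [dvs (z1 * P.k + z.2.2 * P.h) (Y := z.2.1 * P.v) (by rw [hz1]; ring)] at this
    exact (hpi.dvd_or_dvd this).resolve_right hv
  obtain ⟨z2, hz2⟩ := z2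
  refine ⟨P, hu, hv, ?_, (compat hp.ne_zero P c c').2 h3⟩
  rintro ⟨i, hi⟩
  apply n1
  have := o3.2.2
  rw [dvs (z1 * P.l + z2 * P.m + z.2.2 * i) (Y := -1) (by rw [hi, hz1, hz2]; ring)] at this
  rwa [dvd_neg] at this

lemma invp (hp : p.Prime) {u : ℤ} (h : ¬ (p:ℤ) ∣ u) (k : ℕ) : ∃ s t : ℤ, u * s = 1 + p ^ k * t := by
  have hc : IsCoprime ((p:ℤ)^k) u := IsCoprime.pow_left ((Int.prime_iff_natAbs_prime.2 (by simpa using hp)).coprime_iff_not_dvd.2 h)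
  obtain ⟨a, b, hab⟩ := hc
  exact ⟨b, -a, by linear_combination hab⟩

lemma R2_21 (hp : p.Prime) {c c' : IC} {L : LR} [Finite L.A] (hL : ∀ a : L.A, (p ^ (f+4) : ℕ) • a = 0)
    (h : Pres (Lat21 p (f+4)) (F21 p f c) L) (hR : R21 p c c') : Pres (Lat21 p (f+4)) (F21 p f c') L := by
  obtain ⟨P, hu, hv, ht, hC⟩ := hR
  refine h.chg (p := p) hL (P.T p f) ?_ ?_ ((compat hp.ne_zero P c c').1 hC)
  · rintro ⟨_, _, _⟩ ⟨⟨i, rfl⟩, ⟨j, rfl⟩, ⟨k, rfl⟩⟩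
    rw [IP.T_apply]
    exact ⟨⟨i * P.u + j * P.q + k * P.g, by ring⟩, ⟨p^(f+2) * i * P.k + j * P.v + k * P.h, by ring⟩,
      ⟨p^(f+3) * i * P.l + p * j * P.m + k * P.t, by ring⟩⟩
  · rintro ⟨x, y, z⟩
    obtain ⟨u, u', hu⟩ := invp hp hu 1
    obtain ⟨v, v', hv⟩ := invp hp hv 1
    obtain ⟨t, t', ht⟩ := invp hp ht 1
    rw [pow_one] at hu hv ht
    refine ⟨(x * u, (y - x * u * P.k) * v, (z - x * u * P.l - (y - x * u * P.k) * v * P.m) * t),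
      (x * u' + (y - x * u * P.k) * v * (p^(f+1) * P.q) + (z - x * u * P.l - (y - x * u * P.k) * v * P.m) * t * p^(f+2) * P.g,
       (y - x * u * P.k) * v' + (z - x * u * P.l - (y - x * u * P.k) * v * P.m) * t * P.h,
       (z - x * u * P.l - (y - x * u * P.k) * v * P.m) * t'), ?_⟩
    rw [IP.T_apply]
    ext
    · simp; linear_combination x * hu
    · simp; linear_combination (y - x * u * P.k) * hv
    · simp; linear_combination (z - x * u * P.l - (y - x * u * P.k) * v * P.m) * ht
end t21

section s21
variable {p f : ℕ}

lemma nil4 (hp : p.Prime) {A : Type} [AddCommGroup A] (s : LS A) (z w : A) (C : ℤ) (Q : ℤ → A → Prop)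
    (h1 : Q 1 w) (hs : ∀ k a, Q k a → Q (k * C) (s.br z a)) (h0 : ∀ k, Q k 0 → (p:ℤ) ∣ k) : (p:ℤ) ∣ C := by
  have := hs _ _ (hs _ _ (hs _ _ (hs _ _ h1)))
  rw [s.nil] at this
  have := h0 _ this
  rw [show 1 * C * C * C * C = C ^ 4 by ring] at this
  exact (Nat.prime_iff_prime_int.1 hp).dvd_of_dvd_pow this

lemma cyc12 {L : LR} (h : cyc p 1 L) : cyc p 2 L := by
  obtain ⟨x, hx⟩ := h
  refine ⟨x, fun a => ?_⟩
  obtain ⟨i, hi⟩ := hx a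
  exact ⟨i, by rw [pow_two, mul_smul]; rw [pow_one] at hi; rw [hi, smul_zero]⟩

lemma ncyc (hp : p.Prime) {Z : Type} [AddCommGroup Z] {A : Type} [AddCommGroup A] (q : Z →+ A) {k : ℕ} (x : A) (u v : Z)
    (φ ψ : Z →+ ℤ) (h : ∀ w : Z, (p ^ k : ℕ) • q w = 0 → (p:ℤ) ∣ φ w ∧ (p:ℤ) ∣ ψ w)
    (hu : φ u = 1 ∧ ψ u = 0) (hv : φ v = 0 ∧ ψ v = 1) (hq : Function.Surjective q)
    (hx : ∀ a, ∃ i : ℤ, (p ^ k : ℕ) • (a - i • x) = 0) : False := by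
  obtain ⟨w, rfl⟩ := hq x
  have n1 : ¬ (p:ℤ) ∣ 1 := (Nat.prime_iff_prime_int.1 hp).not_dvd_one
  obtain ⟨i, hi⟩ := hx (q u)
  obtain ⟨j, hj⟩ := hx (q v)
  rw [← map_zsmul, ← map_sub] at hi hj
  have := h _ hi
  have h2 := h _ hj
  simp only [map_sub, map_zsmul, hu, hv, smul_eq_mul] at this h2
  obtain ⟨⟨a, ha⟩, ⟨b, hb⟩⟩ := this
  obtain ⟨⟨c, hc⟩, ⟨d, hd⟩⟩ := h2
  apply n1
  exact ⟨a + d - p * a * d + p * b * c, by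
    linear_combination ha * (1 - p * d) + (i * φ w) * hd - (i * ψ w) * hc + hb * (p * c)⟩

lemma pres3_ncyc {e : ℕ} (hp : p.Prime) (he : 3 ≤ e) {A : Type} [AddCommGroup A] {q : ℤ × ℤ →+ A} (q1 : Function.Surjective q)
    (q2 : ∀ v, q v = 0 ↔ Lat3 p e v) (x : A) : ¬ ∀ a, ∃ i : ℤ, (p ^ 2 : ℕ) • (a - i • x) = 0 := by
  have hp0 : (p:ℤ) ≠ 0 := by exact_mod_cast hp.ne_zero
  refine ncyc hp q x (1,0) (0,1) (AddMonoidHom.fst ℤ ℤ) (AddMonoidHom.snd ℤ ℤ) (fun w hw => ?_) (by simp) (by simp) q1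
  rw [← map_nsmul, q2] at hw
  obtain ⟨a, b⟩ := hw
  simp only [Prod.smul_fst, Prod.smul_snd, nsmul_eq_mul, Nat.cast_pow] at a b
  have a := (pow_dvd_pow (p:ℤ) he).trans a
  rw [pow_succ] at a b
  exact ⟨(mul_dvd_mul_iff_left (pow_ne_zero 2 hp0)).1 a, (mul_dvd_mul_iff_left (pow_ne_zero 2 hp0)).1 b⟩

lemma pres21_ncyc {e : ℕ} (hp : p.Prime) (he : 3 ≤ e) {A : Type} [AddCommGroup A] {q : ℤ × ℤ × ℤ →+ A} (q1 : Function.Surjective q)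
    (q2 : ∀ v, q v = 0 ↔ Lat21 p e v) (x : A) : ¬ ∀ a, ∃ i : ℤ, (p ^ 1 : ℕ) • (a - i • x) = 0 := by
  have hp0 : (p:ℤ) ≠ 0 := by exact_mod_cast hp.ne_zero
  refine ncyc hp q x (1,0,0) (0,1,0) (AddMonoidHom.fst ℤ _) ((AddMonoidHom.fst ℤ ℤ).comp (AddMonoidHom.snd ℤ _)) (fun w hw => ?_) (by simp) (by simp) q1
  rw [← map_nsmul, q2] at hw
  obtain ⟨a, b, -⟩ := hw
  simp only [Prod.smul_fst, Prod.smul_snd, nsmul_eq_mul, Nat.cast_pow] at a b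
  have a := (pow_dvd_pow (p:ℤ) (show 2 ≤ e by omega)).trans a
  rw [pow_succ] at a b
  simp only [pow_one] at a b
  exact ⟨(mul_dvd_mul_iff_left hp0).1 a, (mul_dvd_mul_iff_left hp0).1 b⟩

lemma cov21 (hp : p.Prime) {L : LR} (hT : TT p (f+4) L) (n1 : ¬ cyc p 1 L) (hc2 : cyc p 2 L) :
    ∃ c, J21 p c ∧ Pres (Lat21 p (f+4)) (F21 p f c) L := by
  have := hT.fin hp
  obtain ⟨A, s⟩ := L
  obtain ⟨hcard, hexp, x, hx0⟩ := hT
  have hp0 : (p:ℤ) ≠ 0 := by exact_mod_cast hp.ne_zero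
  have hpi : Prime (p:ℤ) := Nat.prime_iff_prime_int.1 hp
  rcases types hp hcard hexp x hx0 with ⟨y, hy⟩ | ⟨y, w, ker⟩ | h
  · exfalso
    obtain ⟨x', hx'⟩ := hc2
    exact pres3_ncyc hp (by omega) (ker_surj (by rw [card3 _ hy]; exact hcard.symm)) hy x' hx'
  swap
  · exfalso; exact n1 ⟨x, by simpa using h⟩
  simp only at x y w ker hexp
  have surj : Function.Surjective (lin3 x y w) := ker_surj (by rw [card21 _ ker]; exact hcard.symm)
  have ker' : ∀ i j k : ℤ, i • x + (j • y + k • w) = 0 ↔ (p:ℤ)^(f+4) ∣ i ∧ (p:ℤ)^2 ∣ j ∧ (p:ℤ) ∣ k := fun i j k => by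
    have := ker (i,j,k); rwa [lin3_apply] at this
  have ker1 : ∀ i j k : ℤ, i • x + (j • y + k • w) = 0 → (p:ℤ) ∣ i ∧ (p:ℤ) ∣ j ∧ (p:ℤ) ∣ k := fun i j k h => by
    obtain ⟨h1, h2, h3⟩ := (ker' i j k).1 h
    exact ⟨(dvd_pow_self _ (by omega)).trans h1, (dvd_pow_self _ (by omega)).trans h2, h3⟩
  have ex : ∀ a, ∃ i j k : ℤ, a = i • x + (j • y + k • w) := fun a => by
    obtain ⟨v, rfl⟩ := surj a; exact ⟨_, _, _, lin3_apply _ _ _ _⟩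
  obtain ⟨A0, B0, C0, h0⟩ := ex (s.br x y)
  obtain ⟨A1, B1, C1, h1⟩ := ex (s.br x w)
  obtain ⟨A2, B2, C2, h2⟩ := ex (s.br y w)
  have xe : ∀ i : ℤ, ((p:ℤ)^(f+4) * i) • x = 0 := fun i => by
    simpa using (ker' ((p:ℤ)^(f+4) * i) 0 0).2 (by simp)
  have ye : ∀ i : ℤ, ((p:ℤ)^2 * i) • y = 0 := fun i => by
    simpa using (ker' 0 ((p:ℤ)^2 * i) 0).2 (by simp)
  have we : ∀ i : ℤ, ((p:ℤ) * i) • w = 0 := fun i => by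
    simpa using (ker' 0 0 ((p:ℤ) * i)).2 (by simp)
  have b0 : ∀ i : ℤ, ((p:ℤ)^2 * i) • s.br x y = 0 := fun i => by rw [← s.zsmul_r, ye, s.zero_r]
  have b1 : ∀ i : ℤ, ((p:ℤ) * i) • s.br x w = 0 := fun i => by rw [← s.zsmul_r, we, s.zero_r]
  have b2 : ∀ i : ℤ, ((p:ℤ) * i) • s.br y w = 0 := fun i => by rw [← s.zsmul_r, we, s.zero_r]
  obtain ⟨a, rfl⟩ : (p:ℤ)^(f+2) ∣ A0 := by
    have := b0 1
    rw [h0, smul_add, smul_add, ← mul_smul, ← mul_smul, ← mul_smul, ker'] at this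
    have := this.1
    rw [show (p:ℤ)^(f+4) = p^2 * p^(f+2) by ring, mul_one] at this
    exact (mul_dvd_mul_iff_left (pow_ne_zero 2 hp0)).1 this
  have aux : ∀ i j k : ℤ, (p * 1 : ℤ) • (i • x + (j • y + k • w)) = 0 → (p:ℤ)^(f+3) ∣ i ∧ (p:ℤ) ∣ j := by
    intro i j k this
    rw [smul_add, smul_add, ← mul_smul, ← mul_smul, ← mul_smul, ker'] at this
    obtain ⟨t1, t2, -⟩ := this
    rw [show (p:ℤ)^(f+4) = p * p^(f+3) by ring, mul_one] at t1
    rw [mul_one, pow_two] at t2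
    exact ⟨(mul_dvd_mul_iff_left hp0).1 t1, (mul_dvd_mul_iff_left hp0).1 t2⟩
  obtain ⟨⟨a1, rfl⟩, ⟨b1', rfl⟩⟩ := aux A1 B1 C1 (by rw [← h1]; exact b1 1)
  obtain ⟨⟨a2, rfl⟩, ⟨b2', rfl⟩⟩ := aux A2 B2 C2 (by rw [← h2]; exact b2 1)
  have sk : s.br y x = - s.br x y := s.skew _ _
  obtain ⟨β, rfl⟩ : (p:ℤ) ∣ B0 := by
    refine nil4 hp s x y B0 (fun k a => ∃ i j l : ℤ, a = i • x + ((k + p * j) • y + l • w)) ⟨0, 0, 0, by simp⟩ ?_ ?_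
    · rintro k _ ⟨i, j, l, rfl⟩
      refine ⟨(k + p * j) * (p^(f+2) * a) + l * (p^(f+3) * a1), j * B0 + l * b1', (k + p * j) * C0 + l * C1, ?_⟩
      simp only [s.add_r, s.zsmul_r, s.self, h0, h1]; module
    · rintro k ⟨i, j, l, h⟩
      have := (ker1 _ _ _ h.symm).2.1
      rwa [dvs j rfl] at this
  obtain ⟨c1, rfl⟩ : (p:ℤ) ∣ C1 := by
    refine nil4 hp s x w C1 (fun k a => ∃ i j l : ℤ, a = i • x + ((p * j) • y + (k + p * l) • w)) ⟨0, 0, 0, by simp⟩ ?_ ?_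
    · rintro k _ ⟨i, j, l, rfl⟩
      refine ⟨(p * j) * (p^(f+2) * a) + (k + p * l) * (p^(f+3) * a1), p * j * β + (k + p * l) * b1', j * C0 + l * C1, ?_⟩
      simp only [s.add_r, s.zsmul_r, s.self, h0, h1]; module
    · rintro k ⟨i, j, l, h⟩
      have := (ker1 _ _ _ h.symm).2.2
      rwa [dvs l rfl] at this
  obtain ⟨c2, rfl⟩ : (p:ℤ) ∣ C2 := by
    refine nil4 hp s y w C2 (fun k a => ∃ i j l : ℤ, a = (p * i) • x + ((p * j) • y + (k + p * l) • w)) ⟨0, 0, 0, by simp⟩ ?_ ?_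
    · rintro k _ ⟨i, j, l, rfl⟩
      refine ⟨- i * (p^(f+2) * a) + (k + p * l) * (p^(f+2) * a2), - i * (p * β) + (k + p * l) * b2', - i * C0 + l * C2, ?_⟩
      simp only [s.add_r, s.zsmul_r, s.self, sk, h0, h2]; module
    · rintro k ⟨i, j, l, h⟩
      have := (ker1 _ _ _ h.symm).2.2
      rwa [dvs l rfl] at this
  rw [we, add_zero] at h1 h2
  refine ⟨⟨a, β, C0, a1, b1', a2, b2'⟩, ?_, lin3 x y w, surj, ker, ?_⟩
  · have := s.jac x y w
    have e1 : s.br (s.br x y) w = 0 := by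
      rw [h0, s.add_l, s.add_l, s.zsmul_l, s.zsmul_l, s.zsmul_l, s.self, smul_zero, b2,
        show (p:ℤ)^(f+2) * a = p * (p^(f+1) * a) by ring, b1]; simp
    have e2 : s.br x (s.br y w) = (p^(f+3) * (a * b2') : ℤ) • x := by
      rw [h2, s.add_r, s.zsmul_r, s.zsmul_r, s.self, h0, smul_add, smul_add, ← mul_smul, ← mul_smul, ← mul_smul,
        show (p:ℤ) * b2' * (p * β) = p^2 * (b2' * β) by ring, ye, mul_assoc (p:ℤ) b2' C0, we, smul_zero, add_zero, add_zero, zero_add]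
      congr 1; ring
    have e3 : s.br y (s.br x w) = 0 := by
      rw [h1, s.add_r, s.zsmul_r, s.zsmul_r, s.self, sk, smul_neg, show (p:ℤ)^(f+3) * a1 = p^2 * (p^(f+1) * a1) by ring, b0]
      simp
    rw [e1, e2, e3, sub_zero] at this
    have := ((ker' (p^(f+3) * (a * b2')) 0 0).1 (by rw [← this]; simp)).1
    rw [pow_succ] at this
    exact (mul_dvd_mul_iff_left (pow_ne_zero _ hp0)).1 this
  · rintro ⟨v0, v1, v2⟩ ⟨w0, w1, w2⟩
    simp only [F21, lin3_apply]
    simp only [s.add_l, s.add_r, s.zsmul_l, s.zsmul_r, s.self, sk, s.skew w x, s.skew w y, h0, h1, h2]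
    module

lemma pres_TT21 (hp : p.Prime) {L : LR} {F} (h : Pres (Lat21 p (f+4)) F L) : TT p (f+4) L ∧ ¬ cyc p 1 L ∧ cyc p 2 L := by
  obtain ⟨q, q1, q2, -⟩ := h
  refine ⟨⟨?_, fun a => ?_, q (1,0,0), ?_⟩, fun ⟨x, hx⟩ => pres21_ncyc hp (by omega) q1 q2 x hx, q (1,0,0), fun a => ?_⟩
  · rw [← card21 q q2, AddMonoidHom.range_eq_top.2 q1, AddSubgroup.card_top]
  · obtain ⟨v, rfl⟩ := q1 a
    rw [← map_nsmul, q2]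
    have h1 : ∀ t : ℤ, (p:ℤ) ∣ p ^ (f+4) * t := fun t => (dvd_pow_self (p:ℤ) (by omega)).mul_right t
    have h2 : ∀ t : ℤ, (p:ℤ)^2 ∣ p ^ (f+4) * t := fun t => (pow_dvd_pow (p:ℤ) (by omega)).mul_right t
    simp [Lat21, h1, h2]
  · rw [← map_nsmul, Ne, q2]
    simp only [Lat21]
    intro h
    have := h.1
    simp at this
    have h2 := Int.le_of_dvd (by have := hp.pos; positivity) this
    have h3 : p ^ (f+3) < p ^ (f+4) := pow_lt_pow_right₀ hp.one_lt (by omega)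
    exact absurd h2 (not_le.2 (by exact_mod_cast h3))
  · obtain ⟨v, rfl⟩ := q1 a
    refine ⟨v.1, ?_⟩
    rw [← map_zsmul, ← map_sub, ← map_nsmul, q2]
    have h1 : ∀ t : ℤ, (p:ℤ) ∣ p ^ 2 * t := fun t => (dvd_pow_self (p:ℤ) (by omega)).mul_right t
    simp [Lat21, h1]

lemma R21.rel (hp : p.Prime) {c c' : IC} (hc : J21 p c) : R21 p c c' ↔
    ∃ L, TT p 4 L ∧ Pres (Lat21 p 4) (F21 p 0 c) L ∧ Pres (Lat21 p 4) (F21 p 0 c') L := by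
  constructor
  · intro h
    obtain ⟨Λ, s, -, hP⟩ := ex21 (f := 0) c hc
    have hT := (pres_TT21 hp hP).1
    have := hT.fin hp
    exact ⟨_, hT, hP, R2_21 hp hT.2.1 hP h⟩
  · rintro ⟨L, -, h1, h2⟩
    exact R1_21 (f := 0) hp h1 h2

lemma R21.symm (hp : p.Prime) {c c' : IC} (hc : J21 p c) (h : R21 p c c') : R21 p c' c := by
  obtain ⟨L, -, h1, h2⟩ := (R21.rel hp hc).1 h
  exact R1_21 (f := 0) hp h2 h1

lemma R21.trans (hp : p.Prime) {c c' c'' : IC} (hc : J21 p c) (h : R21 p c c') (h' : R21 p c' c'') : R21 p c c'' := by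
  obtain ⟨L, hT, h1, h2⟩ := (R21.rel hp hc).1 h
  have := hT.fin hp
  exact R1_21 (f := 0) hp h1 (R2_21 (f := 0) hp hT.2.1 h2 h')

lemma cnt21 (hp : p.Prime) {N : ℕ} (h : Cnt (R21 p) (J21 p) N) :
    Cnt LIso (fun L => (TT p (f+4) L ∧ ¬ cyc p 1 L) ∧ cyc p 2 L) N := by
  refine h.bridge (fun L c => TT p (f+4) L ∧ Pres (Lat21 p (f+4)) (F21 p f c) L) ?_ ?_ ?_ ?_ ?_ ?_
  · intro c hc
    obtain ⟨Λ, s, -, hP⟩ := ex21 (f := f) c hc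
    obtain ⟨a, b, c⟩ := pres_TT21 hp hP
    exact ⟨_, ⟨⟨a, b⟩, c⟩, a, hP⟩
  · rintro L ⟨⟨h1, h2⟩, h3⟩
    obtain ⟨c, hc, hP⟩ := cov21 hp h1 h2 h3
    exact ⟨c, hc, h1, hP⟩
  · exact fun L L' c h h' => h.2.iso h'.2
  · exact fun L L' c h h' => ⟨h'.1.iso h.symm, h'.2.tr h⟩
  · exact fun L c c' h h' => R1_21 hp h.2 h'.2
  · intro L c c' h h'
    have := h.1.fin hp
    exact ⟨h.1, R2_21 hp h.1.2.1 h.2 h'⟩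
end s21

section k21
variable {p : ℕ} [Fact p.Prime]
local notation "𝕂" => ZMod p

lemma Cnt.two {C : Type*} {R : C → C → Prop} {P : C → Prop} (c₀ c₁ : C) (h0 : P c₀) (h1 : P c₁) (n1 : ¬ R c₀ c₁) (n2 : ¬ R c₁ c₀)
    (h : ∀ c, P c → R c c₀ ∨ R c c₁) : Cnt R P 2 := by
  refine ⟨Bool, inferInstance, fun b => if b then c₁ else c₀, by simp, fun b => by cases b <;> simpa, fun c hc => ?_, fun i j hij => ?_⟩
  · rcases h c hc with h | h
    · exact ⟨false, by simpa⟩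
    · exact ⟨true, by simpa⟩
  · revert hij; cases i <;> cases j <;> simp [n1, n2]

lemma gcd2 (h5 : 5 ≤ p) : Nat.gcd (p - 1) 2 = 2 := by
  rw [Nat.gcd_eq_right]
  have h2 := (Fact.out : p.Prime).eq_two_or_odd
  omega

lemma Cnt.sqsq {C : Type*} {R : C → C → Prop} {P : C → Prop} (h5 : 5 ≤ p) (t : 𝕂 → 𝕂 → C) (h0 : ∀ s r, s ≠ 0 → r ≠ 0 → P (t s r))
    (cov : ∀ c, P c → ∃ s r, s ≠ 0 ∧ r ≠ 0 ∧ ∀ a b, a ≠ 0 → b ≠ 0 → R c (t (a ^ 2 * s) (b ^ 2 * r)))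
    (inj : ∀ s r s' r', R (t s r) (t s' r') → ∃ a b, a ≠ 0 ∧ b ≠ 0 ∧ s' = a ^ 2 * s ∧ r' = b ^ 2 * r) : Cnt R P (2 * 2) := by
  obtain ⟨I, hI, r, hc, r0, r1, r2⟩ := powreps (p := p) 2
  rw [gcd2 h5] at hc
  refine ⟨I × I, inferInstance, fun i => t (r i.1) (r i.2), by rw [Nat.card_prod, hc], fun i => h0 _ _ (r0 _) (r0 _), fun c h => ?_, fun i j hij => ?_⟩
  · obtain ⟨s, z, hs, hz, h1⟩ := cov c h
    obtain ⟨i, a, ha, h2⟩ := r1 s hs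
    obtain ⟨j, b, hb, h3⟩ := r1 z hz
    exact ⟨(i, j), by simp only [h2, h3]; exact h1 a b ha hb⟩
  · obtain ⟨a, b, ha, hb, h1, h2⟩ := inj _ _ _ _ hij
    exact Prod.ext (r2 _ _ a ha h1).symm (r2 _ _ b hb h2).symm

lemma Cnt.sqall {C : Type*} {R : C → C → Prop} {P : C → Prop} (h5 : 5 ≤ p) (t : 𝕂 → 𝕂 → C) (h0 : ∀ s r, s ≠ 0 → P (t s r))
    (cov : ∀ c, P c → ∃ s r, s ≠ 0 ∧ ∀ a, a ≠ 0 → R c (t (a ^ 2 * s) r))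
    (inj : ∀ s r s' r', R (t s r) (t s' r') → r = r' ∧ ∃ a, a ≠ 0 ∧ s' = a ^ 2 * s) : Cnt R P (2 * p) := by
  obtain ⟨I, hI, r, hc, r0, r1, r2⟩ := powreps (p := p) 2
  rw [gcd2 h5] at hc
  refine ⟨I × 𝕂, inferInstance, fun i => t (r i.1) i.2, by rw [Nat.card_prod, hc, Nat.card_zmod], fun i => h0 _ _ (r0 _), fun c h => ?_, fun i j hij => ?_⟩
  · obtain ⟨s, z, hs, h1⟩ := cov c h
    obtain ⟨i, a, ha, h2⟩ := r1 s hs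
    exact ⟨(i, z), by simp only [h2]; exact h1 a ha⟩
  · obtain ⟨h2, a, ha, h1⟩ := inj _ _ _ _ hij
    exact Prod.ext (r2 _ _ a ha h1).symm h2

structure KC (K : Type) where
  (al be c a1 b1 a2 b2 : K)

def RI (d d' : KC 𝕂) : Prop := ∃ u k l v m q t h g : 𝕂, (u ≠ 0 ∧ v ≠ 0 ∧ t ≠ 0) ∧
  d'.al * u + d'.be * q + d'.c * g = u * v * d.al + u * m * d.a1 + (k * m - l * v) * d.a2 ∧
  d'.be * v + d'.c * h = u * v * d.be + u * m * d.b1 + (k * m - l * v) * d.b2 ∧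
  d'.c * t = u * v * d.c ∧
  d'.a1 * u + d'.b1 * q = u * t * d.a1 + k * t * d.a2 ∧
  d'.b1 * v = u * t * d.b1 + k * t * d.b2 ∧
  d'.a2 * u + d'.b2 * q = v * t * d.a2 ∧
  d'.b2 = t * d.b2

lemma z0 {K : Type} [Field K] {x x' w r : K} (hw : w ≠ 0) (hr : r ≠ 0) (h : x' * w = r * x) : x = 0 ↔ x' = 0 := by
  constructor
  · rintro rfl; rw [mul_zero] at h; exact (mul_eq_zero.1 h).resolve_right hw
  · rintro rfl; rw [zero_mul] at h; exact (mul_eq_zero.1 h.symm).resolve_left hr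

lemma RI_of {d d' : KC 𝕂} (u k l v m q t h g : 𝕂) (h0 : u ≠ 0 ∧ v ≠ 0 ∧ t ≠ 0)
  (h1 : d'.al * u + d'.be * q + d'.c * g = u * v * d.al + u * m * d.a1 + (k * m - l * v) * d.a2)
  (h2 : d'.be * v + d'.c * h = u * v * d.be + u * m * d.b1 + (k * m - l * v) * d.b2)
  (h3 : d'.c * t = u * v * d.c)
  (h4 : d'.a1 * u + d'.b1 * q = u * t * d.a1 + k * t * d.a2)
  (h5 : d'.b1 * v = u * t * d.b1 + k * t * d.b2)
  (h6 : d'.a2 * u + d'.b2 * q = v * t * d.a2)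
  (h7 : d'.b2 = t * d.b2) : RI d d' := ⟨u, k, l, v, m, q, t, h, g, h0, h1, h2, h3, h4, h5, h6, h7⟩

lemma cI1 : Cnt (RI (p := p)) (fun d => (True ∧ d.c = 0) ∧ ¬ d.b2 = 0) (2 + (p - 1)) := by
  refine Cnt.split (fun d => d.a1 * d.b2 - d.a2 * d.b1 = 0) ?_ ?_ ?_
  · rintro c d hc hd ⟨u, k, l, v, m, q, t, h, g, ⟨hu, hv, ht⟩, e1, e2, e3, e4, e5, e6, e7⟩; simp at hc hd; 
    refine z0 (w := u * v) (r := u * v * t ^ 2) (by simp [*]) (by simp [*]) ?_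
    linear_combination d.b2 * v * e4 - d.b1 * v * e6 - v * t * c.a2 * e5 + (u * t * v * c.a1 + k * t * v * c.a2) * e7
  · refine Cnt.two ⟨0,0,0,0,0,0,1⟩ ⟨1,0,0,0,0,0,1⟩ (by simp) (by simp) ?_ ?_ ?_
    · rintro ⟨u, k, l, v, m, q, t, h, g, ⟨hu, hv, ht⟩, e1, e2, e3, e4, e5, e6, e7⟩; simp_all
    · rintro ⟨u, k, l, v, m, q, t, h, g, ⟨hu, hv, ht⟩, e1, e2, e3, e4, e5, e6, e7⟩; simp_all
    · rintro ⟨α, β, c, a1, b1, a2, b2⟩ h; simp at h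
      obtain ⟨⟨rfl, hb⟩, hd⟩ := h
      by_cases hz : α * b2 - β * a2 = 0
      · left
        refine RI_of 1 (-b1/b2) (β/b2) 1 0 (a2/b2) (1/b2) 0 0 (by simp [*]) ?_ ?_ ?_ ?_ ?_ ?_ ?_ <;> simp <;> field_simp
        · linear_combination -hz
        · ring
        · linear_combination -hd
        · ring
      · right
        obtain ⟨i, hi⟩ : ∃ i, i * (α * b2 - β * a2) = 1 := ⟨_, inv_mul_cancel₀ hz⟩
        have hi0 : i ≠ 0 := by rintro rfl; simp at hi
        refine RI_of 1 (-b1/b2) (β/b2) (b2*i) 0 (i*a2) (1/b2) 0 0 (by simp [*]) ?_ ?_ ?_ ?_ ?_ ?_ ?_ <;> simp <;> field_simp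
        · linear_combination -hi
        · ring
        · linear_combination -hd
        · ring
        · simp
  · refine Cnt.nz (fun s => ⟨0,0,0,s,0,0,1⟩) (by simp) ?_ ?_
    · rintro ⟨α, β, c, a1, b1, a2, b2⟩ h; simp at h
      obtain ⟨⟨rfl, hb⟩, hd⟩ := h
      refine ⟨(a1*b2-a2*b1)/b2^2, by simp [*], ?_⟩
      obtain ⟨i, hi⟩ : ∃ i, i * (a1 * b2 - a2 * b1) = 1 := ⟨_, inv_mul_cancel₀ hd⟩
      refine RI_of 1 (-b1/b2) (β/b2) 1 (-(α*b2-β*a2)*i) (a2/b2) (1/b2) 0 0 (by simp [*]) ?_ ?_ ?_ ?_ ?_ ?_ ?_ <;> simp <;> field_simp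
      · linear_combination (α*b2-β*a2) * hi
      all_goals ring
    · rintro s s' hs hs' ⟨u, k, l, v, m, q, t, h, g, ⟨hu, hv, ht⟩, e1, e2, e3, e4, e5, e6, e7⟩
      simp at e3 e4 e5 e6 e7
      have ek : k = 0 := by tauto
      have et : t = 1 := e7.symm
      simp [ek, et, mul_comm s', hu] at e4
      exact e4.symm

lemma cI2 (h5 : 5 ≤ p) : Cnt (RI (p := p)) (fun d => (True ∧ d.c = 0) ∧ ¬ ¬ d.b2 = 0) ((2 + 2) + (2 + (2 + (2 + 1)))) := by
  refine (Cnt.split (fun d => ¬ d.b1 = 0) ?_ (Cnt.split (fun d => ¬ d.a2 = 0) ?_ ?_ ?_)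
     (Cnt.split (fun d => ¬ d.a2 = 0) ?_ ?_ (Cnt.split (fun d => ¬ d.a1 = 0) ?_ ?_ (Cnt.split (fun d => d.be = 0) ?_ ?_ ?_))))
  · rintro c d hc hd ⟨u, k, l, v, m, q, t, h, g, ⟨hu, hv, ht⟩, e1, e2, e3, e4, e5, e6, e7⟩; simp at hc hd; exact not_congr (z0 hv (mul_ne_zero hu ht) (by simpa [hc, hd] using e5))
  · rintro c d hc hd ⟨u, k, l, v, m, q, t, h, g, ⟨hu, hv, ht⟩, e1, e2, e3, e4, e5, e6, e7⟩; simp at hc hd; exact not_congr (z0 hu (mul_ne_zero hv ht) (by simpa [hc, hd] using e6))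
  · refine Cnt.sq h5 (fun s => ⟨0,0,0,0,1,s,0⟩) (by simp) ?_ ?_
    · rintro ⟨α, β, c, a1, b1, a2, b2⟩ h; simp at h
      obtain ⟨⟨⟨rfl, rfl⟩, hb⟩, ha⟩ := h
      refine ⟨b1*a2, by simp [*], fun a h0 => ?_⟩
      refine RI_of 1 0 ((a*b1*α-a*β*a1)/(a*b1*a2)) (a*b1) (-a*β) (a*a1) a 0 0 (by simp [*]) ?_ ?_ ?_ ?_ ?_ ?_ ?_ <;> simp <;> field_simp <;> ring
    · rintro s s' hs hs' ⟨u, k, l, v, m, q, t, h, g, ⟨hu, hv, ht⟩, e1, e2, e3, e4, e5, e6, e7⟩; simp at e3 e5 e6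
      exact ⟨t, ht, mul_right_cancel₀ hu (by linear_combination e6 + t * s * e5)⟩
  · refine Cnt.two ⟨0,0,0,0,1,0,0⟩ ⟨1,0,0,0,1,0,0⟩ (by simp) (by simp) ?_ ?_ ?_
    · rintro ⟨u, k, l, v, m, q, t, h, g, ⟨hu, hv, ht⟩, e1, e2, e3, e4, e5, e6, e7⟩; simp_all
    · rintro ⟨u, k, l, v, m, q, t, h, g, ⟨hu, hv, ht⟩, e1, e2, e3, e4, e5, e6, e7⟩; simp_all
    · rintro ⟨α, β, c, a1, b1, a2, b2⟩ h; simp at h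
      obtain ⟨⟨⟨rfl, rfl⟩, hb⟩, rfl⟩ := h
      by_cases hz : α * b1 - β * a1 = 0
      · left
        refine RI_of 1 0 0 b1 (-β) a1 1 0 0 (by simp [*]) ?_ ?_ ?_ ?_ ?_ ?_ ?_ <;> simp
        · linear_combination -hz
        · ring
      · right
        obtain ⟨i, hi⟩ : ∃ i, i * (α * b1 - β * a1) = 1 := ⟨_, inv_mul_cancel₀ hz⟩
        have hi0 : i ≠ 0 := by rintro rfl; simp at hi
        refine RI_of 1 0 0 (b1*i) (-β*i) (a1*i) i 0 0 (by simp [*]) ?_ ?_ ?_ ?_ ?_ ?_ ?_ <;> simp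
        · linear_combination -hi
        all_goals ring
  · rintro c d hc hd ⟨u, k, l, v, m, q, t, h, g, ⟨hu, hv, ht⟩, e1, e2, e3, e4, e5, e6, e7⟩; simp at hc hd; exact not_congr (z0 hu (mul_ne_zero hv ht) (by simpa [hc, hd] using e6))
  · refine Cnt.two ⟨0,0,0,0,0,1,0⟩ ⟨0,1,0,0,0,1,0⟩ (by simp) (by simp) ?_ ?_ ?_
    · rintro ⟨u, k, l, v, m, q, t, h, g, ⟨hu, hv, ht⟩, e1, e2, e3, e4, e5, e6, e7⟩; simp [hu, hv, ht] at e2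
    · rintro ⟨u, k, l, v, m, q, t, h, g, ⟨hu, hv, ht⟩, e1, e2, e3, e4, e5, e6, e7⟩; simp [hu, hv, ht] at e2
    · rintro ⟨α, β, c, a1, b1, a2, b2⟩ h; simp at h
      obtain ⟨⟨⟨rfl, rfl⟩, rfl⟩, ha⟩ := h
      by_cases hz : β = 0
      · left; subst hz
        refine RI_of 1 (-a1/a2) (α/a2) 1 0 0 (1/a2) 0 0 (by simp [*]) ?_ ?_ ?_ ?_ ?_ ?_ ?_ <;> simp <;> field_simp <;> ring
      · right
        refine RI_of (1/β) (-a1/a2/β) (α/a2/β) 1 0 0 (1/β/a2) 0 0 (by simp [*]) ?_ ?_ ?_ ?_ ?_ ?_ ?_ <;> simp <;> field_simp <;> ring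
  · rintro c d hc hd ⟨u, k, l, v, m, q, t, h, g, ⟨hu, hv, ht⟩, e1, e2, e3, e4, e5, e6, e7⟩; simp at hc hd; exact not_congr (z0 hu (mul_ne_zero hu ht) (by simpa [hc, hd] using e4))
  · refine Cnt.two ⟨0,0,0,1,0,0,0⟩ ⟨0,1,0,1,0,0,0⟩ (by simp) (by simp) ?_ ?_ ?_
    · rintro ⟨u, k, l, v, m, q, t, h, g, ⟨hu, hv, ht⟩, e1, e2, e3, e4, e5, e6, e7⟩; simp_all
    · rintro ⟨u, k, l, v, m, q, t, h, g, ⟨hu, hv, ht⟩, e1, e2, e3, e4, e5, e6, e7⟩; simp_all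
    · rintro ⟨α, β, c, a1, b1, a2, b2⟩ h; simp at h
      obtain ⟨⟨⟨⟨rfl, rfl⟩, rfl⟩, rfl⟩, ha⟩ := h
      by_cases hz : β = 0
      · left; subst hz
        refine RI_of 1 0 0 1 (-α/a1) 0 (1/a1) 0 0 (by simp [*]) ?_ ?_ ?_ ?_ ?_ ?_ ?_ <;> simp <;> field_simp <;> ring
      · right
        refine RI_of (1/β) 0 0 1 (-α/a1) 0 (1/a1) 0 0 (by simp [*]) ?_ ?_ ?_ ?_ ?_ ?_ ?_ <;> simp <;> field_simp <;> ring
  · rintro c d hc hd ⟨u, k, l, v, m, q, t, h, g, ⟨hu, hv, ht⟩, e1, e2, e3, e4, e5, e6, e7⟩; simp at hc hd; exact z0 hv (mul_ne_zero hu hv) (by simpa [hc, hd] using e2)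
  · refine Cnt.two ⟨0,0,0,0,0,0,0⟩ ⟨1,0,0,0,0,0,0⟩ (by simp) (by simp) ?_ ?_ ?_
    · rintro ⟨u, k, l, v, m, q, t, h, g, ⟨hu, hv, ht⟩, e1, e2, e3, e4, e5, e6, e7⟩; simp_all
    · rintro ⟨u, k, l, v, m, q, t, h, g, ⟨hu, hv, ht⟩, e1, e2, e3, e4, e5, e6, e7⟩; simp_all
    · rintro ⟨α, β, c, a1, b1, a2, b2⟩ h; simp at h
      obtain ⟨⟨⟨⟨⟨rfl, rfl⟩, rfl⟩, rfl⟩, rfl⟩, rfl⟩ := h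
      by_cases hz : α = 0
      · left; subst hz
        refine RI_of 1 0 0 1 0 0 1 0 0 (by simp [*]) ?_ ?_ ?_ ?_ ?_ ?_ ?_ <;> simp
      · right
        refine RI_of 1 0 0 (1/α) 0 0 1 0 0 (by simp [*]) ?_ ?_ ?_ ?_ ?_ ?_ ?_ <;> simp [hz]
  · refine Cnt.one ⟨0,1,0,0,0,0,0⟩ (by simp) ?_
    rintro ⟨α, β, c, a1, b1, a2, b2⟩ h; simp at h
    obtain ⟨⟨⟨⟨⟨rfl, rfl⟩, rfl⟩, rfl⟩, rfl⟩, hb⟩ := h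
    refine RI_of (1/β) 0 0 1 0 (α/β) 1 0 0 (by simp [*]) ?_ ?_ ?_ ?_ ?_ ?_ ?_ <;> simp [hb]
    field_simp

lemma cI3 (h5 : 5 ≤ p) : Cnt (RI (p := p)) (fun d => True ∧ ¬ d.c = 0) (p + ((2 + 2) + (2 + 2 * 2))) := by
  refine (Cnt.split (fun d => ¬ d.b2 = 0) ?_ ?_ (Cnt.split (fun d => d.b1 = 0) ?_ (Cnt.split (fun d => d.a2 = 0) ?_ ?_ ?_) (Cnt.split (fun d => d.a2 = 0) ?_ ?_ ?_)))
  · rintro c d hc hd ⟨u, k, l, v, m, q, t, h, g, ⟨hu, hv, ht⟩, e1, e2, e3, e4, e5, e6, e7⟩; simp at hc hd; exact not_congr (z0 one_ne_zero ht (by simpa using e7))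
  · refine Cnt.all (fun s => ⟨0,0,1,s,0,0,1⟩) (by simp) ?_ ?_
    · rintro ⟨α, β, c, a1, b1, a2, b2⟩ h; simp at h
      obtain ⟨hc, hb⟩ := h
      refine ⟨(a1*b2-a2*b1)/b2^2, ?_⟩
      refine RI_of 1 (-b1/b2) 0 (1/b2/c) 0 (1/b2^2/c*a2) (1/b2) (β/b2/c) (α/b2/c) (by simp [*]) ?_ ?_ ?_ ?_ ?_ ?_ ?_ <;> simp <;> field_simp <;> ring_nf <;> simp
    · intro s s'
      rintro ⟨u, k, l, v, m, q, t, h, g, ⟨hu, hv, ht⟩, e1, e2, e3, e4, e5, e6, e7⟩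
      simp at e3 e4 e5 e6 e7
      have ek : k = 0 := by tauto
      have et : t = 1 := e7.symm
      simp [ek, et, mul_comm s', hu] at e4
      exact e4.symm
  · rintro c d hc hd ⟨u, k, l, v, m, q, t, h, g, ⟨hu, hv, ht⟩, e1, e2, e3, e4, e5, e6, e7⟩; simp at hc hd; exact z0 hv (mul_ne_zero hu ht) (by simpa [hc, hd] using e5)
  · rintro c d hc hd ⟨u, k, l, v, m, q, t, h, g, ⟨hu, hv, ht⟩, e1, e2, e3, e4, e5, e6, e7⟩; simp at hc hd; exact z0 hu (mul_ne_zero hv ht) (by simpa [hc, hd] using e6)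
  · refine Cnt.two ⟨0,0,1,0,0,0,0⟩ ⟨0,0,1,1,0,0,0⟩ (by simp) (by simp) ?_ ?_ ?_
    · rintro ⟨u, k, l, v, m, q, t, h, g, ⟨hu, hv, ht⟩, e1, e2, e3, e4, e5, e6, e7⟩; simp_all
    · rintro ⟨u, k, l, v, m, q, t, h, g, ⟨hu, hv, ht⟩, e1, e2, e3, e4, e5, e6, e7⟩; simp_all
    · rintro ⟨α, β, c, a1, b1, a2, b2⟩ h; simp at h
      obtain ⟨⟨⟨hc, rfl⟩, rfl⟩, rfl⟩ := h
      by_cases hz : a1 = 0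
      · left; subst hz
        refine RI_of 1 0 0 (1/c) 0 0 1 (β/c) (α/c) (by simp [*]) ?_ ?_ ?_ ?_ ?_ ?_ ?_ <;> simp <;> field_simp
      · right
        refine RI_of 1 0 0 (1/a1/c) 0 0 (1/a1) (β/c/a1) (α/c/a1) (by simp [*]) ?_ ?_ ?_ ?_ ?_ ?_ ?_ <;> simp <;> field_simp
  · refine Cnt.sq h5 (fun s => ⟨0,0,1,0,0,s,0⟩) (by simp) ?_ ?_
    · rintro ⟨α, β, c, a1, b1, a2, b2⟩ h; simp at h
      obtain ⟨⟨⟨hc, rfl⟩, rfl⟩, ha⟩ := h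
      refine ⟨c*a2, by simp [*], fun a h0 => ?_⟩
      refine RI_of 1 (-a1/a2) 0 a 0 0 (a*c) (β*a) (α*a) (by simp [*]) ?_ ?_ ?_ ?_ ?_ ?_ ?_ <;> simp <;> field_simp <;> ring
    · rintro s s' hs hs' ⟨u, k, l, v, m, q, t, h, g, ⟨hu, hv, ht⟩, e1, e2, e3, e4, e5, e6, e7⟩; simp at e3 e5 e6
      exact ⟨v, hv, mul_right_cancel₀ hu (by linear_combination e6 + v * s * e3)⟩
  · rintro c d hc hd ⟨u, k, l, v, m, q, t, h, g, ⟨hu, hv, ht⟩, e1, e2, e3, e4, e5, e6, e7⟩; simp at hc hd; exact z0 hu (mul_ne_zero hv ht) (by simpa [hc, hd] using e6)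
  · refine Cnt.sq h5 (fun s => ⟨0,0,1,0,s,0,0⟩) (by simp) ?_ ?_
    · rintro ⟨α, β, c, a1, b1, a2, b2⟩ h; simp at h
      obtain ⟨⟨⟨hc, rfl⟩, hb⟩, rfl⟩ := h
      refine ⟨c*b1, by simp [*], fun a h0 => ?_⟩
      refine RI_of a 0 0 1 0 (a1/b1) (a*c) (β*a) (α*a) (by simp [*]) ?_ ?_ ?_ ?_ ?_ ?_ ?_ <;> simp <;> field_simp <;> ring
    · rintro s s' hs hs' ⟨u, k, l, v, m, q, t, h, g, ⟨hu, hv, ht⟩, e1, e2, e3, e4, e5, e6, e7⟩; simp at e3 e5 e6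
      exact ⟨u, hu, mul_right_cancel₀ hv (by linear_combination e5 + u * s * e3)⟩
  · refine Cnt.sqsq h5 (fun s r => ⟨0,0,1,0,s,r,0⟩) (by simp +contextual) ?_ ?_
    · rintro ⟨α, β, c, a1, b1, a2, b2⟩ h; simp at h
      obtain ⟨⟨⟨hc, rfl⟩, hb⟩, ha⟩ := h
      refine ⟨c*b1, c*a2, by simp [*], by simp [*], fun a b h0 h1 => ?_⟩
      refine RI_of a 0 0 b 0 (b*a1/b1) (a*b*c) (β*a*b) (α*a*b) (by simp [*]) ?_ ?_ ?_ ?_ ?_ ?_ ?_ <;> simp <;> field_simp <;> ring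
    · rintro s r s' r' ⟨u, k, l, v, m, q, t, h, g, ⟨hu, hv, ht⟩, e1, e2, e3, e4, e5, e6, e7⟩
      simp at e3 e5 e6
      exact ⟨u, v, hu, hv, mul_right_cancel₀ hv (by linear_combination e5 + u * s * e3), mul_right_cancel₀ hu (by linear_combination e6 + v * r * e3)⟩

lemma cI (h5 : 5 ≤ p) : Cnt (RI (p := p)) (fun _ => True)
    (((2 + (p - 1)) + ((2 + 2) + (2 + (2 + (2 + 1))))) + (p + ((2 + 2) + (2 + 2 * 2)))) := by
  refine Cnt.split (fun d => d.c = 0) ?_ (Cnt.split (fun d => ¬ d.b2 = 0) ?_ cI1 (cI2 h5)) (cI3 h5)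
  · rintro c d hc hd ⟨u, k, l, v, m, q, t, h, g, ⟨hu, hv, ht⟩, e1, e2, e3, e4, e5, e6, e7⟩; exact z0 ht (mul_ne_zero hu hv) e3
  · rintro c d hc hd ⟨u, k, l, v, m, q, t, h, g, ⟨hu, hv, ht⟩, e1, e2, e3, e4, e5, e6, e7⟩; simp at hc hd; exact not_congr (z0 one_ne_zero ht (by simpa using e7))
end k21

section k22
variable {p : ℕ} [Fact p.Prime]
local notation "𝕂" => ZMod p

def RII (d d' : KC 𝕂) : Prop := ∃ u k m q t h : 𝕂, (u ≠ 0 ∧ t ≠ 0) ∧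
  d'.be + d'.c * h = u * d.be + u * m * d.b1 ∧
  d'.c * t = u * d.c ∧
  d'.a1 * u + d'.b1 * q = u * h + u * t * d.a1 + k * t * d.a2 ∧
  d'.b1 = u * t * d.b1 ∧
  d'.a2 * u = t * d.a2

lemma RII_of {d d' : KC 𝕂} (u k m q t h : 𝕂) (h0 : u ≠ 0 ∧ t ≠ 0)
  (h1 : d'.be + d'.c * h = u * d.be + u * m * d.b1)
  (h2 : d'.c * t = u * d.c)
  (h3 : d'.a1 * u + d'.b1 * q = u * h + u * t * d.a1 + k * t * d.a2)
  (h4 : d'.b1 = u * t * d.b1)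
  (h5 : d'.a2 * u = t * d.a2) : RII d d' := ⟨u, k, m, q, t, h, h0, h1, h2, h3, h4, h5⟩

lemma cII (h5 : 5 ≤ p) : Cnt (RII (p := p)) (fun _ => True) ((((p - 1) + 2) + 2 * p) + ((2 + 1) + (2 + 2))) := by
  refine Cnt.split (fun d => ¬ d.c = 0) ?_ (Cnt.split (fun d => d.b1 = 0) ?_ (Cnt.split (fun d => ¬ d.a2 = 0) ?_ ?_ ?_) ?_)
    (Cnt.split (fun d => ¬ d.b1 = 0) ?_ (Cnt.split (fun d => ¬ d.a2 = 0) ?_ ?_ ?_) (Cnt.split (fun d => ¬ d.a2 = 0) ?_ ?_ ?_))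
  · rintro c d - - ⟨u, k, m, q, t, h, ⟨hu, ht⟩, e1, e2, e3, e4, e5⟩; exact not_congr (z0 ht hu e2)
  · rintro c d - - ⟨u, k, m, q, t, h, ⟨hu, ht⟩, e1, e2, e3, e4, e5⟩; exact z0 one_ne_zero (mul_ne_zero hu ht) (by simpa using e4)
  · rintro c d - - ⟨u, k, m, q, t, h, ⟨hu, ht⟩, e1, e2, e3, e4, e5⟩; exact not_congr (z0 hu ht e5)
  · refine Cnt.nz (fun s => ⟨0,0,1,0,0,s,0⟩) (by simp) ?_ ?_
    · rintro ⟨α, β, c, a1, b1, a2, b2⟩ h; simp at h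
      obtain ⟨⟨hc, rfl⟩, ha⟩ := h
      refine ⟨c*a2, by simp [*], ?_⟩
      refine RII_of 1 (-(β + c*a1)/(c*a2)) 0 0 c β (by simp [*]) ?_ ?_ ?_ ?_ ?_ <;> simp <;> field_simp <;> ring
    · rintro s s' hs hs' ⟨u, k, m, q, t, h, ⟨hu, ht⟩, e1, e2, e3, e4, e5⟩
      simp at e2 e5
      rw [e2, mul_comm] at e5
      exact (mul_left_cancel₀ hu e5).symm
  · refine Cnt.two ⟨0,0,1,0,0,0,0⟩ ⟨0,0,1,1,0,0,0⟩ (by simp) (by simp) ?_ ?_ ?_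
    · rintro ⟨u, k, m, q, t, h, ⟨hu, ht⟩, e1, e2, e3, e4, e5⟩; simp at e1 e3; exact hu (by rw [e3, e1, mul_zero])
    · rintro ⟨u, k, m, q, t, h, ⟨hu, ht⟩, e1, e2, e3, e4, e5⟩; simp at e1 e3; simp [e1, hu, ht] at e3
    · rintro ⟨α, β, c, a1, b1, a2, b2⟩ h; simp at h
      obtain ⟨⟨hc, rfl⟩, rfl⟩ := h
      by_cases hz : β + c * a1 = 0
      · left
        refine RII_of 1 0 0 0 c β (by simp [*]) ?_ ?_ ?_ ?_ ?_ <;> simp [hz]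
      · right
        obtain ⟨i, hi⟩ : ∃ i, i * (β + c * a1) = 1 := ⟨_, inv_mul_cancel₀ hz⟩
        have hi0 : i ≠ 0 := by rintro rfl; simp at hi
        refine RII_of i 0 0 0 (i*c) (i*β) (by simp [*]) ?_ ?_ ?_ ?_ ?_ <;> simp
        linear_combination -i * hi
  · refine Cnt.sqall h5 (fun s r => ⟨0,0,1,0,s,r,0⟩) (by simp) ?_ ?_
    · rintro ⟨α, β, c, a1, b1, a2, b2⟩ h; simp at h
      obtain ⟨hc, hb⟩ := h
      refine ⟨c*b1, c*a2, by simp [*], fun a h0 => ?_⟩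
      refine RII_of a 0 0 ((β+c*a1)/(c*b1)) (a*c) (a*β) (by simp [*]) ?_ ?_ ?_ ?_ ?_ <;> simp <;> field_simp <;> ring
    · rintro s r s' r' ⟨u, k, m, q, t, h, ⟨hu, ht⟩, e1, e2, e3, e4, e5⟩
      simp at e2 e4 e5
      subst e2
      exact ⟨(mul_right_cancel₀ hu (by linear_combination e5)).symm, t, hu, by rw [e4]; ring⟩
  · rintro c d - - ⟨u, k, m, q, t, h, ⟨hu, ht⟩, e1, e2, e3, e4, e5⟩; exact not_congr (z0 one_ne_zero (mul_ne_zero hu ht) (by simpa using e4))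
  · rintro c d - - ⟨u, k, m, q, t, h, ⟨hu, ht⟩, e1, e2, e3, e4, e5⟩; exact not_congr (z0 hu ht e5)
  · refine Cnt.sq h5 (fun s => ⟨0,0,0,0,1,s,0⟩) (by simp) ?_ ?_
    · rintro ⟨α, β, c, a1, b1, a2, b2⟩ h; simp at h
      obtain ⟨⟨rfl, hb⟩, ha⟩ := h
      refine ⟨a2/b1, by simp [*], fun a h0 => ?_⟩
      refine RII_of (1/a) 0 (-β/b1) 0 (a/b1) (-(a/b1)*a1) (by simp [*]) ?_ ?_ ?_ ?_ ?_ <;> simp <;> field_simp <;> ring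
    · rintro s s' hs hs' ⟨u, k, m, q, t, h, ⟨hu, ht⟩, e1, e2, e3, e4, e5⟩
      simp at e4 e5
      exact ⟨t, ht, by linear_combination t * e5 + s' * e4⟩
  · refine Cnt.one ⟨0,0,0,0,1,0,0⟩ (by simp) ?_
    rintro ⟨α, β, c, a1, b1, a2, b2⟩ h; simp at h
    obtain ⟨⟨rfl, hb⟩, rfl⟩ := h
    refine RII_of 1 0 (-β/b1) 0 (1/b1) (-(1/b1)*a1) (by simp [*]) ?_ ?_ ?_ ?_ ?_ <;> simp [hb]
  · rintro c d - - ⟨u, k, m, q, t, h, ⟨hu, ht⟩, e1, e2, e3, e4, e5⟩; exact not_congr (z0 hu ht e5)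
  · refine Cnt.two ⟨0,0,0,0,0,1,0⟩ ⟨0,1,0,0,0,1,0⟩ (by simp) (by simp) ?_ ?_ ?_
    · rintro ⟨u, k, m, q, t, h, ⟨hu, ht⟩, e1, e2, e3, e4, e5⟩; simp at e1
    · rintro ⟨u, k, m, q, t, h, ⟨hu, ht⟩, e1, e2, e3, e4, e5⟩; simp [hu] at e1; exact hu e1.symm
    · rintro ⟨α, β, c, a1, b1, a2, b2⟩ h; simp at h
      obtain ⟨⟨rfl, rfl⟩, ha⟩ := h
      by_cases hz : β = 0
      · left; subst hz
        refine RII_of 1 0 0 0 (1/a2) (-(1/a2)*a1) (by simp [*]) ?_ ?_ ?_ ?_ ?_ <;> simp [ha]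
      · right
        refine RII_of (1/β) 0 0 0 (1/β/a2) (-(1/β/a2)*a1) (by simp [*]) ?_ ?_ ?_ ?_ ?_ <;> simp [ha, hz]
        ring
  · refine Cnt.two ⟨0,0,0,0,0,0,0⟩ ⟨0,1,0,0,0,0,0⟩ (by simp) (by simp) ?_ ?_ ?_
    · rintro ⟨u, k, m, q, t, h, ⟨hu, ht⟩, e1, e2, e3, e4, e5⟩; simp at e1
    · rintro ⟨u, k, m, q, t, h, ⟨hu, ht⟩, e1, e2, e3, e4, e5⟩; simp [hu] at e1; exact hu e1.symm
    · rintro ⟨α, β, c, a1, b1, a2, b2⟩ h; simp at h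
      obtain ⟨⟨rfl, rfl⟩, rfl⟩ := h
      by_cases hz : β = 0
      · left; subst hz
        refine RII_of 1 0 0 0 1 (-a1) (by simp) ?_ ?_ ?_ ?_ ?_ <;> simp
      · right
        refine RII_of (1/β) 0 0 0 1 (-a1) (by simp [*]) ?_ ?_ ?_ ?_ ?_ <;> simp [hz]

def tI (d : KC 𝕂) : IC := ⟨p * d.al.val, d.be.val, d.c.val, d.a1.val, d.b1.val, d.a2.val, d.b2.val⟩
def tII (d : KC 𝕂) : IC := ⟨1, d.be.val, d.c.val, d.a1.val, d.b1.val, d.a2.val, 0⟩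

lemma zne {i : ℤ} : ¬ (p:ℤ) ∣ i ↔ (i : 𝕂) ≠ 0 := not_congr (zdvd i)
lemma zsub (i j : ℤ) : (p:ℤ) ∣ i - j ↔ (i : 𝕂) = (j : 𝕂) := by rw [zdvd, Int.cast_sub, sub_eq_zero]
lemma zp2 {i j : ℤ} (h : i = p * j) : (p:ℤ) ^ 2 ∣ i ↔ (p:ℤ) ∣ j := by
  rw [h, pow_two]
  exact mul_dvd_mul_iff_left (by exact_mod_cast (Fact.out : p.Prime).ne_zero)

lemma R21_I (d d' : KC 𝕂) : R21 p (tI d) (tI d') ↔ RI d d' := by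
  constructor
  · rintro ⟨⟨u, k, l, v, m, q, t, h, g⟩, hu, hv, ht, ⟨h1, h2, h3⟩, ⟨h4, h5⟩, h6, h7⟩
    simp only [tI] at *
    rw [zp2 (j := (d'.al.val * u + d'.be.val * q + d'.c.val * g) - (u * v * d.al.val + u * m * d.a1.val + (k * m - l * v) * d.a2.val)) (by ring)] at h1
    rw [zne] at hu hv ht
    rw [zsub] at h1 h2 h3 h4 h5 h6 h7
    simp at h1 h2 h3 h4 h5 h6 h7
    exact RI_of u k l v m q t h g ⟨hu, hv, ht⟩ h1 h2 h3 h4 h5 h6 (mul_right_cancel₀ hv (by linear_combination h7))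
  · rintro ⟨u, k, l, v, m, q, t, h, g, ⟨hu, hv, ht⟩, e1, e2, e3, e4, e5, e6, e7⟩
    refine ⟨⟨u.val, k.val, l.val, v.val, m.val, q.val, t.val, h.val, g.val⟩, ?_, ?_, ?_, ⟨?_, ?_, ?_⟩, ⟨?_, ?_⟩, ?_, ?_⟩
    · rw [zne]; simpa using hu
    · rw [zne]; simpa using hv
    · rw [zne]; simpa using ht
    · simp only [tI]
      rw [zp2 (j := (d'.al.val * u.val + d'.be.val * q.val + d'.c.val * g.val) - (u.val * v.val * d.al.val + u.val * m.val * d.a1.val + (k.val * m.val - l.val * v.val) * d.a2.val)) (by ring), zsub]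
      simpa using e1
    all_goals simp only [tI]; rw [zsub]; simp
    · exact e2
    · exact e3
    · exact e4
    · exact e5
    · exact e6
    · rw [e7]; ring

lemma R21_II (d d' : KC 𝕂) : R21 p (tII d) (tII d') ↔ RII d d' := by
  constructor
  · rintro ⟨⟨u, k, l, v, m, q, t, h, g⟩, hu, hv, ht, ⟨h1, h2, h3⟩, ⟨h4, h5⟩, h6, h7⟩
    simp only [tII] at *
    have h1 := (dvd_pow_self (p:ℤ) (by norm_num)).trans h1
    rw [zne] at hu hv ht
    rw [zsub] at h1 h2 h3 h4 h5 h6 h7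
    simp at h1 h2 h3 h4 h5 h6 h7
    have hv1 : (v : 𝕂) = 1 := mul_left_cancel₀ hu (by rw [← h1, mul_one])
    simp only [hv1, mul_one, one_mul] at h2 h3 h5 h6
    exact RII_of u k m q t h ⟨hu, ht⟩ h2 h3 h4 h5 h6
  · rintro ⟨u, k, m, q, t, h, ⟨hu, ht⟩, e1, e2, e3, e4, e5⟩
    have hv : (1 + p * ((u⁻¹ * (d'.be * q - u * m * d.a1 - k * m * d.a2)).val : ℤ) : ℤ) = (1 : 𝕂) := by simp
    generalize hw : (((u⁻¹ * (d'.be * q - u * m * d.a1 - k * m * d.a2)).val : ℕ) : ℤ) = w at hv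
    have hw : (w : 𝕂) = (u⁻¹ * (d'.be * q - u * m * d.a1 - k * m * d.a2)) := by rw [← hw]; simp
    refine ⟨⟨u.val, k.val, 0, 1 + p * w, m.val, q.val, t.val, h.val, 0⟩, ?_, ?_, ?_, ⟨?_, ?_, ?_⟩, ⟨?_, ?_⟩, ?_, ?_⟩
    · rw [zne]; simpa using hu
    · rw [zne, hv]; exact one_ne_zero
    · rw [zne]; simpa using ht
    · simp only [tII]
      rw [zp2 (j := (d'.be.val * q.val) - (u.val * w + u.val * m.val * d.a1.val + (k.val * m.val) * d.a2.val)) (by ring), zsub]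
      simp [hw]
      field_simp
      ring
    all_goals simp only [tII]; rw [zsub]; simp
    · exact e1
    · exact e2
    · exact e3
    · exact e4
    · exact e5

lemma c21 (h5 : 5 ≤ p) : Cnt (R21 p) (J21 p) (5 * p + 30) := by
  have hp : p.Prime := Fact.out
  have hpi : Prime (p:ℤ) := Nat.prime_iff_prime_int.1 hp
  have key : Cnt (R21 p) (J21 p) ((((2 + (p - 1)) + ((2 + 2) + (2 + (2 + (2 + 1))))) + (p + ((2 + 2) + (2 + 2 * 2)))) +
      ((((p - 1) + 2) + 2 * p) + ((2 + 1) + (2 + 2)))) := by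
    refine Cnt.split (fun c => (p:ℤ) ∣ c.a) ?_ ?_ ?_
    · rintro c d - - ⟨P, hu, hv, ht, ⟨h1, -⟩, -⟩
      have h1 := (dvd_pow_self (p:ℤ) (by norm_num)).trans h1
      rw [zne] at hu hv
      rw [zsub] at h1
      simp at h1
      rw [zdvd, zdvd]
      exact z0 hu (mul_ne_zero hu hv) h1
    · refine (cI h5).sub tI ?_ ?_ (fun c c' c'' hc => R21.trans hp hc.1) (fun d d' => (R21_I d d').1) (fun d d' => (R21_I d d').2)
      · intro d _; simp [tI, J21, mul_assoc]
      · rintro ⟨a, β, c, a1, b1, a2, b2⟩ ⟨-, ⟨α, rfl⟩⟩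
        refine ⟨⟨α, β, c, a1, b1, a2, b2⟩, trivial, ⟨1,0,0,1,0,0,1,0,0⟩, hpi.not_dvd_one, hpi.not_dvd_one, hpi.not_dvd_one, ⟨?_, ?_, ?_⟩, ⟨?_, ?_⟩, ?_, ?_⟩
        · simp only [tI]
          rw [zp2 (j := ((α : 𝕂).val : ℤ) - α) (by ring), zsub]; simp
        all_goals simp only [tI]; rw [zsub]; simp
    · refine (cII h5).sub tII ?_ ?_ (fun c c' c'' hc => R21.trans hp hc.1) (fun d d' => (R21_II d d').1) (fun d d' => (R21_II d d').2)
      · intro d _; simp [tII, J21, hp.ne_one]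
        exact hpi.not_dvd_one
      · rintro ⟨a, β, c, a1, b1, a2, b2⟩ ⟨hJ, ha⟩
        simp only at ha
        have hb : (p:ℤ) ∣ b2 := (hpi.dvd_or_dvd hJ).resolve_left ha
        obtain ⟨v, y, hv⟩ := invp hp ha 2
        have hv0 : (a : 𝕂) * v = 1 := by
          have := congrArg (Int.cast (R := 𝕂)) hv
          simpa using this
        have hvn : ¬ (p:ℤ) ∣ v := by rw [zne]; rintro h; rw [h, mul_zero] at hv0; exact zero_ne_one hv0
        rw [zdvd] at hb
        refine ⟨⟨0, β, v * c, a1, a * b1, v * a2, 0⟩, trivial, ⟨1,0,0,v,0,0,1,0,0⟩, hpi.not_dvd_one, hvn, hpi.not_dvd_one, ⟨?_, ?_, ?_⟩, ⟨?_, ?_⟩, ?_, ?_⟩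
        · simp only [tII]; exact ⟨-y, by linear_combination -hv⟩
        all_goals simp only [tII]; rw [zsub]; simp
        · ring
        · linear_combination (b1 : 𝕂) * hv0
        · right; exact hb
  convert key using 1
  have := hp.pos
  omega
end k22

section t3
variable {p f : ℕ}
def F3 (p f : ℕ) (r s : ℤ) (v w : ℤ × ℤ) : ℤ × ℤ :=
  ((p:ℤ)^(f+1) * r * (v.1*w.2 - v.2*w.1), s * (v.1*w.2 - v.2*w.1))

def S3 (f : ℕ) (c : ℕ × ℕ) : Prop :=
  c.1 ≤ 3 ∧ 1 ≤ c.2 ∧ c.2 ≤ 3 ∧ (c.1 < c.2 ∨ c.1 = 3) ∧ (c.2 < c.1 + f + 1 ∨ c.2 = 3)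

lemma lat3_sub (e : ℕ) : ∃ Λ : AddSubgroup (ℤ × ℤ), ∀ v, v ∈ Λ ↔ Lat3 p e v :=
  ⟨{ carrier := {v | Lat3 p e v}
     add_mem' := fun {a b} ha hb => ⟨dvd_add ha.1 hb.1, dvd_add ha.2 hb.2⟩
     zero_mem' := ⟨dvd_zero _, dvd_zero _⟩
     neg_mem' := fun {a} ha => ⟨(dvd_neg).2 ha.1, (dvd_neg).2 ha.2⟩ }, fun v => Iff.rfl⟩

lemma ex3 (r s : ℤ) : ∃ (Λ : AddSubgroup (ℤ × ℤ)) (t : LS ((ℤ × ℤ) ⧸ Λ)),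
    (∀ v, v ∈ Λ ↔ Lat3 p (f+4) v) ∧ Pres (Lat3 p (f+4)) (F3 p f r (p * s)) ⟨_, t⟩ := by
  have l0 : Lat3 p (f+4) 0 := by simp [Lat3]
  have hz : ∀ v, v = 0 → Lat3 p (f+4) v := fun v h => by rw [h]; exact l0
  refine Pres.ex (lat3_sub _) ?_ ?_ ?_ ?_ ?_ ?_
  · rintro ⟨a, b⟩ ⟨x, y⟩ ⟨_, _⟩ ⟨⟨i, rfl⟩, ⟨j, rfl⟩⟩
    refine ⟨⟨?_, ?_⟩, ⟨?_, ?_⟩⟩ <;> simp only [F3, Prod.fst_sub, Prod.snd_sub, Prod.fst_add, Prod.snd_add]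
    · exact ⟨r * (p^(f+1) * i * y - j * x), by ring⟩
    · exact ⟨p * s * (p^(f+1) * i * y - j * x), by ring⟩
    · exact ⟨-(r * (p^(f+1) * i * y - j * x)), by ring⟩
    · exact ⟨-(p * s * (p^(f+1) * i * y - j * x)), by ring⟩
  · intro a b d; apply hz; ext <;> simp [F3] <;> ring
  · intro a b d; apply hz; ext <;> simp [F3] <;> ring
  · intro a; apply hz; ext <;> simp [F3] <;> ring_nf <;> simp
  · intro a b d; apply hz; ext <;> simp [F3] <;> ring
  · intro a b c d e
    have s2 : ∀ (a : ℤ × ℤ) (X : ℤ), F3 p f r (p * s) a (p^(f+1) * r * X, p * s * X) =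
        (p^(f+1) * r * (p * (a.1 * s - a.2 * (p^f * r)) * X), p * s * (p * (a.1 * s - a.2 * (p^f * r)) * X)) :=
        fun a X => by ext <;> simp only [F3] <;> ring
    rw [show F3 p f r (p * s) d e = (p^(f+1) * r * (d.1*e.2 - d.2*e.1), p * s * (d.1*e.2 - d.2*e.1)) from rfl, s2, s2, s2]
    generalize a.1 * s - a.2 * (p^f * r) = X
    generalize b.1 * s - b.2 * (p^f * r) = Y
    generalize c.1 * s - c.2 * (p^f * r) = Z
    exact ⟨⟨r * X * Y * Z * (d.1*e.2 - d.2*e.1), by ring⟩, ⟨p * s * X * Y * Z * (d.1*e.2 - d.2*e.1), by ring⟩⟩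

lemma chg3 (hp : p.Prime) {r s r' s' : ℤ} {L : LR} [Finite L.A] (hL : ∀ a : L.A, (p ^ (f+4) : ℕ) • a = 0)
    (h : Pres (Lat3 p (f+4)) (F3 p f r s) L) (u k l v : ℤ) (hu : ¬ (p:ℤ) ∣ u) (hv : ¬ (p:ℤ) ∣ v)
    (c1 : (p:ℤ)^3 ∣ r' * u + s' * l - r * (u * v - k * (p^(f+1) * l)))
    (c2 : (p:ℤ)^3 ∣ p^(f+1) * r' * k + s' * v - s * (u * v - k * (p^(f+1) * l))) :
    Pres (Lat3 p (f+4)) (F3 p f r' s') L := by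
  obtain ⟨d1, c1⟩ := c1
  obtain ⟨d2, c2⟩ := c2
  refine h.chg (p := p) hL (lin2 (u, k) ((p:ℤ)^(f+1) * l, v)) ?_ ?_ ?_
  · rintro ⟨_, _⟩ ⟨⟨i, rfl⟩, ⟨j, rfl⟩⟩
    rw [lin2_apply]
    exact ⟨⟨i * u + j * l, by simp; ring⟩, ⟨p^(f+1) * i * k + j * v, by simp; ring⟩⟩
  · rintro ⟨a, b⟩
    obtain ⟨x, x', hx⟩ := invp hp hu 1
    obtain ⟨y, y', hy⟩ := invp hp hv 1
    rw [pow_one] at hx hy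
    refine ⟨(a * x, (b - a * x * k) * y), (a * x' + p^f * l * (b - a * x * k) * y, y' * (b - a * x * k)), ?_⟩
    rw [lin2_apply]
    ext
    · simp; linear_combination a * hx
    · simp; linear_combination (b - a * x * k) * hy
  · rintro ⟨a, b⟩ ⟨x, y⟩
    simp only [lin2_apply]
    refine ⟨⟨d1 * (a * y - b * x), ?_⟩, ⟨d2 * (a * y - b * x), ?_⟩⟩ <;> simp [F3]
    · linear_combination (a * y - b * x) * p^(f+1) * c1
    · linear_combination (a * y - b * x) * c2

lemma lin_T2 (T : (ℤ × ℤ) →+ (ℤ × ℤ)) (v) : T v = lin2 (T (1,0)) (T (0,1)) v := by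
  rw [lin2_apply, ← map_zsmul, ← map_zsmul, ← map_add]
  congr 1
  ext <;> simp

lemma two3 (hp : p.Prime) {r s r' s' : ℤ} {L : LR} (h : Pres (Lat3 p (f+4)) (F3 p f r s) L)
    (h' : Pres (Lat3 p (f+4)) (F3 p f r' s') L) : ∃ u k l v : ℤ, ¬ (p:ℤ) ∣ u * v - k * (p^(f+1) * l) ∧
      (p:ℤ)^3 ∣ r' * u + s' * l - r * (u * v - k * (p^(f+1) * l)) ∧
      (p:ℤ)^3 ∣ p^(f+1) * r' * k + s' * v - s * (u * v - k * (p^(f+1) * l)) := by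
  obtain ⟨T, T', h1, h2, h3⟩ := h.two h'
  have hp0 : (p:ℤ) ≠ 0 := by exact_mod_cast hp.ne_zero
  have hpi : Prime (p:ℤ) := Nat.prime_iff_prime_int.1 hp
  have n1 : ¬ (p:ℤ) ∣ 1 := hpi.not_dvd_one
  have a1 := (h1 ((p:ℤ)^3 • (0,1))).2 (by simp [Lat3])
  rw [map_zsmul] at a1
  have e1 : (p:ℤ)^(f+1) ∣ (T (0,1)).1 := by
    have := a1.1
    rw [show (p:ℤ)^(f+4) = p^3 * p^(f+1) by ring] at this
    exact (mul_dvd_mul_iff_left (pow_ne_zero 3 hp0)).1 this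
  obtain ⟨l, hl⟩ := e1
  have g3 := h3 (1,0) (0,1)
  simp only [lin_T2 T (F3 _ _ _ _ _ _), lin2_apply] at g3
  have o1 := h2 (1,0)
  have o2 := h2 (0,1)
  rw [lin_T2 T (T' _), lin2_apply] at o1 o2
  generalize T' (1,0) = x at *
  generalize T' (0,1) = y at *
  generalize hX : T (1,0) = X at *
  generalize hY : T (0,1) = Y at *
  obtain ⟨u, k⟩ := X
  obtain ⟨q, v⟩ := Y
  obtain ⟨x1, x2⟩ := x
  obtain ⟨y1, y2⟩ := y
  simp only at hl
  subst hl
  obtain ⟨m1, m2⟩ := o1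
  obtain ⟨m3, m4⟩ := o2
  obtain ⟨g1, g2⟩ := g3
  have m1 := (dvd_pow_self (p:ℤ) (show f + 4 ≠ 0 by omega)).trans m1
  have m2 := (dvd_pow_self (p:ℤ) (show 3 ≠ 0 by omega)).trans m2
  have m3 := (dvd_pow_self (p:ℤ) (show f + 4 ≠ 0 by omega)).trans m3
  have m4 := (dvd_pow_self (p:ℤ) (show 3 ≠ 0 by omega)).trans m4
  simp [F3] at m1 m2 m3 m4 g1 g2
  refine ⟨u, k, l, v, ?_, ?_, ?_⟩
  · rintro ⟨z, hz⟩
    obtain ⟨a, ha⟩ := m1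
    obtain ⟨b, hb⟩ := m2
    obtain ⟨c, hc⟩ := m3
    obtain ⟨d, hd⟩ := m4
    apply n1
    exact ⟨(x1 * y2 - x2 * y1) * z - a - d - p * a * d + p * b * c, by
      linear_combination (x1 * y2 - x2 * y1) * hz - (y1 * k + y2 * v) * ha - (1 + p * a) * hd + (y1 * u + y2 * (p^(f+1)*l)) * hb + p * b * hc⟩
  · rw [show (p:ℤ)^(f+4) = p^(f+1) * p^3 by ring] at g1
    refine (mul_dvd_mul_iff_left (pow_ne_zero (f+1) hp0)).1 (g1.trans (dvd_of_eq ?_))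
    ring
  · exact g2.trans (dvd_of_eq (by ring))

lemma inv3 (hp : p.Prime) {r s r' s' : ℤ} {L : LR} (h : Pres (Lat3 p (f+4)) (F3 p f r s) L)
    (h' : Pres (Lat3 p (f+4)) (F3 p f r' s') L) (m : ℕ) (hm : m ≤ 3) (hs : (p:ℤ)^m ∣ s') :
    ((p:ℤ)^m ∣ r' → (p:ℤ)^m ∣ r) ∧ ((p:ℤ)^m ∣ p^(f+1) * r' → (p:ℤ)^m ∣ s) := by
  obtain ⟨u, k, l, v, hD, c1, c2⟩ := two3 hp h h'
  have c1 := (pow_dvd_pow (p:ℤ) hm).trans c1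
  have c2 := (pow_dvd_pow (p:ℤ) hm).trans c2
  have hc : IsCoprime ((p:ℤ)^m) (u * v - k * (p^(f+1) * l)) :=
    IsCoprime.pow_left ((Nat.prime_iff_prime_int.1 hp).coprime_iff_not_dvd.2 hD)
  refine ⟨fun hr => hc.dvd_of_dvd_mul_right ((dvd_sub_right (dvd_add (hr.mul_right _) (hs.mul_right _))).1 c1),
    fun hr => hc.dvd_of_dvd_mul_right ((dvd_sub_right (dvd_add (hr.mul_right _) (hs.mul_right _))).1 c2)⟩

lemma uniq3 (hp : p.Prime) {c c' : ℕ × ℕ} {L : LR} (hc : S3 f c) (hc' : S3 f c')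
    (h : Pres (Lat3 p (f+4)) (F3 p f (p^c.1) (p^c.2)) L)
    (h' : Pres (Lat3 p (f+4)) (F3 p f (p^c'.1) (p^c'.2)) L) : c = c' := by
  have key : ∀ {c c' : ℕ × ℕ}, S3 f c → S3 f c' → Pres (Lat3 p (f+4)) (F3 p f (p^c.1) (p^c.2)) L →
      Pres (Lat3 p (f+4)) (F3 p f (p^c'.1) (p^c'.2)) L → min c'.1 c'.2 ≤ c.1 ∧ min (c'.1 + f + 1) c'.2 ≤ c.2 := by
    intro c c' hc hc' h h'
    have pw : ∀ a b, (p:ℤ)^a ∣ p^b ↔ a ≤ b := fun a b => pow_dvd_pow_iff (by exact_mod_cast hp.ne_zero) (by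
      rw [Int.isUnit_iff]; have := hp.two_le; omega)
    obtain ⟨q1, q2, q3, q4, q5⟩ := hc'
    have k1 := (inv3 hp h h' (min c'.1 c'.2) (by omega) ((pw _ _).2 (by omega))).1
    have k2 := (inv3 hp h h' (min (c'.1 + f + 1) c'.2) (by omega) ((pw _ _).2 (by omega))).2
    rw [← pow_add] at k2
    rw [pw, pw] at k1 k2
    omega
  have a := key hc hc' h h'
  have b := key hc' hc h' h
  obtain ⟨i, j⟩ := c
  obtain ⟨i', j'⟩ := c'
  simp only [S3] at *
  ext <;> simp only <;> omega

lemma pdec (hp : p.Prime) (r : ℤ) : ∃ (i : ℕ) (w : ℤ), i ≤ 3 ∧ ¬ (p:ℤ) ∣ w ∧ (p:ℤ)^3 ∣ w * r - p^i ∧ ((p:ℤ) ∣ r → 1 ≤ i) := by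
  have n1 : ¬ (p:ℤ) ∣ 1 := (Nat.prime_iff_prime_int.1 hp).not_dvd_one
  have fin : ∀ i r0, ¬ (p:ℤ) ∣ r0 → ∃ w : ℤ, ¬ (p:ℤ) ∣ w ∧ (p:ℤ)^3 ∣ w * (p^i * r0) - p^i := by
    intro i r0 h
    obtain ⟨w, t, ht⟩ := invp hp h 3
    refine ⟨w, fun hw => n1 ?_, p^i * t, by linear_combination (p:ℤ)^i * ht⟩
    have := hw.mul_left r0
    rwa [ht, dvs (p^2 * t) (Y := 1) (by ring)] at this
  by_cases h0 : (p:ℤ) ∣ r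
  swap
  · obtain ⟨w, hw, h⟩ := fin 0 r h0
    exact ⟨0, w, by omega, hw, by simpa using h, fun h => absurd h h0⟩
  obtain ⟨r, rfl⟩ := h0
  by_cases h1 : (p:ℤ) ∣ r
  swap
  · obtain ⟨w, hw, h⟩ := fin 1 r h1
    exact ⟨1, w, by omega, hw, by simpa using h, fun h => le_rfl⟩
  obtain ⟨r, rfl⟩ := h1
  by_cases h2 : (p:ℤ) ∣ r
  swap
  · obtain ⟨w, hw, h⟩ := fin 2 r h2
    exact ⟨2, w, by omega, hw, by rw [← mul_assoc (p:ℤ), ← pow_two]; exact h, fun h => by omega⟩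
  obtain ⟨r, rfl⟩ := h2
  exact ⟨3, 1, le_rfl, n1, ⟨r - 1, by ring⟩, fun h => by omega⟩

lemma cov3 (hp : p.Prime) {L : LR} (hT : TT p (f+4) L) (n2 : ¬ cyc p 2 L) :
    ∃ c, S3 f c ∧ Pres (Lat3 p (f+4)) (F3 p f (p^c.1) (p^c.2)) L := by
  have := hT.fin hp
  have hp0 : (p:ℤ) ≠ 0 := by exact_mod_cast hp.ne_zero
  have hpi : Prime (p:ℤ) := Nat.prime_iff_prime_int.1 hp
  have n1 : ¬ (p:ℤ) ∣ 1 := hpi.not_dvd_one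
  have hex := hT.2.1
  suffices hh : ∃ r s : ℤ, Pres (Lat3 p (f+4)) (F3 p f r (p * s)) L by
    obtain ⟨r, s, hP⟩ := hh
    obtain ⟨i, v, hi, hv, ci, -⟩ := pdec hp r
    obtain ⟨j, u, hj, hu, cj, hj1⟩ := pdec hp (p * s)
    have hj1 := hj1 ⟨s, rfl⟩
    have hP : Pres (Lat3 p (f+4)) (F3 p f (p^i) (p^j)) L := chg3 hp hex hP u 0 0 v hu hv
      ((dvd_mul_of_dvd_left ci (-u)).trans (dvd_of_eq (by ring))) ((dvd_mul_of_dvd_left cj (-v)).trans (dvd_of_eq (by ring)))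
    by_cases hA : i < j ∨ i = 3
    · by_cases hB : j < i + f + 1 ∨ j = 3
      · exact ⟨(i, j), ⟨hi, hj1, hj, hA, hB⟩, hP⟩
      · refine ⟨(i, 3), ⟨hi, by simp, by simp, by simp only; omega, by simp⟩, ?_⟩
        obtain ⟨k, rfl⟩ : ∃ k, j = i + f + 1 + k := ⟨j - (i + f + 1), by omega⟩
        exact chg3 hp hex hP 1 (p^k) 0 1 n1 n1 ⟨0, by ring⟩ ⟨1, by ring⟩
    · refine ⟨(3, j), ⟨by simp, hj1, hj, by simp, by simp only; omega⟩, ?_⟩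
      obtain ⟨k, rfl⟩ : ∃ k, i = j + k := ⟨i - j, by omega⟩
      exact chg3 hp hex hP 1 0 (p^k) 1 n1 n1 ⟨1, by ring⟩ ⟨0, by ring⟩
  obtain ⟨A, s⟩ := L
  obtain ⟨hcard, hexp, x, hx0⟩ := hT
  rcases types hp hcard hexp x hx0 with ⟨y, ker⟩ | ⟨y, w, ker⟩ | h
  · simp only at x y ker hexp
    have surj : Function.Surjective (lin2 x y) := ker_surj (by rw [card3 _ ker]; exact hcard.symm)
    have ker' : ∀ i j : ℤ, i • x + j • y = 0 ↔ (p:ℤ)^(f+4) ∣ i ∧ (p:ℤ)^3 ∣ j := fun i j => by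
      have := ker (i,j); rwa [lin2_apply] at this
    obtain ⟨⟨A0, B0⟩, h0⟩ := surj (s.br x y)
    rw [lin2_apply] at h0
    have h0 := h0.symm
    simp only at h0
    have ye : ((p:ℤ)^3) • y = 0 := by simpa using (ker' 0 ((p:ℤ)^3)).2 (by simp)
    obtain ⟨a, rfl⟩ : (p:ℤ)^(f+1) ∣ A0 := by
      have : ((p:ℤ)^3) • s.br x y = 0 := by rw [← s.zsmul_r, ye, s.zero_r]
      rw [h0, smul_add, ← mul_smul, ← mul_smul, ker'] at this
      have := this.1
      rw [show (p:ℤ)^(f+4) = p^3 * p^(f+1) by ring] at this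
      exact (mul_dvd_mul_iff_left (pow_ne_zero 3 hp0)).1 this
    have sk : s.br y x = - s.br x y := s.skew _ _
    obtain ⟨β, rfl⟩ : (p:ℤ) ∣ B0 := by
      refine nil4 hp s x y B0 (fun k a => ∃ i j : ℤ, a = i • x + (k + p * j) • y) ⟨0, 0, by simp⟩ ?_ ?_
      · rintro k _ ⟨i, j, rfl⟩
        refine ⟨(k + p * j) * (p^(f+1) * a), j * B0, ?_⟩
        simp only [s.add_r, s.zsmul_r, s.self, h0]; module
      · rintro k ⟨i, j, h⟩
        have := (dvd_pow_self (p:ℤ) (show 3 ≠ 0 by omega)).trans ((ker' _ _).1 h.symm).2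
        rwa [dvs j rfl] at this
    refine ⟨a, β, lin2 x y, surj, ker, ?_⟩
    rintro ⟨v0, v1⟩ ⟨w0, w1⟩
    simp only [F3, lin2_apply]
    simp only [s.add_l, s.add_r, s.zsmul_l, s.zsmul_r, s.self, sk, h0]
    module
  · exfalso; apply n2
    have surj : Function.Surjective (lin3 x y w) := ker_surj (by rw [card21 _ ker]; exact hcard.symm)
    refine ⟨x, fun a => ?_⟩
    obtain ⟨v, rfl⟩ := surj a
    refine ⟨v.1, ?_⟩
    have : lin3 x y w v - v.1 • x = lin3 x y w (0, v.2) := by simp [lin3_apply]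
    simp only at this
    rw [this, ← map_nsmul, ker]
    have h1 : ∀ t : ℤ, (p:ℤ) ∣ p ^ 2 * t := fun t => (dvd_pow_self (p:ℤ) (by omega)).mul_right t
    simp [Lat21, h1]
  · exfalso; exact n2 (cyc12 ⟨x, by simpa using h⟩)

lemma pres_TT3 (hp : p.Prime) {L : LR} {F} (h : Pres (Lat3 p (f+4)) F L) : TT p (f+4) L ∧ ¬ cyc p 2 L := by
  obtain ⟨q, q1, q2, -⟩ := h
  refine ⟨⟨?_, fun a => ?_, q (1,0), ?_⟩, fun ⟨x, hx⟩ => pres3_ncyc hp (by omega) q1 q2 x hx⟩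
  · rw [← card3 q q2, AddMonoidHom.range_eq_top.2 q1, AddSubgroup.card_top]
  · obtain ⟨v, rfl⟩ := q1 a
    rw [← map_nsmul, q2]
    have h2 : ∀ t : ℤ, (p:ℤ)^3 ∣ p ^ (f+4) * t := fun t => (pow_dvd_pow (p:ℤ) (by omega)).mul_right t
    simp [Lat3, h2]
  · rw [← map_nsmul, Ne, q2]
    simp only [Lat3]
    intro h
    have := h.1
    simp at this
    have h2 := Int.le_of_dvd (by have := hp.pos; positivity) this
    have h3 : p ^ (f+3) < p ^ (f+4) := pow_lt_pow_right₀ hp.one_lt (by omega)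
    exact absurd h2 (not_le.2 (by exact_mod_cast h3))

lemma cnt3 (hp : p.Prime) {N : ℕ} (h : Cnt Eq (S3 f) N) :
    Cnt LIso (fun L => (TT p (f+4) L ∧ ¬ cyc p 1 L) ∧ ¬ cyc p 2 L) N := by
  refine h.bridge (fun L c => S3 f c ∧ Pres (Lat3 p (f+4)) (F3 p f (p^c.1) (p^c.2)) L) ?_ ?_ ?_ ?_ ?_ ?_
  · intro c hc
    obtain ⟨Λ, s, -, hP⟩ := ex3 (p := p) (f := f) (p^c.1) (p^(c.2-1))
    rw [← pow_succ', Nat.sub_add_cancel hc.2.1] at hP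
    obtain ⟨a, b⟩ := pres_TT3 hp hP
    exact ⟨_, ⟨⟨a, fun h => b (cyc12 h)⟩, b⟩, hc, hP⟩
  · rintro L ⟨⟨h1, h2⟩, h3⟩
    obtain ⟨c, hc, hP⟩ := cov3 hp h1 h3
    exact ⟨c, hc, hc, hP⟩
  · exact fun L L' c h h' => h.2.iso h'.2
  · exact fun L L' c h h' => ⟨h'.1, h'.2.tr h⟩
  · exact fun L c c' h h' => uniq3 hp h.1 h'.1 h.2 h'.2
  · rintro L c c' h rfl; exact h

lemma cS (f N : ℕ) (s : Finset (ℕ × ℕ)) (hs : s.card = N) (h : ∀ c, S3 f c ↔ c ∈ s) : Cnt Eq (S3 f) N :=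
  ⟨s, inferInstance, Subtype.val, by simp [hs], fun i => (h _).2 i.2, fun c hc => ⟨⟨c, (h c).1 hc⟩, rfl⟩, fun i j => Subtype.ext⟩

lemma c3 (f : ℕ) : Cnt Eq (S3 f) (if f = 0 then 6 else if f = 1 then 8 else 9) := by
  have e : ∀ a b c d : ℕ, ((a, b) : ℕ × ℕ) = (c, d) ↔ a = c ∧ b = d := by simp
  split_ifs with h h'
  · refine cS f 6 {(3,1),(3,2),(0,3),(1,3),(2,3),(3,3)} (by decide) ?_
    rintro ⟨i, j⟩; simp only [S3, Finset.mem_insert, Finset.mem_singleton, e]; omega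
  · refine cS f 8 {(3,1),(3,2),(0,3),(1,3),(2,3),(3,3),(0,1),(1,2)} (by decide) ?_
    rintro ⟨i, j⟩; simp only [S3, Finset.mem_insert, Finset.mem_singleton, e]; omega
  · refine cS f 9 {(3,1),(3,2),(0,3),(1,3),(2,3),(3,3),(0,1),(1,2),(0,2)} (by decide) ?_
    rintro ⟨i, j⟩; simp only [S3, Finset.mem_insert, Finset.mem_singleton, e]; omega
end t3

/-- For every prime `p ≥ 5` and every `n ≥ 7`,
`Ψ_{n,3}^p = 5p + 2·gcd(p-1,3) + gcd(p-1,4) + c(n)`, where `c(7) = 59`,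
`c(8) = 61` and `c(n) = 62` for `n ≥ 9`. -/
theorem psi_coexp_three_formula (p : ℕ) (hp : p.Prime) (hp5 : 5 ≤ p)
    (n : ℕ) (hn : 7 ≤ n) :
    PsiCoexp p n 3 =
      5 * p + 2 * Nat.gcd (p - 1) 3 + Nat.gcd (p - 1) 4 +
        (if n = 7 then 59 else if n = 8 then 61 else 62) := by
  haveI := Fact.mk hp
  obtain ⟨f, rfl⟩ : ∃ f, n = f + 7 := ⟨n - 7, by omega⟩
  have h1 : Cnt LIso (TT p (f + 4)) ((23 + Nat.gcd (p-1) 4 + 2 * Nat.gcd (p-1) 3) +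
      ((5 * p + 30) + (if f = 0 then 6 else if f = 1 then 8 else 9))) :=
    Cnt.split (cyc p 1) (fun c d _ _ h => ⟨cyc.iso h, cyc.iso h.symm⟩) (cnt111 (by omega) (c111 hp5))
      (Cnt.split (cyc p 2) (fun c d _ _ h => ⟨cyc.iso h, cyc.iso h.symm⟩) (cnt21 hp (c21 hp5)) (cnt3 hp (c3 f)))
  rw [psi_of_cnt hp hp5 hn h1]
  split_ifs <;> omega
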